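/- arXiv:2411.09060 — 3 statements merged into one kernel-verified Lean document; each statement's English description precedes it below -/
import Mathlib

section
/- There exists a positive integer n₀ such that for all integers n ≥ n₀ and b ≥ 2, every prime p ≥ 7, and every negative integer a divisible by p, if n! = (b^p − 1)/(b − 1) + a, then |a| ≥ 0.5·(log log log n)/(log log log log n). -/
section

open Finset

namespace RepunitFactorial

theorem sum_log_primesLE_le (n : ℕ) :
    ∑ q ∈ Nat.primesLE n, Real.log q ≤ Real.log 4 * n := by
  rw [← Chebyshev.theta_eq_sum_primesLE_log]
  exact Chebyshev.theta_le_log4_mul_x (Nat.cast_nonneg n)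

theorem sum_log_div_sq_Icc_le (N : ℕ) (hN : 1 ≤ N) :
    ∑ k ∈ Finset.Icc 1 N, Real.log k / (k : ℝ) ^ 2 ≤ 4 - 4 / √(N : ℝ) := by
  induction N, hN using Nat.le_induction with
  | base => simp
  | succ k hk ih =>
    rw [Finset.sum_Icc_succ_top (by omega)]
    have hkpos : (0 : ℝ) < k := by exact_mod_cast hk
    have hs : 0 < √(k : ℝ) := Real.sqrt_pos.mpr hkpos
    have ht : 0 < √((k + 1 : ℕ) : ℝ) := Real.sqrt_pos.mpr (by positivity)
    have hs2 : √(k : ℝ) ^ 2 = k := Real.sq_sqrt hkpos.le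
    have ht2 : √((k + 1 : ℕ) : ℝ) ^ 2 = k + 1 := by
      rw [Real.sq_sqrt (by positivity)]; push_cast; ring
    have hst : √(k : ℝ) ≤ √((k + 1 : ℕ) : ℝ) := Real.sqrt_le_sqrt (by push_cast; linarith)
    have hcast : ((k + 1 : ℕ) : ℝ) = √((k + 1 : ℕ) : ℝ) ^ 2 := by rw [ht2]; push_cast; ring
    set s := √(k : ℝ)
    set t := √((k + 1 : ℕ) : ℝ)
    have hlog : Real.log ((k + 1 : ℕ) : ℝ) ≤ 2 * t := by
      rw [hcast, Real.log_pow]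
      have := Real.log_le_sub_one_of_pos ht
      push_cast; linarith
    have h1 : Real.log ((k + 1 : ℕ) : ℝ) / ((k + 1 : ℕ) : ℝ) ^ 2 ≤ 2 / t ^ 3 := by
      calc _ ≤ 2 * t / ((k + 1 : ℕ) : ℝ) ^ 2 := by gcongr
        _ = 2 / t ^ 3 := by rw [hcast]; field_simp
    have h2 : 2 / t ^ 3 ≤ 4 / s - 4 / t := by
      have : 4 / s - 4 / t = 4 / (s * t * (s + t)) := by
        have h3 : (t - s) * (t + s) = 1 := by nlinarith
        field_simp
        linarith
      rw [this, div_le_div_iff₀ (by positivity) (by positivity)]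
      have h4 : s * t * (s + t) ≤ t * t * (t + t) := by gcongr
      nlinarith
    linarith

theorem sum_log_div_sq_primesLE_le (n : ℕ) :
    ∑ q ∈ Nat.primesLE n, Real.log q / (q : ℝ) ^ 2 ≤ 4 := by
  rcases Nat.eq_zero_or_pos n with rfl | hn
  · simp
  calc _ ≤ ∑ k ∈ Finset.Icc 1 n, Real.log k / (k : ℝ) ^ 2 := by
        refine Finset.sum_le_sum_of_subset_of_nonneg ?_ ?_
        · intro q hq
          rw [Nat.mem_primesLE] at hq
          exact Finset.mem_Icc.mpr ⟨hq.2.one_lt.le, hq.1⟩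
        · intro k _ _
          positivity
    _ ≤ 4 - 4 / √(n : ℝ) := sum_log_div_sq_Icc_le n hn
    _ ≤ 4 := by
        have : 0 ≤ 4 / √(n : ℝ) := by positivity
        linarith

theorem log_factorial_eq_sum (n : ℕ) :
    Real.log (n.factorial : ℝ) =
      ∑ q ∈ Nat.primesLE n, (n.factorial.factorization q : ℝ) * Real.log q := by
  conv_lhs => rw [← Nat.prod_factorization_pow_eq_self n.factorial_ne_zero]
  rw [Finsupp.prod]
  push_cast
  rw [Real.log_prod]
  · simp_rw [Real.log_pow]
    refine Finset.sum_subset ?_ ?_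
    · intro q hq
      rw [Nat.support_factorization, Nat.mem_primeFactors] at hq
      rw [Nat.mem_primesLE]
      exact ⟨(hq.1.dvd_factorial).mp hq.2.1, hq.1⟩
    · intro q _ hq
      rw [Finsupp.notMem_support_iff.mp hq]
      simp
  · intro q hq
    rw [Nat.support_factorization, Nat.mem_primeFactors] at hq
    have := hq.1.pos
    positivity

theorem factorization_factorial_le (n : ℕ) {q : ℕ} (hq : q.Prime) :
    (n.factorial.factorization q : ℝ) ≤ n / q + 2 * (n / q ^ 2) := by
  have h1 : (n.factorial.factorization q : ℝ) ≤ (n : ℝ) / ((q - 1 : ℕ) : ℝ) :=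
    (Nat.cast_le.mpr (Nat.factorization_factorial_le_div_pred hq n)).trans Nat.cast_div_le
  have hq2 : (2 : ℝ) ≤ q := by exact_mod_cast hq.two_le
  refine h1.trans ?_
  rw [Nat.cast_sub hq.one_le, Nat.cast_one]
  have : (n : ℝ) / q + 2 * (n / q ^ 2) - n / (q - 1) = n * (q - 2) / (q ^ 2 * (q - 1)) := by
    have : (q : ℝ) - 1 ≠ 0 := by linarith
    field_simp
    ring
  have h3 : 0 ≤ (n : ℝ) * (q - 2) / (q ^ 2 * (q - 1)) := by
    apply div_nonneg
    · exact mul_nonneg (Nat.cast_nonneg n) (by linarith)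
    · exact mul_nonneg (by positivity) (by linarith)
  linarith

/-- A Mertens-type lower bound for the primes up to `n` outside a set `S` carrying only a part
of the size of `n!`. -/
theorem log_sub_le_sum_log_div {n : ℕ} (hn : 1 ≤ n) {S : Finset ℕ} (hS : S ⊆ Nat.primesLE n)
    {V : ℝ} (hV : ∑ q ∈ S, (n.factorial.factorization q : ℝ) * Real.log q ≤ V * n) :
    Real.log n - 9 - V ≤ ∑ q ∈ Nat.primesLE n \ S, Real.log q / q := by
  have hn0 : (0 : ℝ) < n := by exact_mod_cast hn
  have h1 := Stirling.le_log_factorial_stirling (n := n) (by omega)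
  have h2 := log_factorial_eq_sum n
  rw [← Finset.sum_sdiff hS] at h2
  have h3 : ∑ q ∈ Nat.primesLE n \ S, (n.factorial.factorization q : ℝ) * Real.log q ≤
      ∑ q ∈ Nat.primesLE n \ S, (n * (Real.log q / q) + 2 * n * (Real.log q / q ^ 2)) := by
    refine Finset.sum_le_sum fun q hq => ?_
    have hqp := (Nat.mem_primesLE.mp (Finset.mem_sdiff.mp hq).1).2
    calc _ ≤ (n / q + 2 * (n / q ^ 2)) * Real.log q := by
          gcongr
          exact factorization_factorial_le n hqp
      _ = _ := by ring
  rw [Finset.sum_add_distrib, ← Finset.mul_sum, ← Finset.mul_sum] at h3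
  have h4 : ∑ q ∈ Nat.primesLE n \ S, Real.log q / (q : ℝ) ^ 2 ≤ 4 :=
    (Finset.sum_le_sum_of_subset_of_nonneg Finset.sdiff_subset
      fun k _ _ => by positivity).trans (sum_log_div_sq_primesLE_le n)
  have h5 : 0 ≤ Real.log n := by positivity
  have h6 : 0 ≤ Real.log (2 * Real.pi) :=
    Real.log_nonneg (by have := Real.pi_gt_three; linarith)
  have h7 : n * Real.log n - n ≤
      n * ∑ q ∈ Nat.primesLE n \ S, Real.log q / q + 8 * n + V * n := by nlinarith
  have h8 : n * (Real.log n - 9 - V) ≤ n * ∑ q ∈ Nat.primesLE n \ S, Real.log q / q := by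
    nlinarith
  exact le_of_mul_le_mul_left h8 hn0

theorem sum_log_primeFactors_le {N : ℕ} (hN : N ≠ 0) :
    ∑ q ∈ N.primeFactors, Real.log q ≤ Real.log N := by
  rw [← Real.log_prod]
  · apply Real.log_le_log
    · refine Finset.prod_pos fun q hq => ?_
      exact_mod_cast (Nat.prime_of_mem_primeFactors hq).pos
    · rw [← Nat.cast_prod]
      exact_mod_cast Nat.le_of_dvd (Nat.pos_of_ne_zero hN) (Nat.prod_primeFactors_dvd N)
  · intro q hq
    exact_mod_cast (Nat.prime_of_mem_primeFactors hq).ne_zero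

open Polynomial in
/-- The repunit polynomial `1 + X + ⋯ + X ^ (p - 1)` shifted by a constant. -/
noncomputable def shiftedRepunit (p : ℕ) (A : ℤ) : ℤ[X] := ∑ i ∈ Finset.range p, X ^ i - C A

open Polynomial in
theorem eval_shiftedRepunit (p : ℕ) (A b : ℤ) :
    (shiftedRepunit p A).eval b = ∑ i ∈ Finset.range p, b ^ i - A := by
  simp [shiftedRepunit, eval_finsetSum]

open Polynomial in
theorem shiftedRepunit_eq (p : ℕ) (hp : 2 ≤ p) (A : ℤ) :
    shiftedRepunit p A = X ^ (p - 1) + (∑ i ∈ Finset.range (p - 1), X ^ i - C A) := by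
  obtain ⟨k, rfl⟩ : ∃ k, p = k + 1 := ⟨p - 1, by omega⟩
  rw [shiftedRepunit, Finset.sum_range_succ]
  simp only [Nat.add_sub_cancel]
  ring

open Polynomial in
theorem degree_shiftedRepunit_tail (p : ℕ) (hp : 2 ≤ p) (A : ℤ) :
    (∑ i ∈ Finset.range (p - 1), (X : ℤ[X]) ^ i - C A).degree < ((p - 1 : ℕ) : WithBot ℕ) := by
  have h0 : (0 : WithBot ℕ) < ((p - 1 : ℕ) : WithBot ℕ) := by
    exact_mod_cast (show 0 < p - 1 by omega)
  refine (degree_sub_le _ _).trans_lt (max_lt ?_ (degree_C_le.trans_lt h0))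
  refine (degree_sum_le _ _).trans_lt ?_
  rw [Finset.sup_lt_iff (bot_lt_iff_ne_bot.mpr (by simp))]
  intro i hi
  rw [degree_X_pow]
  exact_mod_cast Finset.mem_range.mp hi

open Polynomial in
theorem monic_shiftedRepunit (p : ℕ) (hp : 2 ≤ p) (A : ℤ) : (shiftedRepunit p A).Monic := by
  rw [shiftedRepunit_eq p hp]
  exact monic_X_pow_add (degree_shiftedRepunit_tail p hp A)

open Polynomial in
theorem natDegree_shiftedRepunit (p : ℕ) (hp : 2 ≤ p) (A : ℤ) :
    (shiftedRepunit p A).natDegree = p - 1 := by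
  rw [shiftedRepunit_eq p hp]
  apply natDegree_eq_of_degree_eq_some
  rw [degree_add_eq_left_of_degree_lt] <;> rw [degree_X_pow]
  exact degree_shiftedRepunit_tail p hp A

open Polynomial in
theorem map_shiftedRepunit {p : ℕ} [Fact p.Prime] {A : ℤ} (hA : (p : ℤ) ∣ A) :
    (shiftedRepunit p A).map (Int.castRingHom (ZMod p)) = (X - C 1) ^ (p - 1) := by
  have hA0 : (A : ZMod p) = 0 := (ZMod.intCast_zmod_eq_zero_iff_dvd A p).mpr hA
  have h1 : (shiftedRepunit p A).map (Int.castRingHom (ZMod p)) =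
      ∑ i ∈ Finset.range p, X ^ i := by
    have hC : (A : (ZMod p)[X]) = 0 := by simpa using congrArg C hA0
    simp [shiftedRepunit, Polynomial.map_sum, hC]
  have hne : (X - C 1 : (ZMod p)[X]) ≠ 0 := X_sub_C_ne_zero 1
  apply mul_right_cancel₀ hne
  rw [h1, ← pow_succ, Nat.sub_add_cancel (Fact.out : p.Prime).one_le, sub_pow_char]
  simpa using geom_sum_mul (X : (ZMod p)[X]) p

open Polynomial in
theorem dvd_eval_one_of_map_eq {p : ℕ} [Fact p.Prime] {U : ℤ[X]} (hU : U.Monic)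
    (hdvd : U.map (Int.castRingHom (ZMod p)) ∣ (X - C 1) ^ (p - 1)) (hdeg : 2 ≤ U.natDegree) :
    (p : ℤ) ∣ U.eval 1 ∧ (p : ℤ) ∣ U.derivative.eval 1 := by
  obtain ⟨i, _, hi⟩ := (dvd_prime_pow (prime_X_sub_C (1 : ZMod p)) _).mp hdvd
  have hmon : (U.map (Int.castRingHom (ZMod p))).Monic := hU.map _
  have heq := eq_of_monic_of_associated hmon ((monic_X_sub_C (1 : ZMod p)).pow i) hi
  have hi2 : 2 ≤ i := by
    have := congrArg natDegree heq
    rw [hU.natDegree_map, natDegree_pow, natDegree_X_sub_C, mul_one] at this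
    omega
  have key : ∀ W : ℤ[X], (W.map (Int.castRingHom (ZMod p))).eval 1 = 0 → (p : ℤ) ∣ W.eval 1 := by
    intro W hW
    rw [← ZMod.intCast_zmod_eq_zero_iff_dvd]
    have := eval_intCast_map (Int.castRingHom (ZMod p)) W 1
    simp only [Int.cast_one, eq_intCast] at this
    rw [← this, hW]
  refine ⟨key _ ?_, key _ ?_⟩
  · rw [heq]
    simp [show i ≠ 0 by omega]
  · rw [← derivative_map, heq, derivative_pow]
    simp [show i - 1 ≠ 0 by omega]

open Polynomial in
theorem natDegree_le_one_of_mul_eq_shiftedRepunit {p : ℕ} (hp : p.Prime) (hp3 : 3 ≤ p) {A : ℤ}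
    (hA : (p : ℤ) ∣ A) {U V : ℤ[X]} (hU : U.Monic) (hV : V.Monic)
    (hUV : U * V = shiftedRepunit p A) : U.natDegree ≤ 1 ∨ V.natDegree ≤ 1 := by
  by_contra! hcon
  have : Fact p.Prime := ⟨hp⟩
  have hmap := map_shiftedRepunit (p := p) hA
  rw [← hUV, Polynomial.map_mul] at hmap
  obtain ⟨⟨u0, hu0⟩, ⟨u1, hu1⟩⟩ := dvd_eval_one_of_map_eq hU (Dvd.intro _ hmap) hcon.1
  obtain ⟨⟨v0, hv0⟩, ⟨v1, hv1⟩⟩ := dvd_eval_one_of_map_eq hV (Dvd.intro_left _ hmap) hcon.2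
  have hder := congrArg (fun P => (derivative P).eval 1) hUV
  simp only [derivative_mul, eval_add, eval_mul, hu0, hu1, hv0, hv1, shiftedRepunit,
    derivative_sub, derivative_sum, derivative_X_pow, derivative_C, sub_zero, eval_finsetSum,
    eval_natCast, eval_pow, eval_X, one_pow, mul_one, map_natCast] at hder
  have hsum := Finset.sum_range_id_mul_two p
  have hsum' : (∑ i ∈ Finset.range p, (i : ℤ)) * 2 = p * (p - 1) := by
    have : ((p - 1 : ℕ) : ℤ) = p - 1 := by rw [Nat.cast_sub hp.one_le]; simp
    rw [← this, ← Nat.cast_sum]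
    exact_mod_cast hsum
  rw [← hder] at hsum'
  have hp0 : (p : ℤ) ≠ 0 := by exact_mod_cast hp.ne_zero
  have h1 : (p : ℤ) * ((u1 * v0 + u0 * v1) * 2) = p - 1 := by
    apply mul_left_cancel₀ hp0
    linear_combination hsum'
  have h2 : (p : ℤ) ∣ 1 := ⟨1 - (u1 * v0 + u0 * v1) * 2, by linear_combination h1⟩
  have := Int.le_of_dvd one_pos h2
  omega

open Polynomial in
theorem exists_irreducible_factor_shiftedRepunit {p : ℕ} (hp : p.Prime) (hp7 : 7 ≤ p) {A : ℤ}
    (hA : (p : ℤ) ∣ A) : ∃ h : ℤ[X], h.Monic ∧ Irreducible h ∧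
      ((h.natDegree = p - 1 ∧ shiftedRepunit p A = h) ∨
        (h.natDegree = p - 2 ∧ ∃ r : ℤ, shiftedRepunit p A = (X - C r) * h)) := by
  have hmon := monic_shiftedRepunit p (by omega) A
  have hdeg := natDegree_shiftedRepunit p (by omega) A
  by_cases hirr : Irreducible (shiftedRepunit p A)
  · exact ⟨_, hmon, hirr, Or.inl ⟨hdeg, rfl⟩⟩
  have hne1 : ∀ W : ℤ[X], W.Monic → W ≠ 1 → 1 ≤ W.natDegree := by
    intro W hW hW1
    by_contra! h0
    exact hW1 (hW.natDegree_eq_zero.mp (by omega))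
  have main : ∀ U V : ℤ[X], U.Monic → V.Monic → U ≠ 1 → U * V = shiftedRepunit p A →
      U.natDegree ≤ 1 → ∃ h : ℤ[X], h.Monic ∧ Irreducible h ∧
        (h.natDegree = p - 2 ∧ ∃ r : ℤ, shiftedRepunit p A = (X - C r) * h) := by
    intro U V hU hV hU1 hUV hUd
    have hUd1 : U.natDegree = 1 := le_antisymm hUd (hne1 U hU hU1)
    have hVd : V.natDegree = p - 2 := by
      have := congrArg natDegree hUV
      rw [hU.natDegree_mul hV, hdeg] at this
      omega
    refine ⟨V, hV, ?_, hVd, -U.coeff 0, ?_⟩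
    · have hV1 : V ≠ 1 := by
        rintro rfl
        rw [natDegree_one] at hVd
        omega
      rw [irreducible_of_monic hV hV1]
      intro V1 V2 hV1m hV2m h12
      by_contra! hcon
      have e1 := hne1 V1 hV1m hcon.1
      have e2 := hne1 V2 hV2m hcon.2
      have e3 := congrArg natDegree h12
      rw [hV1m.natDegree_mul hV2m, hVd] at e3
      have k1 := natDegree_le_one_of_mul_eq_shiftedRepunit hp (by omega) hA (hU.mul hV1m) hV2m
        (by rw [mul_assoc, h12, hUV])
      have k2 := natDegree_le_one_of_mul_eq_shiftedRepunit hp (by omega) hA (hU.mul hV2m) hV1m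
        (by rw [mul_assoc, mul_comm V2, h12, hUV])
      rw [hU.natDegree_mul hV1m] at k1
      rw [hU.natDegree_mul hV2m] at k2
      omega
    · rw [← hUV, hU.eq_X_add_C hUd1]
      simp
  have hF1 : shiftedRepunit p A ≠ 1 := by
    intro h
    rw [h, natDegree_one] at hdeg
    omega
  rw [irreducible_of_monic hmon hF1] at hirr
  push Not at hirr
  obtain ⟨U, V, hU, hV, hUV, hU1, hV1⟩ := hirr
  rcases natDegree_le_one_of_mul_eq_shiftedRepunit hp (by omega) hA hU hV hUV with h | h
  · obtain ⟨w, a, b, c⟩ := main U V hU hV hU1 hUV h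
    exact ⟨w, a, b, Or.inr c⟩
  · obtain ⟨w, a, b, c⟩ := main V U hV hU hV1 (by rw [mul_comm, hUV]) h
    exact ⟨w, a, b, Or.inr c⟩

section PowerEval

variable {R : Type*} [CommRing R] {m : ℕ}

/-- The value at `α` of the polynomial of degree less than `m` with coefficient vector `v`. -/
def powerEval (α : R) (v : Fin m → ℤ) : R := ∑ i, (v i : R) * α ^ (i : ℕ)

theorem powerEval_add (α : R) (v w : Fin m → ℤ) :
    powerEval α (v + w) = powerEval α v + powerEval α w := by
  simp [powerEval, add_mul, Finset.sum_add_distrib]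

theorem powerEval_sub (α : R) (v w : Fin m → ℤ) :
    powerEval α (v - w) = powerEval α v - powerEval α w := by
  simp [powerEval, sub_mul, Finset.sum_sub_distrib]

theorem exists_powerEval_eq_mul {α : R} {c : Fin m → ℤ} (hc : α ^ m = powerEval α c) {G : ℕ}
    (hcG : ∀ i, |c i| ≤ G) {k : ℤ} {v : Fin m → ℤ} (hv : ∀ i, |v i| ≤ k) :
    ∃ w : Fin m → ℤ, powerEval α w = powerEval α v * α ∧ ∀ i, |w i| ≤ (1 + G) * k := by
  cases m with
  | zero => exact ⟨v, by simp [powerEval], fun i => i.elim0⟩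
  | succ n =>
    have hk : 0 ≤ k := (abs_nonneg _).trans (hv 0)
    have hmul : ∀ i, |v (Fin.last n) * c i| ≤ G * k := fun i => by
      rw [abs_mul, mul_comm]
      exact mul_le_mul (hcG i) (hv _) (abs_nonneg _) (by positivity)
    refine ⟨fun i => (Fin.cases 0 (fun j => v j.castSucc) i : ℤ) + v (Fin.last n) * c i, ?_, ?_⟩
    · have h1 : powerEval α v * α
          = ∑ i : Fin n, (v i.castSucc : R) * α ^ ((i : ℕ) + 1)
            + (v (Fin.last n) : R) * powerEval α c := by
        rw [← hc, powerEval, Fin.sum_univ_castSucc, add_mul, Finset.sum_mul]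
        congr 1
        · exact Finset.sum_congr rfl fun i _ => by simp; ring
        · simp; ring
      rw [h1, powerEval]
      push_cast
      simp only [add_mul, Finset.sum_add_distrib]
      congr 1
      · rw [Fin.sum_univ_succ]; simp
      · rw [powerEval, Finset.mul_sum]
        exact Finset.sum_congr rfl fun i _ => by ring
    · intro i
      refine (abs_add_le _ _).trans ?_
      rw [add_mul, one_mul]
      refine add_le_add ?_ (hmul i)
      refine Fin.cases ?_ (fun j => ?_) i
      · simpa using hk
      · simpa using hv _

theorem exists_powerEval_eq_mul_pow {α : R} {c : Fin m → ℤ} (hc : α ^ m = powerEval α c) {G : ℕ}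
    (hcG : ∀ i, |c i| ≤ G) {k : ℤ} {v : Fin m → ℤ} (hv : ∀ i, |v i| ≤ k) (j : ℕ) :
    ∃ w : Fin m → ℤ, powerEval α w = powerEval α v * α ^ j ∧ ∀ i, |w i| ≤ (1 + G) ^ j * k := by
  induction j with
  | zero => exact ⟨v, by simp, by simpa using hv⟩
  | succ j ih =>
    obtain ⟨w, hw, hw'⟩ := ih
    obtain ⟨u, hu, hu'⟩ := exists_powerEval_eq_mul hc hcG hw'
    exact ⟨u, by rw [hu, hw]; ring, fun i => (hu' i).trans_eq (by ring)⟩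

/-- Every ideal contains a nonzero value of a short coefficient vector. -/
theorem exists_powerEval_mem (α : R) (I : Ideal R) [Finite (R ⧸ I)] {k : ℕ}
    (hk : Nat.card (R ⧸ I) < (k + 1) ^ m) :
    ∃ w : Fin m → ℤ, w ≠ 0 ∧ (∀ i, |w i| ≤ k) ∧ powerEval α w ∈ I := by
  have := Fintype.ofFinite (R ⧸ I)
  have hcard : Fintype.card (R ⧸ I) < Fintype.card (Fin m → Fin (k + 1)) := by
    simpa [Nat.card_eq_fintype_card] using hk
  obtain ⟨u, v, huv, h⟩ := Fintype.exists_ne_map_eq_of_card_lt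
    (fun v : Fin m → Fin (k + 1) =>
      Ideal.Quotient.mk I (powerEval α fun i => ((v i : ℕ) : ℤ))) hcard
  refine ⟨(fun i => ((u i : ℕ) : ℤ)) - fun i => ((v i : ℕ) : ℤ), ?_, fun i => ?_, ?_⟩
  · intro h0
    apply huv
    ext i
    have := congrFun h0 i
    simp only [Pi.sub_apply, Pi.zero_apply] at this
    omega
  · have h1 := (u i).2
    have h2 := (v i).2
    simp only [Pi.sub_apply]
    rw [abs_le]
    constructor <;> omega
  · rw [powerEval_sub]
    exact Ideal.Quotient.eq.1 h

end PowerEval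

section Covering

open NumberField

variable {L : Type*} [Field L] [NumberField L] {m : ℕ} {α : 𝓞 L}

theorem algebraMap_powerEval (v : Fin m → ℤ) :
    ((powerEval α v : 𝓞 L) : L) = ∑ i, (v i : ℚ) • (α : L) ^ (i : ℕ) := by
  simp [powerEval, Algebra.smul_def]

theorem powerEval_ne_zero (hli : LinearIndependent ℚ fun i : Fin m => (α : L) ^ (i : ℕ))
    {v : Fin m → ℤ} (hv : v ≠ 0) : powerEval α v ≠ 0 := by
  intro h
  apply hv
  have h1 : algebraMap (𝓞 L) L (powerEval α v) = ∑ i, (v i : ℚ) • (α : L) ^ (i : ℕ) :=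
    algebraMap_powerEval v
  rw [h, map_zero] at h1
  ext i
  exact_mod_cast Fintype.linearIndependent_iff.1 hli _ h1.symm i

/-- Modulo an ideal of norm less than `(k + 1) ^ m`, every coefficient vector is congruent to one
of sup norm at most a constant times `k`. -/
theorem exists_powerEval_congr (hli : LinearIndependent ℚ fun i : Fin m => (α : L) ^ (i : ℕ))
    (hm : Module.finrank ℚ L = m) {c : Fin m → ℤ} (hc : α ^ m = powerEval α c) {G : ℕ}
    (hcG : ∀ i, |c i| ≤ G) {I : Ideal (𝓞 L)} (hI : I ≠ ⊥) {k : ℕ}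
    (hk : Ideal.absNorm I < (k + 1) ^ m) (x : Fin m → ℤ) :
    ∃ s : Fin m → ℤ, powerEval α x - powerEval α s ∈ I ∧
      ∀ i, |s i| ≤ m * (1 + G) ^ m * k := by
  have hfin : Finite (𝓞 L ⧸ I) :=
    (Ideal.absNorm_ne_zero_iff I).1 (by rwa [Ne, Ideal.absNorm_eq_zero_iff])
  obtain ⟨w, hw0, hwk, hwI⟩ := exists_powerEval_mem α I (m := m) (k := k) hk
  choose a ha hak using exists_powerEval_eq_mul_pow hc hcG hwk
  have hpos : 0 < m := by
    rw [← hm]; exact Module.finrank_pos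
  have : Nonempty (Fin m) := ⟨⟨0, hpos⟩⟩
  have hspan := hli.span_eq_top_of_card_eq_finrank (by simp [hm])
  have hwL : ((powerEval α w : 𝓞 L) : L) ≠ 0 := by
    simpa using powerEval_ne_zero hli hw0
  obtain ⟨q, hq⟩ : ∃ q : Fin m → ℚ,
      ∑ j, q j • (α : L) ^ (j : ℕ) = ((powerEval α x : 𝓞 L) : L) / ((powerEval α w : 𝓞 L) : L) := by
    have : ((powerEval α x : 𝓞 L) : L) / ((powerEval α w : 𝓞 L) : L) ∈
        Submodule.span ℚ (Set.range fun i : Fin m => (α : L) ^ (i : ℕ)) := by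
      rw [hspan]; trivial
    exact (Submodule.mem_span_range_iff_exists_fun ℚ).1 this
  have hx : ∀ i, (x i : ℚ) = ∑ j : Fin m, q j * a j i := by
    have h1 : ∑ i, ((x i : ℚ) - ∑ j : Fin m, q j * a j i) • (α : L) ^ (i : ℕ) = 0 := by
      have h2 : ((powerEval α x : 𝓞 L) : L) =
          ∑ j : Fin m, q j • ((powerEval α (a j) : 𝓞 L) : L) := by
        have : ((powerEval α x : 𝓞 L) : L) =
            ((powerEval α w : 𝓞 L) : L) * ∑ j, q j • (α : L) ^ (j : ℕ) := by
          rw [hq, mul_div_cancel₀ _ hwL]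
        rw [this, Finset.mul_sum]
        refine Finset.sum_congr rfl fun j _ => ?_
        rw [ha, mul_smul_comm]
        simp
      simp only [sub_smul, Finset.sum_sub_distrib, ← algebraMap_powerEval]
      rw [h2]
      simp only [algebraMap_powerEval, Finset.smul_sum, Finset.sum_smul, smul_smul]
      rw [Finset.sum_comm, sub_self]
    intro i
    exact sub_eq_zero.1 (Fintype.linearIndependent_iff.1 hli _ h1 i)
  refine ⟨x - ∑ j : Fin m, ⌊q j⌋ • a j, ?_, fun i => ?_⟩
  · rw [← powerEval_sub, sub_sub_cancel]
    have : powerEval α (∑ j : Fin m, ⌊q j⌋ • a j) =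
        ∑ j : Fin m, (⌊q j⌋ : 𝓞 L) * powerEval α (a j) := by
      simp only [powerEval, Finset.sum_apply, Pi.smul_apply, smul_eq_mul, Int.cast_sum,
        Int.cast_mul, Finset.sum_mul, Finset.mul_sum, mul_assoc]
      rw [Finset.sum_comm]
    rw [this]
    refine Ideal.sum_mem _ fun j _ => Ideal.mul_mem_left _ _ ?_
    rw [ha]
    exact Ideal.mul_mem_right _ _ hwI
  · have h1 : (((x - ∑ j : Fin m, ⌊q j⌋ • a j) i : ℤ) : ℚ) =
        ∑ j : Fin m, Int.fract (q j) * a j i := by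
      simp only [Pi.sub_apply, Finset.sum_apply, Pi.smul_apply, smul_eq_mul, Int.cast_sub,
        Int.cast_sum, Int.cast_mul, hx i, ← Finset.sum_sub_distrib, ← sub_mul]
      rfl
    have h2 : |(((x - ∑ j : Fin m, ⌊q j⌋ • a j) i : ℤ) : ℚ)| ≤ m * (1 + G) ^ m * k := by
      rw [h1]
      refine (Finset.abs_sum_le_sum_abs _ _).trans ?_
      have : ∀ j ∈ (Finset.univ : Finset (Fin m)),
          |Int.fract (q j) * (a j i : ℚ)| ≤ (1 + G) ^ m * k := fun j _ => by
        rw [abs_mul, abs_of_nonneg (Int.fract_nonneg _)]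
        have h3 : |(a j i : ℚ)| ≤ (1 + G) ^ (j : ℕ) * k := by exact_mod_cast hak j i
        have h4 : ((1 + G : ℚ)) ^ (j : ℕ) ≤ (1 + G) ^ m :=
          pow_le_pow_right₀ (by simp) j.2.le
        calc Int.fract (q j) * |(a j i : ℚ)| ≤ 1 * |(a j i : ℚ)| :=
              mul_le_mul_of_nonneg_right (Int.fract_lt_one _).le (abs_nonneg _)
          _ ≤ (1 + G) ^ (j : ℕ) * k := by simpa using h3
          _ ≤ _ := by gcongr
      refine (Finset.sum_le_sum this).trans ?_
      simp [mul_assoc]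
    exact_mod_cast h2

/-- If the values of the vectors `y j` are pairwise incongruent modulo `I`, then a box of side `X`
contains at most `(X + 2 C k) ^ m / |ι|` vectors with value in `I`. -/
theorem card_powerEval_mem_mul_card_le
    (hli : LinearIndependent ℚ fun i : Fin m => (α : L) ^ (i : ℕ))
    (hm : Module.finrank ℚ L = m) {c : Fin m → ℤ} (hc : α ^ m = powerEval α c) {G : ℕ}
    (hcG : ∀ i, |c i| ≤ G) {I : Ideal (𝓞 L)} (hI : I ≠ ⊥) {k : ℕ}
    (hk : Ideal.absNorm I < (k + 1) ^ m) {ι : Type*} [Fintype ι] (y : ι → Fin m → ℤ)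
    (hy : ∀ i j, powerEval α (y i) - powerEval α (y j) ∈ I → i = j)
    (B : Finset (Fin m → ℤ)) (o : Fin m → ℤ) (X : ℕ)
    (hB : ∀ v ∈ B, powerEval α v ∈ I ∧ ∀ i, o i ≤ v i ∧ v i < o i + X) :
    B.card * Fintype.card ι ≤ (X + 2 * (m * (1 + G) ^ m * k)) ^ m := by
  classical
  choose s hs hsk using fun j => exists_powerEval_congr hli hm hc hcG hI hk (y j)
  set K := m * (1 + G) ^ m * k with hK
  have hsK : ∀ j i, |s j i| ≤ K := fun j i => by
    have := hsk j i
    rw [hK]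
    exact_mod_cast this
  have hmaps : ∀ z ∈ B ×ˢ (Finset.univ : Finset ι), z.1 + s z.2 ∈
      Fintype.piFinset fun i => Finset.Ico (o i - K) (o i + X + K) := by
    intro z hz
    rw [Finset.mem_product] at hz
    rw [Fintype.mem_piFinset]
    intro i
    have h1 := (hB z.1 hz.1).2 i
    have h2 := abs_le.1 (hsK z.2 i)
    rw [Finset.mem_Ico, Pi.add_apply]
    constructor <;> omega
  have hinj : Set.InjOn (fun z : (Fin m → ℤ) × ι => z.1 + s z.2)
      (B ×ˢ (Finset.univ : Finset ι) : Finset _) := by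
    intro z hz z' hz' h
    rw [Finset.mem_coe, Finset.mem_product] at hz hz'
    have h1 : powerEval α z.1 + powerEval α (s z.2) = powerEval α z'.1 + powerEval α (s z'.2) := by
      rw [← powerEval_add, ← powerEval_add]
      exact congrArg _ h
    have h2 : z.2 = z'.2 := by
      apply hy
      have h3 := I.sub_mem (I.sub_mem (I.add_mem (hs z.2) (hB _ hz'.1).1) (hB _ hz.1).1) (hs z'.2)
      convert h3 using 1
      linear_combination h1
    have h4 : z.1 = z'.1 := by
      have h' : z.1 + s z.2 = z'.1 + s z'.2 := h
      rw [h2] at h'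
      exact add_right_cancel h'
    exact Prod.ext h4 h2
  have := Finset.card_le_card_of_injOn _ hmaps hinj
  rw [Finset.card_product, Finset.card_univ, Fintype.card_piFinset] at this
  refine this.trans_eq ?_
  simp only [Int.card_Ico]
  rw [Finset.prod_congr rfl (fun i _ => show (o i + X + K - (o i - K)).toNat = X + 2 * K by omega)]
  simp

end Covering

section IdealNorm

open NumberField

variable {L : Type*} [Field L] [NumberField L]

theorem absNorm_pos {I : Ideal (𝓞 L)} (hI : I ≠ ⊥) : 0 < Ideal.absNorm I :=
  Nat.pos_of_ne_zero fun h => hI (Ideal.absNorm_eq_zero_iff.1 h)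

omit [NumberField L] in
theorem span_singleton_ne_bot {x : 𝓞 L} (hx : x ≠ 0) : Ideal.span {x} ≠ ⊥ := by
  simpa using hx

theorem absNorm_le_of_mem {I : Ideal (𝓞 L)} {x : 𝓞 L} (hx : x ≠ 0) (h : x ∈ I) :
    Ideal.absNorm I ≤ Ideal.absNorm (Ideal.span {x}) :=
  Nat.le_of_dvd (absNorm_pos (span_singleton_ne_bot hx))
    (Ideal.absNorm_dvd_absNorm_of_le (by simpa [Ideal.span_le] using h))

theorem two_le_absNorm {Q : Ideal (𝓞 L)} (hQ : Q.IsPrime) (h0 : Q ≠ ⊥) :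
    2 ≤ Ideal.absNorm Q := by
  have h1 := absNorm_pos h0
  have h2 : Ideal.absNorm Q ≠ 1 := fun h => hQ.ne_top (Ideal.absNorm_eq_one_iff.1 h)
  omega

theorem sum_log_absNorm_le {x : 𝓞 L} (hx : x ≠ 0) (S : Finset (Ideal (𝓞 L)))
    (hS : ∀ Q ∈ S, Q.IsPrime ∧ Q ≠ ⊥ ∧ x ∈ Q) :
    ∑ Q ∈ S, Real.log (Ideal.absNorm Q) ≤ Real.log (Ideal.absNorm (Ideal.span {x})) := by
  have hdvd : ∏ Q ∈ S, Q ∣ Ideal.span {x} := by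
    refine Finset.prod_primes_dvd _ (fun Q hQ => ?_) fun Q hQ => ?_
    · exact (Ideal.prime_iff_isPrime (hS Q hQ).2.1).2 (hS Q hQ).1
    · rw [Ideal.dvd_span_singleton]
      exact (hS Q hQ).2.2
  have hd := map_dvd Ideal.absNorm hdvd
  rw [map_prod] at hd
  rw [← Real.log_prod fun Q hQ => by exact_mod_cast (absNorm_pos (hS Q hQ).2.1).ne']
  refine Real.log_le_log
    (Finset.prod_pos fun Q hQ => by exact_mod_cast absNorm_pos (hS Q hQ).2.1) ?_
  exact_mod_cast Nat.le_of_dvd (absNorm_pos (span_singleton_ne_bot hx)) hd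

theorem absNorm_span_natCast' (q : ℕ) :
    Ideal.absNorm (Ideal.span {(q : 𝓞 L)}) = q ^ Module.finrank ℚ L := by
  rw [Ideal.absNorm_span_natCast, RingOfIntegers.rank]

theorem minFac_absNorm_spec {Q : Ideal (𝓞 L)} (hQ : Q.IsPrime) (h0 : Q ≠ ⊥) :
    (Ideal.absNorm Q).minFac.Prime ∧ ((Ideal.absNorm Q).minFac : 𝓞 L) ∈ Q := by
  have : Q.IsMaximal := hQ.isMaximal h0
  obtain ⟨p, n, hn, hpQ, hp, h⟩ := Ideal.exists_prime_and_absNorm_eq_pow Q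
  have : (Ideal.absNorm Q).minFac = p := by
    rw [h, Nat.pow_minFac hn.ne', hp.minFac_eq]
  rw [this]
  exact ⟨hp, hpQ⟩

theorem sum_log_absNorm_mul_le (S : Finset (Ideal (𝓞 L))) (Z : ℕ)
    (hS : ∀ Q ∈ S, Q.IsPrime ∧ Q ≠ ⊥ ∧ Ideal.absNorm Q ≤ Z) (g : ℕ → ℝ) (hg : ∀ q, 0 ≤ g q) :
    ∑ Q ∈ S, Real.log (Ideal.absNorm Q) * g (Ideal.absNorm Q).minFac ≤
      Module.finrank ℚ L * ∑ q ∈ Nat.primesLE Z, Real.log q * g q := by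
  classical
  have hmaps : ∀ Q ∈ S, (Ideal.absNorm Q).minFac ∈ Nat.primesLE Z := fun Q hQ => by
    obtain ⟨h1, h2, h3⟩ := hS Q hQ
    exact Nat.mem_primesLE.2
      ⟨(Nat.minFac_le (absNorm_pos h2)).trans h3, (minFac_absNorm_spec h1 h2).1⟩
  rw [← Finset.sum_fiberwise_of_maps_to hmaps, Finset.mul_sum]
  refine Finset.sum_le_sum fun q hq => ?_
  have hqp := (Nat.mem_primesLE.1 hq).2
  have h1 : ∑ Q ∈ S with (Ideal.absNorm Q).minFac = q,
      Real.log (Ideal.absNorm Q) * g (Ideal.absNorm Q).minFac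
      = (∑ Q ∈ S with (Ideal.absNorm Q).minFac = q, Real.log (Ideal.absNorm Q)) * g q := by
    rw [Finset.sum_mul]
    exact Finset.sum_congr rfl fun Q hQ => by rw [(Finset.mem_filter.1 hQ).2]
  rw [h1, ← mul_assoc]
  refine mul_le_mul_of_nonneg_right ?_ (hg q)
  have hq0 : (q : 𝓞 L) ≠ 0 := by exact_mod_cast hqp.ne_zero
  refine (sum_log_absNorm_le hq0 _ fun Q hQ => ?_).trans_eq ?_
  · obtain ⟨hQS, hQq⟩ := Finset.mem_filter.1 hQ
    obtain ⟨h1, h2, -⟩ := hS Q hQS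
    exact ⟨h1, h2, hQq ▸ (minFac_absNorm_spec h1 h2).2⟩
  · rw [absNorm_span_natCast']
    push_cast
    rw [Real.log_pow]

open UniqueFactorizationMonoid Classical in
theorem log_absNorm_le_sum {I : Ideal (𝓞 L)} (hI : I ≠ ⊥) {Z : ℕ} (hZ : Ideal.absNorm I ≤ Z)
    (S : Finset (Ideal (𝓞 L)))
    (hS : ∀ Q : Ideal (𝓞 L), Q.IsPrime → Q ≠ ⊥ → Ideal.absNorm Q ≤ Z → Q ∈ S) :
    Real.log (Ideal.absNorm I) ≤
      ∑ Q ∈ S, ((Finset.card {j ∈ Finset.Icc 1 Z | I ≤ Q ^ j} : ℕ) : ℝ) *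
        Real.log (Ideal.absNorm Q) := by
  classical
  have hprime : ∀ Q ∈ normalizedFactors I, Q.IsPrime ∧ Q ≠ ⊥ := fun Q hQ => by
    have := prime_of_normalized_factor Q hQ
    exact ⟨Ideal.isPrime_of_prime this, this.ne_zero⟩
  have h1 : Ideal.absNorm I = ∏ Q ∈ (normalizedFactors I).toFinset,
      Ideal.absNorm Q ^ (normalizedFactors I).count Q := by
    conv_lhs => rw [← associated_iff_eq.1 (prod_normalizedFactors hI), map_multiset_prod,
      Finset.prod_multiset_map_count]
  have hdvd : ∀ Q j, j ≤ (normalizedFactors I).count Q → Q ∈ normalizedFactors I → I ≤ Q ^ j := by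
    intro Q j hj hQ
    rw [← Ideal.dvd_iff_le]
    have hirr := irreducible_of_normalized_factor Q hQ
    have h2 := (le_emultiplicity_iff_replicate_le_normalizedFactors (n := j) hirr hI).2 (by
      rw [normalize_eq]
      exact Multiset.le_count_iff_replicate_le.1 hj)
    exact pow_dvd_of_le_emultiplicity h2
  conv_lhs => rw [h1]
  push_cast
  rw [Real.log_prod fun Q hQ => by
    have := absNorm_pos (hprime Q (Multiset.mem_toFinset.1 hQ)).2
    positivity]
  refine (Finset.sum_le_sum fun Q hQ => ?_).trans
    (Finset.sum_le_sum_of_subset_of_nonneg (fun Q hQ => ?_) fun Q _ _ => ?_)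
  · rw [Real.log_pow]
    refine mul_le_mul_of_nonneg_right ?_ (Real.log_natCast_nonneg _)
    have hQ' := Multiset.mem_toFinset.1 hQ
    obtain ⟨hQp, hQ0⟩ := hprime Q hQ'
    set e := (normalizedFactors I).count Q with he
    have heZ : e ≤ Z := by
      have h3 : Ideal.absNorm Q ^ e ≤ Ideal.absNorm I := by
        rw [← map_pow]
        exact Nat.le_of_dvd (absNorm_pos hI)
          (Ideal.absNorm_dvd_absNorm_of_le (hdvd Q e le_rfl hQ'))
      have h4 : 2 ^ e ≤ Ideal.absNorm Q ^ e := Nat.pow_le_pow_left (two_le_absNorm hQp hQ0) e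
      have h5 : e < 2 ^ e := Nat.lt_two_pow_self
      omega
    have : Finset.Icc 1 e ⊆ {j ∈ Finset.Icc 1 Z | I ≤ Q ^ j} := fun j hj => by
      rw [Finset.mem_Icc] at hj
      rw [Finset.mem_filter, Finset.mem_Icc]
      exact ⟨⟨hj.1, hj.2.trans heZ⟩, hdvd Q j hj.2 hQ'⟩
    have := Finset.card_le_card this
    rw [Nat.card_Icc, Nat.add_sub_cancel] at this
    exact_mod_cast this
  · have hQ' := Multiset.mem_toFinset.1 hQ
    obtain ⟨hQp, hQ0⟩ := hprime Q hQ'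
    refine hS Q hQp hQ0 (le_trans ?_ hZ)
    exact Nat.le_of_dvd (absNorm_pos hI)
      (map_dvd _ (dvd_of_mem_normalizedFactors hQ'))
  · exact mul_nonneg (Nat.cast_nonneg _) (Real.log_natCast_nonneg _)

theorem absNorm_span_le_pow {x : 𝓞 L} {T : ℝ} (h : ∀ σ : L →ₐ[ℚ] ℂ, ‖σ x‖ ≤ T) :
    (Ideal.absNorm (Ideal.span {x}) : ℝ) ≤ T ^ Module.finrank ℚ L := by
  have h1 : (Ideal.absNorm (Ideal.span {x}) : ℝ) = ∏ σ : L →ₐ[ℚ] ℂ, ‖σ x‖ := by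
    rw [Ideal.absNorm_span_singleton, ← norm_prod, ← Algebra.norm_eq_prod_embeddings ℚ ℂ (x : L),
      Nat.cast_natAbs, ← Algebra.coe_norm_int]
    simp
  rw [h1, ← AlgHom.card ℚ L ℂ]
  exact (Finset.prod_le_prod (fun _ _ => norm_nonneg _) fun σ _ => h σ).trans_eq (by simp)

theorem pow_le_absNorm_span {x : 𝓞 L} {T : ℝ} (hT : 0 ≤ T) (h : ∀ σ : L →ₐ[ℚ] ℂ, T ≤ ‖σ x‖) :
    T ^ Module.finrank ℚ L ≤ (Ideal.absNorm (Ideal.span {x}) : ℝ) := by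
  have h1 : (Ideal.absNorm (Ideal.span {x}) : ℝ) = ∏ σ : L →ₐ[ℚ] ℂ, ‖σ x‖ := by
    rw [Ideal.absNorm_span_singleton, ← norm_prod, ← Algebra.norm_eq_prod_embeddings ℚ ℂ (x : L),
      Nat.cast_natAbs, ← Algebra.coe_norm_int]
    simp
  rw [h1, ← AlgHom.card ℚ L ℂ]
  exact le_trans (by simp) (Finset.prod_le_prod (fun _ _ => hT) fun σ _ => h σ)

theorem norm_powerEval_le {m : ℕ} {z : ℂ} {G : ℕ} (hG : 1 ≤ G) (hz : ‖z‖ ≤ G) {X : ℝ}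
    {v : Fin m → ℤ} (hv : ∀ i, |(v i : ℝ)| ≤ X) : ‖powerEval z v‖ ≤ m * G ^ m * X := by
  rw [powerEval]
  refine (norm_sum_le _ _).trans ?_
  have : ∀ i ∈ (Finset.univ : Finset (Fin m)), ‖(v i : ℂ) * z ^ (i : ℕ)‖ ≤ G ^ m * X := by
    intro i _
    rw [norm_mul, norm_pow, mul_comm, Complex.norm_intCast]
    have h1 : ‖z‖ ^ (i : ℕ) ≤ (G : ℝ) ^ m :=
      (pow_le_pow_left₀ (norm_nonneg _) hz _).trans
        (pow_le_pow_right₀ (by exact_mod_cast hG) i.2.le)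
    exact mul_le_mul h1 (hv i) (abs_nonneg _) (by positivity)
  exact (Finset.sum_le_sum this).trans_eq (by simp; ring)

theorem algHom_powerEval {m : ℕ} (σ : L →ₐ[ℚ] ℂ) (α : 𝓞 L) (v : Fin m → ℤ) :
    σ ((powerEval α v : 𝓞 L) : L) = powerEval (σ α) v := by
  rw [algebraMap_powerEval, powerEval, map_sum]
  exact Finset.sum_congr rfl fun i _ => by simp [Algebra.smul_def]

end IdealNorm

section LowerBound

open NumberField

variable {L : Type*} [Field L] [NumberField L]

/-- `α` generates a number field of degree `m`, its size is controlled by `G`, and the index of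
the order it generates is controlled by `D`. -/
structure IsBoundedGenerator (α : 𝓞 L) (m G D : ℕ) : Prop where
  linearIndependent : LinearIndependent ℚ fun i : Fin m => (α : L) ^ (i : ℕ)
  finrank_eq : Module.finrank ℚ L = m
  exists_pow_eq : ∃ c : Fin m → ℤ, α ^ m = powerEval α c ∧ ∀ i, |c i| ≤ G
  one_le : 1 ≤ G
  norm_le : ∀ σ : L →ₐ[ℚ] ℂ, ‖σ α‖ ≤ G
  index_ne_zero : D ≠ 0
  exists_eq_index_mul : ∀ x : 𝓞 L, ∃ v : Fin m → ℤ, powerEval α v = D * x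

theorem exists_pow_le_lt_succ_pow {m : ℕ} (hm : m ≠ 0) (N : ℕ) :
    ∃ k : ℕ, k ^ m ≤ N ∧ N < (k + 1) ^ m := by
  have hex : ∃ k, N < (k + 1) ^ m :=
    ⟨N, (Nat.lt_succ_self N).trans_le (Nat.le_self_pow hm _)⟩
  classical
  refine ⟨Nat.find hex, ?_, Nat.find_spec hex⟩
  rcases Nat.eq_zero_or_pos (Nat.find hex) with h | h
  · rw [h, zero_pow hm]; exact Nat.zero_le _
  · have := Nat.find_min hex (Nat.sub_lt h one_pos)
    rwa [not_lt, show Nat.find hex - 1 + 1 = Nat.find hex from Nat.sub_add_cancel h] at this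

/-- A box of side `X`, shifted in the first coordinate so that its vectors have values of large
absolute value. -/
noncomputable def shiftedBox (m G X : ℕ) : Finset (Fin m → ℤ) :=
  Fintype.piFinset fun i => Finset.Ico ((if (i : ℕ) = 0 then 2 * m * G ^ m * X else 0 : ℕ) : ℤ)
    ((if (i : ℕ) = 0 then 2 * m * G ^ m * X else 0 : ℕ) + X)

theorem card_shiftedBox (m G X : ℕ) : (shiftedBox m G X).card = X ^ m := by
  simp [shiftedBox]

theorem norm_powerEval_shiftedBox {m G X : ℕ} (hm : m ≠ 0) (hG : 1 ≤ G) {z : ℂ} (hz : ‖z‖ ≤ G)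
    {v : Fin m → ℤ} (hv : v ∈ shiftedBox m G X) :
    (X : ℝ) ≤ ‖powerEval z v‖ ∧ ‖powerEval z v‖ ≤ (3 * m * G ^ m * X : ℕ) := by
  obtain ⟨n, rfl⟩ : ∃ n, m = n + 1 := ⟨m - 1, by omega⟩
  set o : Fin (n + 1) → ℤ :=
    fun i => ((if (i : ℕ) = 0 then 2 * (n + 1) * G ^ (n + 1) * X else 0 : ℕ) : ℤ) with ho
  have h0 : powerEval z o = ((2 * (n + 1) * G ^ (n + 1) * X : ℕ) : ℂ) := by
    rw [powerEval, Fin.sum_univ_succ]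
    simp [ho]
  have h1 : ‖powerEval z (v - o)‖ ≤ (n + 1 : ℕ) * G ^ (n + 1) * X := by
    refine norm_powerEval_le hG hz fun i => ?_
    have := Finset.mem_Ico.1 (Fintype.mem_piFinset.1 hv i)
    have h2 : |(v - o) i| ≤ X := by
      rw [Pi.sub_apply, abs_le]
      simp only [ho]
      constructor <;> omega
    exact_mod_cast h2
  have h2 : powerEval z v = powerEval z (v - o) + ((2 * (n + 1) * G ^ (n + 1) * X : ℕ) : ℂ) := by
    rw [← h0, ← powerEval_add, sub_add_cancel]
  have h3 : ‖((2 * (n + 1) * G ^ (n + 1) * X : ℕ) : ℂ)‖ = 2 * ((n + 1 : ℕ) * G ^ (n + 1) * X) := by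
    rw [Complex.norm_natCast]; push_cast; ring
  have h4 : (X : ℝ) ≤ (n + 1 : ℕ) * G ^ (n + 1) * X := by
    have : (1 : ℝ) ≤ (n + 1 : ℕ) * G ^ (n + 1) := by
      have : 1 ≤ (n + 1) * G ^ (n + 1) := Nat.one_le_iff_ne_zero.2 (by positivity)
      exact_mod_cast this
    exact le_mul_of_one_le_left (Nat.cast_nonneg _) this
  constructor
  · have := norm_sub_le (powerEval z v) (powerEval z (v - o))
    rw [h2, add_sub_cancel_left, h3, ← h2] at this
    linarith
  · have := norm_add_le (powerEval z (v - o)) ((2 * (n + 1) * G ^ (n + 1) * X : ℕ) : ℂ)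
    rw [← h2, h3] at this
    refine this.trans ?_
    push_cast at h1 ⊢
    linarith

variable {α : 𝓞 L} {m G D : ℕ}

theorem IsBoundedGenerator.ne_zero (h : IsBoundedGenerator α m G D) : m ≠ 0 := by
  rw [← h.finrank_eq]; exact Module.finrank_pos.ne'

theorem IsBoundedGenerator.absNorm_powerEval (h : IsBoundedGenerator α m G D) {X : ℕ}
    {v : Fin m → ℤ} (hv : v ∈ shiftedBox m G X) :
    X ^ m ≤ Ideal.absNorm (Ideal.span {powerEval α v}) ∧
      Ideal.absNorm (Ideal.span {powerEval α v}) ≤ (3 * m * G ^ m * X) ^ m := by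
  have h1 := fun σ : L →ₐ[ℚ] ℂ => norm_powerEval_shiftedBox h.ne_zero h.one_le (h.norm_le σ) hv
  simp only [← algHom_powerEval] at h1
  have h2 := absNorm_span_le_pow fun σ => (h1 σ).2
  have h3 := pow_le_absNorm_span (Nat.cast_nonneg _) fun σ => (h1 σ).1
  rw [h.finrank_eq] at h2 h3
  exact ⟨by exact_mod_cast h3, by exact_mod_cast h2⟩

open Classical in
theorem IsBoundedGenerator.card_mul_absNorm_le (h : IsBoundedGenerator α m G D) {X : ℕ}
    (hX : 1 ≤ X) {I : Ideal (𝓞 L)} (hI : I ≠ ⊥) :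
    (Finset.card {v ∈ shiftedBox m G X | powerEval α v ∈ I}) * Ideal.absNorm I ≤
      D ^ m * (1 + 2 * (m * (1 + G) ^ m * (3 * m * G ^ m))) ^ m * X ^ m := by
  rcases Finset.eq_empty_or_nonempty {v ∈ shiftedBox m G X | powerEval α v ∈ I} with he | ⟨v, hv⟩
  · rw [he]; simp
  obtain ⟨k, hk, hk'⟩ := exists_pow_le_lt_succ_pow h.ne_zero (Ideal.absNorm I)
  obtain ⟨hvB, hvI⟩ := Finset.mem_filter.1 hv
  have hvN := h.absNorm_powerEval hvB
  have hv0 : powerEval α v ≠ 0 := by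
    intro h0
    have h1 := hvN.1
    rw [h0] at h1
    simp [h.ne_zero] at h1
    omega
  have hkX : k ≤ 3 * m * G ^ m * X :=
    le_of_pow_le_pow_left₀ h.ne_zero (Nat.zero_le _)
      ((hk.trans (absNorm_le_of_mem hv0 hvI)).trans hvN.2)
  set I' : Ideal (𝓞 L) := Submodule.comap (LinearMap.mulLeft (𝓞 L) (D : 𝓞 L)) I with hI'
  have hmem : ∀ x, x ∈ I' ↔ (D : 𝓞 L) * x ∈ I := fun x => by simp [hI']
  have hI'0 : I' ≠ ⊥ := by
    intro h0
    apply hI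
    rw [eq_bot_iff, ← h0]
    exact fun x hx => (hmem x).2 (I.mul_mem_left _ hx)
  have hnorm : Ideal.absNorm I ≤ D ^ m * Ideal.absNorm I' := by
    rw [← h.finrank_eq, ← absNorm_span_natCast', ← map_mul]
    refine Nat.le_of_dvd (absNorm_pos ?_) (Ideal.absNorm_dvd_absNorm_of_le ?_)
    · exact mul_ne_zero
        (span_singleton_ne_bot (Nat.cast_ne_zero.2 h.index_ne_zero)) hI'0
    · rw [Ideal.span_singleton_mul_le_iff]
      exact fun x hx => (hmem x).1 hx
  have hfin : Finite (𝓞 L ⧸ I') := (Ideal.absNorm_ne_zero_iff I').1 (absNorm_pos hI'0).ne'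
  have := Fintype.ofFinite (𝓞 L ⧸ I')
  choose y hy using fun j : 𝓞 L ⧸ I' => h.exists_eq_index_mul (Quotient.out j)
  obtain ⟨c, hc, hcG⟩ := h.exists_pow_eq
  have hcard := card_powerEval_mem_mul_card_le h.linearIndependent h.finrank_eq hc hcG hI hk' y
    (fun i j hij => by
      rw [hy, hy, ← mul_sub, ← hmem] at hij
      rw [← Quotient.out_eq i, ← Quotient.out_eq j]
      exact Ideal.Quotient.eq.2 hij)
    {v ∈ shiftedBox m G X | powerEval α v ∈ I} _ X (fun v hv => by
      obtain ⟨h1, h2⟩ := Finset.mem_filter.1 hv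
      exact ⟨h2, fun i => Finset.mem_Ico.1 (Fintype.mem_piFinset.1 h1 i)⟩)
  have hcard' : Fintype.card (𝓞 L ⧸ I') = Ideal.absNorm I' := by
    rw [← Nat.card_eq_fintype_card]; rfl
  rw [hcard'] at hcard
  calc _ ≤ (Finset.card {v ∈ shiftedBox m G X | powerEval α v ∈ I}) * (D ^ m * Ideal.absNorm I') :=
        Nat.mul_le_mul_left _ hnorm
    _ = D ^ m * ((Finset.card {v ∈ shiftedBox m G X | powerEval α v ∈ I}) * Ideal.absNorm I') := by
        ring
    _ ≤ D ^ m * (X + 2 * (m * (1 + G) ^ m * (3 * m * G ^ m * X))) ^ m := by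
        refine Nat.mul_le_mul_left _ (hcard.trans ?_)
        gcongr
    _ = _ := by
        rw [mul_assoc (D ^ m), ← mul_pow _ X]
        congr 2
        ring

open Classical in
theorem IsBoundedGenerator.card_mul_prime_le (h : IsBoundedGenerator α m G D) {X s : ℕ}
    {I : Ideal (𝓞 L)} (hI : (Ideal.absNorm I).Prime) (hs : Ideal.absNorm I < (s + 1) ^ m) :
    (Finset.card {v ∈ shiftedBox m G X | powerEval α v ∈ I}) * Ideal.absNorm I ≤
      (X + 2 * (m * (1 + G) ^ m * s)) ^ m := by
  have hI0 : I ≠ ⊥ := fun h0 => by simp [h0] at hI; exact Nat.not_prime_zero hI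
  have hpos : 0 < m := Nat.pos_of_ne_zero h.ne_zero
  obtain ⟨c, hc, hcG⟩ := h.exists_pow_eq
  have hprime : I.IsPrime := Ideal.isPrime_of_irreducible_absNorm hI
  have hone : (1 : 𝓞 L) ∉ I := fun h1 => hprime.ne_top ((Ideal.eq_top_iff_one I).2 h1)
  have hpe : ∀ j : ℤ, powerEval α (fun i : Fin m => if (i : ℕ) = 0 then j else 0) = (j : 𝓞 L) := by
    intro j
    obtain ⟨n, rfl⟩ := Nat.exists_eq_succ_of_ne_zero h.ne_zero
    rw [powerEval, Fin.sum_univ_succ]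
    simp
  have hcard := card_powerEval_mem_mul_card_le h.linearIndependent h.finrank_eq hc hcG hI0 hs
    (fun (j : Fin (Ideal.absNorm I)) (i : Fin m) => if (i : ℕ) = 0 then ((j : ℕ) : ℤ) else 0)
    (fun i j hij => by
      rw [hpe, hpe] at hij
      by_contra hne
      have hcop : IsCoprime ((i : ℕ) - (j : ℕ) : ℤ) (Ideal.absNorm I : ℤ) := by
        rw [isCoprime_comm]
        refine (Nat.prime_iff_prime_int.1 hI).coprime_iff_not_dvd.2 fun hd => hne ?_
        have h1 := Int.eq_zero_of_abs_lt_dvd hd (by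
          have := i.2
          have := j.2
          rw [abs_lt]
          constructor <;> omega)
        ext
        omega
      obtain ⟨a, b, hab⟩ := hcop
      apply hone
      have h2 : (1 : 𝓞 L) = a * ((((i : ℕ) : ℤ) : 𝓞 L) - (((j : ℕ) : ℤ) : 𝓞 L))
          + b * (Ideal.absNorm I : 𝓞 L) := by
        exact_mod_cast (congrArg (Int.cast : ℤ → 𝓞 L) hab).symm
      rw [h2]
      exact I.add_mem (I.mul_mem_left _ hij) (I.mul_mem_left _ (Ideal.absNorm_mem I)))
    {v ∈ shiftedBox m G X | powerEval α v ∈ I} _ X (fun v hv => by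
      obtain ⟨h1, h2⟩ := Finset.mem_filter.1 hv
      exact ⟨h2, fun i => Finset.mem_Ico.1 (Fintype.mem_piFinset.1 h1 i)⟩)
  rwa [Fintype.card_fin] at hcard

end LowerBound

theorem one_add_inv_pow_le {m a : ℕ} (hm : m ≠ 0) (ha : a ≠ 0) :
    (1 + 1 / (2 * m * a : ℝ)) ^ m ≤ 1 + 1 / a := by
  have hm' : (0 : ℝ) < m := by positivity
  have ha' : (1 : ℝ) ≤ a := by exact_mod_cast Nat.one_le_iff_ne_zero.2 ha
  have h1 : (1 + 1 / (2 * m * a : ℝ)) ^ m ≤ Real.exp (1 / (2 * a)) := by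
    calc (1 + 1 / (2 * m * a : ℝ)) ^ m ≤ Real.exp (1 / (2 * m * a : ℝ)) ^ m := by
          refine pow_le_pow_left₀ (by positivity) ?_ _
          rw [add_comm]; exact Real.add_one_le_exp _
      _ = _ := by
          rw [← Real.exp_nat_mul]
          congr 1
          field_simp
  have h2 := Real.add_one_le_exp (-(1 / (2 * a : ℝ)))
  have h3 : Real.exp (1 / (2 * a : ℝ)) * Real.exp (-(1 / (2 * a : ℝ))) = 1 := by
    rw [← Real.exp_add]; simp
  have hx0 : 0 < 1 / (2 * a : ℝ) := by positivity
  have hx1 : 1 / (2 * a : ℝ) ≤ 1 / 2 := by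
    apply one_div_le_one_div_of_le <;> linarith
  have hx2 : 1 / (a : ℝ) = 2 * (1 / (2 * a : ℝ)) := by field_simp
  refine h1.trans ?_
  rw [hx2]
  set x := 1 / (2 * a : ℝ)
  have h4 := Real.exp_pos x
  have h5 : Real.exp x * (1 - x) ≤ 1 := by nlinarith
  by_contra! hlt
  nlinarith

theorem sum_range_inv_pow_le {x : ℝ} (hx : 2 ≤ x) (k : ℕ) :
    ∑ i ∈ Finset.range k, 1 / x ^ (i + 2) ≤ 2 / x ^ 2 := by
  have h : ∑ i ∈ Finset.range k, 1 / x ^ (i + 2) ≤ 2 / x ^ 2 - 2 / x ^ (k + 2) := by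
    induction k with
    | zero => simp
    | succ k ih =>
      rw [Finset.sum_range_succ]
      have : 1 / x ^ (k + 2) + 2 / x ^ (k + 1 + 2) ≤ 2 / x ^ (k + 2) := by
        have hp : 0 < x ^ (k + 2) := by positivity
        have hx0 : 0 < x := by linarith
        rw [show k + 1 + 2 = (k + 2) + 1 by ring, pow_succ x (k + 2),
          div_add_div _ _ hp.ne' (by positivity), div_le_div_iff₀ (by positivity) hp]
        nlinarith [mul_pos hp hp, mul_nonneg (mul_pos hp hp).le (sub_nonneg.2 hx)]
      linarith
  have : 0 ≤ 2 / x ^ (k + 2) := by positivity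
  linarith

section LowerBound

open NumberField

variable {L : Type*} [Field L] [NumberField L] {α : 𝓞 L} {m G D : ℕ}

open Classical in
theorem IsBoundedGenerator.sum_card_pow_le (h : IsBoundedGenerator α m G D) {a n s Z : ℕ}
    (ha : a ≠ 0) (hs : s ≠ 0) (hn : n < (s + 1) ^ m) (hn0 : 0 < n) (hZ : Z ≠ 0)
    {Q : Ideal (𝓞 L)} (hQ : Q.IsPrime) (hQ0 : Q ≠ ⊥) {X : ℕ}
    (hX : X = 4 * m * (m * (1 + G) ^ m) * a * s) {W : ℕ}
    (hW : W = D ^ m * (1 + 2 * (m * (1 + G) ^ m * (3 * m * G ^ m))) ^ m) :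
    ∑ j ∈ Finset.Icc 1 Z,
        ((Finset.card {v ∈ shiftedBox m G X | powerEval α v ∈ Q ^ j} : ℕ) : ℝ) ≤
      (X : ℝ) ^ m * ((if (Ideal.absNorm Q).Prime ∧ Ideal.absNorm Q ≤ n then
        (1 + 1 / a) / (Ideal.absNorm Q : ℝ) else 0) +
        (W / n + 3 * W / ((Ideal.absNorm Q).minFac : ℝ) ^ 2)) := by
  have hm := h.ne_zero
  have hXpos : 1 ≤ X := Nat.one_le_iff_ne_zero.2 (by rw [hX]; positivity)
  set N := Ideal.absNorm Q with hN
  have hN2 : 2 ≤ N := two_le_absNorm hQ hQ0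
  have hN2' : (2 : ℝ) ≤ N := by exact_mod_cast hN2
  have hq := (minFac_absNorm_spec hQ hQ0).1
  have hcnt : ∀ j, ((Finset.card {v ∈ shiftedBox m G X | powerEval α v ∈ Q ^ j} : ℕ) : ℝ) ≤
      (X : ℝ) ^ m * (W * (1 / (N : ℝ) ^ j)) := fun j => by
    have h1 := h.card_mul_absNorm_le hXpos (pow_ne_zero j hQ0 : Q ^ j ≠ ⊥)
    rw [map_pow, ← hW, ← hN] at h1
    have h2 : ((Finset.card {v ∈ shiftedBox m G X | powerEval α v ∈ Q ^ j} : ℕ) : ℝ) * (N : ℝ) ^ j ≤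
      W * (X : ℝ) ^ m := by exact_mod_cast h1
    rw [← mul_assoc, mul_one_div, le_div_iff₀ (by positivity)]
    linarith
  obtain ⟨Y, rfl⟩ := Nat.exists_eq_succ_of_ne_zero hZ
  have hsum : ∀ f : ℕ → ℝ, ∑ j ∈ Finset.Icc 1 (Y + 1), f j
      = f 1 + ∑ i ∈ Finset.range Y, f (i + 2) := fun f => by
    rw [Finset.range_eq_Ico, Finset.sum_Ico_add' f 0 Y 2, ← Finset.Ico_add_one_right_eq_Icc,
      Finset.sum_eq_sum_Ico_succ_bot (by omega)]
    congr 2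
  rw [hsum]
  have htail : ∑ i ∈ Finset.range Y,
      ((Finset.card {v ∈ shiftedBox m G X | powerEval α v ∈ Q ^ (i + 2)} : ℕ) : ℝ) ≤
      (X : ℝ) ^ m * (2 * W / (N.minFac : ℝ) ^ 2) := by
    refine (Finset.sum_le_sum fun i _ => hcnt (i + 2)).trans ?_
    rw [← Finset.mul_sum, ← Finset.mul_sum]
    refine mul_le_mul_of_nonneg_left ?_ (by positivity)
    have h1 := sum_range_inv_pow_le hN2' Y
    have h2 : 2 / (N : ℝ) ^ 2 ≤ 2 / (N.minFac : ℝ) ^ 2 := by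
      have h3 : (N.minFac : ℝ) ≤ N := by exact_mod_cast Nat.minFac_le (by omega)
      have h4 : (0 : ℝ) < N.minFac := by exact_mod_cast hq.pos
      gcongr
    calc (W : ℝ) * ∑ i ∈ Finset.range Y, 1 / (N : ℝ) ^ (i + 2)
        ≤ W * (2 / (N.minFac : ℝ) ^ 2) := by gcongr; exact h1.trans h2
      _ = _ := by ring
  suffices hone : ((Finset.card {v ∈ shiftedBox m G X | powerEval α v ∈ Q ^ 1} : ℕ) : ℝ) ≤
      (X : ℝ) ^ m * ((if N.Prime ∧ N ≤ n then (1 + 1 / a) / (N : ℝ) else 0) +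
        (W / n + W / (N.minFac : ℝ) ^ 2)) by
    calc _ ≤ _ := add_le_add hone htail
      _ = _ := by ring
  have hc1 := hcnt 1
  have hq0 : (0 : ℝ) < N.minFac := by exact_mod_cast hq.pos
  have hn0' : (0 : ℝ) < n := by exact_mod_cast hn0
  split_ifs with hp
  · have h1 := h.card_mul_prime_le (X := X) (I := Q) hp.1 (hp.2.trans_lt hn)
    have h2 : ((X + 2 * (m * (1 + G) ^ m * s) : ℕ) : ℝ) = X * (1 + 1 / (2 * m * a : ℝ)) := by
      rw [hX]
      push_cast
      field_simp
      ring
    have h3 : ((Finset.card {v ∈ shiftedBox m G X | powerEval α v ∈ Q} : ℕ) : ℝ) * N ≤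
        (X : ℝ) ^ m * (1 + 1 / a) := by
      have h4 : ((Finset.card {v ∈ shiftedBox m G X | powerEval α v ∈ Q} : ℕ) : ℝ) * N ≤
        ((X + 2 * (m * (1 + G) ^ m * s) : ℕ) : ℝ) ^ m := by exact_mod_cast h1
      rw [h2, mul_pow] at h4
      exact h4.trans (mul_le_mul_of_nonneg_left (one_add_inv_pow_le hm ha) (by positivity))
    rw [pow_one]
    have h5 : ((Finset.card {v ∈ shiftedBox m G X | powerEval α v ∈ Q} : ℕ) : ℝ) ≤
        (X : ℝ) ^ m * ((1 + 1 / a) / N) := by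
      rw [← mul_div_assoc, le_div_iff₀ (by positivity)]
      exact h3
    refine h5.trans (mul_le_mul_of_nonneg_left ?_ (by positivity))
    have : (0 : ℝ) ≤ W / n + W / (N.minFac : ℝ) ^ 2 := by positivity
    linarith
  · refine hc1.trans (mul_le_mul_of_nonneg_left ?_ (by positivity))
    rw [zero_add, pow_one, mul_one_div]
    by_cases hNn : n ≤ N
    · have h1 : (W : ℝ) / N ≤ W / n := by
        have : (n : ℝ) ≤ N := by exact_mod_cast hNn
        gcongr
      have : (0 : ℝ) ≤ W / (N.minFac : ℝ) ^ 2 := by positivity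
      linarith
    · have hnp : ¬ N.Prime := fun hh => hp ⟨hh, by omega⟩
      have h1 : (W : ℝ) / N ≤ W / (N.minFac : ℝ) ^ 2 := by
        have : (N.minFac : ℝ) ^ 2 ≤ N := by
          exact_mod_cast Nat.minFac_sq_le_self (by omega) hnp
        gcongr
      have : (0 : ℝ) ≤ W / (n : ℝ) := by positivity
      linarith

end LowerBound

section LowerBound

open NumberField

variable {L : Type*} [Field L] [NumberField L] {α : 𝓞 L} {m G D : ℕ}

open Classical in
/-- A lower bound of Mertens type for the sum over prime ideals of prime norm. -/
theorem IsBoundedGenerator.log_le_sum (h : IsBoundedGenerator α m G D) {a n : ℕ}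
    (ha : a ≠ 0) (hn : n ≠ 0) {W C : ℕ}
    (hW : W = D ^ m * (1 + 2 * (m * (1 + G) ^ m * (3 * m * G ^ m))) ^ m)
    (hC : C = (3 * m * G ^ m * (4 * m * (m * (1 + G) ^ m) * a)) ^ m)
    (T : Finset (Ideal (𝓞 L)))
    (hT : ∀ Q, (Ideal.absNorm Q).Prime → Ideal.absNorm Q ≤ n → Q ∈ T) :
    Real.log n ≤ (1 + 1 / a) * ∑ Q ∈ T, Real.log (Ideal.absNorm Q) / Ideal.absNorm Q
      + m * W * (Real.log 4 * C + 12) := by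
  have hm := h.ne_zero
  obtain ⟨s, hs, hs'⟩ := exists_pow_le_lt_succ_pow hm n
  have hs0 : s ≠ 0 := by
    rintro rfl
    simp at hs'
    exact hn hs'
  set X : ℕ := 4 * m * (m * (1 + G) ^ m) * a * s with hX
  set Z : ℕ := (3 * m * G ^ m * X) ^ m with hZ
  have hG := h.one_le
  have hX0 : X ≠ 0 := by rw [hX]; positivity
  have hZ0 : Z ≠ 0 := by rw [hZ]; positivity
  have hn0 : (0 : ℝ) < n := by positivity
  set S := {Q ∈ (Ideal.finite_setOfPred_absNorm_le (S := 𝓞 L) Z).toFinset | Q.IsPrime ∧ Q ≠ ⊥}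
    with hS
  have hSmem : ∀ Q, Q ∈ S ↔ Ideal.absNorm Q ≤ Z ∧ Q.IsPrime ∧ Q ≠ ⊥ := fun Q => by simp [hS]
  have h1 : ∀ v ∈ shiftedBox m G X, Real.log n ≤ ∑ Q ∈ S,
      ((Finset.card {j ∈ Finset.Icc 1 Z | powerEval α v ∈ Q ^ j} : ℕ) : ℝ)
        * Real.log (Ideal.absNorm Q) := by
    intro v hv
    obtain ⟨h2, h3⟩ := h.absNorm_powerEval hv
    have hb : Ideal.span {powerEval α v} ≠ ⊥ := by
      intro hb
      rw [hb, Ideal.absNorm_bot] at h2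
      have : 0 < X ^ m := by positivity
      omega
    have h4 := log_absNorm_le_sum (Z := Z) hb h3 S fun Q h5 h6 h7 => (hSmem Q).2 ⟨h7, h5, h6⟩
    have h5 : n ≤ X ^ m := by
      refine hs'.le.trans (Nat.pow_le_pow_left ?_ m)
      have : 1 ≤ m * (m * (1 + G) ^ m) * a := Nat.one_le_iff_ne_zero.2 (by positivity)
      rw [hX]
      calc s + 1 ≤ 4 * 1 * s := by omega
        _ ≤ 4 * (m * (m * (1 + G) ^ m) * a) * s := by gcongr
        _ = _ := by ring
    have h6 : Real.log n ≤ Real.log (Ideal.absNorm (Ideal.span {powerEval α v})) :=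
      Real.log_le_log hn0 (by exact_mod_cast h5.trans h2)
    refine (h6.trans h4).trans_eq (Finset.sum_congr rfl fun Q _ => ?_)
    simp only [Ideal.span_singleton_le_iff_mem]
  have h2 := Finset.sum_le_sum h1
  rw [Finset.sum_const, card_shiftedBox, nsmul_eq_mul, Finset.sum_comm] at h2
  have h3 : ∀ Q ∈ S, ∑ v ∈ shiftedBox m G X,
      ((Finset.card {j ∈ Finset.Icc 1 Z | powerEval α v ∈ Q ^ j} : ℕ) : ℝ)
        * Real.log (Ideal.absNorm Q) ≤
      (X : ℝ) ^ m * ((if (Ideal.absNorm Q).Prime ∧ Ideal.absNorm Q ≤ n then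
        (1 + 1 / a) / (Ideal.absNorm Q : ℝ) else 0) * Real.log (Ideal.absNorm Q) +
        Real.log (Ideal.absNorm Q) * (W / n + 3 * W / ((Ideal.absNorm Q).minFac : ℝ) ^ 2)) := by
    intro Q hQ
    obtain ⟨-, hQp, hQ0⟩ := (hSmem Q).1 hQ
    have h4 := h.sum_card_pow_le ha hs0 hs' (Nat.pos_of_ne_zero hn) hZ0 hQp hQ0 hX hW
    have h5 : ∑ v ∈ shiftedBox m G X,
        Finset.card {j ∈ Finset.Icc 1 Z | powerEval α v ∈ Q ^ j} =
        ∑ j ∈ Finset.Icc 1 Z, Finset.card {v ∈ shiftedBox m G X | powerEval α v ∈ Q ^ j} :=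
      Finset.sum_card_bipartiteAbove_eq_sum_card_bipartiteBelow _
    rw [← Finset.sum_mul, ← Nat.cast_sum, h5, Nat.cast_sum]
    refine (mul_le_mul_of_nonneg_right h4 (Real.log_natCast_nonneg _)).trans_eq (by ring)
  have h4 := h2.trans (Finset.sum_le_sum h3)
  rw [← Finset.mul_sum, Nat.cast_pow] at h4
  have h5 := le_of_mul_le_mul_left h4 (by positivity)
  rw [Finset.sum_add_distrib] at h5
  refine h5.trans (add_le_add ?_ ?_)
  · simp only [ite_mul, zero_mul]
    rw [← Finset.sum_filter, Finset.mul_sum]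
    have : ∀ Q : Ideal (𝓞 L), (1 + 1 / (a : ℝ)) / (Ideal.absNorm Q : ℝ) * Real.log (Ideal.absNorm Q)
        = (1 + 1 / a) * (Real.log (Ideal.absNorm Q) / Ideal.absNorm Q) := fun Q => by ring
    simp only [this]
    refine Finset.sum_le_sum_of_subset_of_nonneg (fun Q hQ => ?_) fun Q _ _ => ?_
    · obtain ⟨-, h6, h7⟩ := Finset.mem_filter.1 hQ
      exact hT Q h6 h7
    · have := Real.log_natCast_nonneg (Ideal.absNorm Q)
      positivity
  · refine (sum_log_absNorm_mul_le S Z (fun Q hQ => ?_)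
      (fun q => (W : ℝ) / n + 3 * W / (q : ℝ) ^ 2) fun q => by positivity).trans ?_
    · obtain ⟨h6, h7, h8⟩ := (hSmem Q).1 hQ
      exact ⟨h7, h8, h6⟩
    · rw [h.finrank_eq, mul_assoc]
      refine mul_le_mul_of_nonneg_left ?_ (by positivity)
      have h6 : ∀ q ∈ Nat.primesLE Z, Real.log q * ((W : ℝ) / n + 3 * W / (q : ℝ) ^ 2)
          = W / n * Real.log q + 3 * W * (Real.log q / (q : ℝ) ^ 2) := fun q _ => by ring
      rw [Finset.sum_congr rfl h6, Finset.sum_add_distrib, ← Finset.mul_sum, ← Finset.mul_sum]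
      have h7 := sum_log_primesLE_le Z
      have h8 := sum_log_div_sq_primesLE_le Z
      have h9 : (Z : ℝ) ≤ C * n := by
        have : Z ≤ C * n := by
          calc Z = C * s ^ m := by rw [hZ, hC, ← mul_pow, hX]; congr 1; ring
            _ ≤ _ := Nat.mul_le_mul_left _ hs
        exact_mod_cast this
      have hlog4 : 0 ≤ Real.log 4 := Real.log_nonneg (by norm_num)
      calc _ ≤ (W : ℝ) / n * (Real.log 4 * (C * n)) + 3 * W * 4 := by
            gcongr
            exact h7.trans (mul_le_mul_of_nonneg_left h9 hlog4)
        _ = _ := by field_simp; ring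

end LowerBound

/-- The residues `r` modulo `q` at which `h` vanishes. -/
def rootResidues (h : Polynomial ℤ) (q : ℕ) : Finset ℕ :=
  {r ∈ Finset.range q | (q : ℤ) ∣ h.eval (r : ℤ)}

theorem card_sq_le_card_mul {ι κ : Type*} [DecidableEq κ] (B : Finset ι) (f : ι → κ)
    (T : Finset κ) (hf : ∀ u ∈ B, f u ∈ T) :
    B.card ^ 2 ≤ T.card * Finset.card {z ∈ B ×ˢ B | f z.1 = f z.2} := by
  have h1 : B.card = ∑ t ∈ T, Finset.card {u ∈ B | f u = t} :=
    Finset.card_eq_sum_card_fiberwise hf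
  have h2 : Finset.card {z ∈ B ×ˢ B | f z.1 = f z.2}
      = ∑ t ∈ T, Finset.card {u ∈ B | f u = t} ^ 2 := by
    rw [Finset.card_eq_sum_card_fiberwise (f := fun z => f z.1) (t := T)]
    · refine Finset.sum_congr rfl fun t _ => ?_
      rw [sq, ← Finset.card_product]
      congr 1
      ext ⟨u, v⟩
      simp only [Finset.mem_filter, Finset.mem_product]
      constructor
      · rintro ⟨⟨⟨hu, hv⟩, h⟩, rfl⟩
        exact ⟨⟨hu, rfl⟩, hv, h.symm⟩
      · rintro ⟨⟨hu, rfl⟩, hv, h⟩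
        exact ⟨⟨⟨hu, hv⟩, h.symm⟩, rfl⟩
    · intro z hz
      exact hf _ (Finset.mem_product.1 (Finset.mem_filter.1 hz).1).1
  rw [h2, h1]
  exact sq_sum_le_card_mul_sum_sq

theorem map_powerEval {R S : Type*} [CommRing R] [CommRing S] (f : R →+* S) {m : ℕ} (x : R)
    (v : Fin m → ℤ) : f (powerEval x v) = powerEval (f x) v := by
  simp [powerEval]

section UpperBound

open NumberField

variable {K : Type*} [Field K] [NumberField K] {θ : 𝓞 K} {d G : ℕ} {h : Polynomial ℤ}

omit [NumberField K] in
theorem powerEval_mem_of_dvd {Q : Ideal (𝓞 K)} {q : ℕ} {r : ℤ} (hq : (q : 𝓞 K) ∈ Q)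
    (hr : θ - r ∈ Q) {w : Fin d → ℤ} (hw : (q : ℤ) ∣ powerEval r w) : powerEval θ w ∈ Q := by
  rw [← Ideal.Quotient.eq_zero_iff_mem, map_powerEval, Ideal.Quotient.eq.2 hr, ← map_powerEval,
    Ideal.Quotient.eq_zero_iff_mem]
  obtain ⟨c, hc⟩ := hw
  have : powerEval (r : 𝓞 K) w = q * c := by
    have := map_powerEval (Int.castRingHom (𝓞 K)) r w
    rw [hc] at this
    simpa using this.symm
  rw [this]
  exact Q.mul_mem_right _ hq

theorem exists_prime_of_dvd_eval
    (hnorm : ∀ r : ℤ, Ideal.absNorm (Ideal.span {θ - (r : 𝓞 K)}) = (h.eval r).natAbs)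
    {q : ℕ} (hq : q.Prime) {r : ℤ} (hr : (q : ℤ) ∣ h.eval r) :
    ∃ Q : Ideal (𝓞 K), Q.IsPrime ∧ Q ≠ ⊥ ∧ (q : 𝓞 K) ∈ Q ∧ θ - r ∈ Q := by
  obtain ⟨P, hP, hPq, hPd⟩ := Ideal.exists_isMaximal_dvd_of_dvd_absNorm
    (Nat.prime_iff_prime_int.1 hq) (Ideal.span {θ - (r : 𝓞 K)})
    (by rw [hnorm]; exact Int.dvd_natAbs.2 hr)
  have hqP : (q : 𝓞 K) ∈ P := by
    have : (q : ℤ) ∈ P.under ℤ := by rw [hPq]; exact Ideal.mem_span_singleton_self _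
    rw [Ideal.under, Ideal.mem_comap] at this
    simpa using this
  refine ⟨P, hP.isPrime, fun h0 => ?_, hqP, ?_⟩
  · rw [h0, Ideal.mem_bot] at hqP
    exact hq.ne_zero (by exact_mod_cast hqP)
  · exact Ideal.dvd_span_singleton.1 hPd

theorem int_not_mem_of_isCoprime {Q : Ideal (𝓞 K)} (hQ : Q.IsPrime) {x y : ℤ}
    (hxy : IsCoprime x y) (hx : (x : 𝓞 K) ∈ Q) : (y : 𝓞 K) ∉ Q := fun hy => by
  obtain ⟨a, b, hab⟩ := hxy
  refine hQ.ne_top ((Ideal.eq_top_iff_one Q).2 ?_)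
  have : (1 : 𝓞 K) = a * x + b * y := by
    exact_mod_cast (congrArg (Int.cast : ℤ → 𝓞 K) hab).symm
  rw [this]
  exact Q.add_mem (Q.mul_mem_left _ hx) (Q.mul_mem_left _ hy)

theorem log_le_log_absNorm {Q : Ideal (𝓞 K)} (hQ : Q.IsPrime) (h0 : Q ≠ ⊥) {q : ℕ}
    (hq : q.Prime) (hqQ : (q : 𝓞 K) ∈ Q) : Real.log q ≤ Real.log (Ideal.absNorm Q) := by
  obtain ⟨h1, h2⟩ := minFac_absNorm_spec hQ h0
  have h3 : (Ideal.absNorm Q).minFac = q := by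
    by_contra hne
    have hc : IsCoprime ((Ideal.absNorm Q).minFac : ℤ) (q : ℤ) :=
      Nat.isCoprime_iff_coprime.2 ((Nat.coprime_primes h1 hq).2 hne)
    exact int_not_mem_of_isCoprime hQ hc (by simpa using h2) (by simpa using hqQ)
  refine Real.log_le_log (by exact_mod_cast hq.pos) ?_
  rw [← h3]
  exact_mod_cast Nat.minFac_le (absNorm_pos h0)

/-- If `x` is nonzero, the pairs `(q, r)` of a prime and a root residue which divide `x` have
product at most the norm of `x`. -/
theorem sum_log_rootResidues_le {Qf : ℕ → ℕ → Ideal (𝓞 K)}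
    (hQf : ∀ q r : ℕ, q.Prime → (q : ℤ) ∣ h.eval (r : ℤ) →
      (Qf q r).IsPrime ∧ Qf q r ≠ ⊥ ∧ (q : 𝓞 K) ∈ Qf q r ∧ θ - ((r : ℤ) : 𝓞 K) ∈ Qf q r)
    {x : 𝓞 K} (hx : x ≠ 0) (A : Finset (Σ _ : ℕ, ℕ))
    (hA : ∀ z ∈ A, z.1.Prime ∧ z.2 ∈ rootResidues h z.1 ∧ x ∈ Qf z.1 z.2) :
    ∑ z ∈ A, Real.log z.1 ≤ Real.log (Ideal.absNorm (Ideal.span {x})) := by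
  classical
  have hA' : ∀ z ∈ A, z.2 < z.1 ∧ (Qf z.1 z.2).IsPrime ∧ Qf z.1 z.2 ≠ ⊥ ∧
      (z.1 : 𝓞 K) ∈ Qf z.1 z.2 ∧ θ - ((z.2 : ℤ) : 𝓞 K) ∈ Qf z.1 z.2 := fun z hz => by
    obtain ⟨h1, h2, -⟩ := hA z hz
    obtain ⟨h3, h4⟩ := Finset.mem_filter.1 h2
    exact ⟨Finset.mem_range.1 h3, hQf _ _ h1 h4⟩
  have hinj : Set.InjOn (fun z : Σ _ : ℕ, ℕ => Qf z.1 z.2) A := by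
    rintro ⟨q, r⟩ hz ⟨q', r'⟩ hz' heq
    obtain ⟨hlt, hp, -, hq, hr⟩ := hA' _ hz
    obtain ⟨hlt', -, -, hq', hr'⟩ := hA' _ hz'
    have h1 := (hA _ hz).1
    have h1' := (hA _ hz').1
    simp only at heq hlt hp hq hr hlt' hq' hr' h1 h1'
    rw [← heq] at hq' hr'
    have hqq : q = q' := by
      by_contra hne
      exact int_not_mem_of_isCoprime hp
        (Nat.isCoprime_iff_coprime.2 ((Nat.coprime_primes h1 h1').2 hne))
        (by simpa using hq) (by simpa using hq')
    subst hqq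
    have hrr : r = r' := by
      by_contra hne
      have hc : IsCoprime (q : ℤ) ((r' : ℤ) - r) := by
        refine (Nat.prime_iff_prime_int.1 h1).coprime_iff_not_dvd.2 fun hd => hne ?_
        have := Int.eq_zero_of_abs_lt_dvd hd (by rw [abs_lt]; constructor <;> omega)
        omega
      refine int_not_mem_of_isCoprime hp hc (by simpa using hq) ?_
      have := (Qf q r).sub_mem hr hr'
      rwa [sub_sub_sub_cancel_left, ← Int.cast_sub] at this
    subst hrr
    rfl
  have h1 := sum_log_absNorm_le hx (A.image fun z => Qf z.1 z.2) (fun Q hQ => by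
    obtain ⟨z, hz, rfl⟩ := Finset.mem_image.1 hQ
    obtain ⟨-, h2, h3, -⟩ := hA' z hz
    exact ⟨h2, h3, (hA z hz).2.2⟩)
  rw [Finset.sum_image hinj] at h1
  refine (Finset.sum_le_sum fun z hz => ?_).trans h1
  obtain ⟨-, h2, h3, h4, -⟩ := hA' z hz
  exact log_le_log_absNorm h2 h3 (hA z hz).1 h4

/-- An upper bound of Mertens type for the number of root residues. -/
theorem sum_card_rootResidues_le
    (hli : LinearIndependent ℚ fun i : Fin d => (θ : K) ^ (i : ℕ))
    (hd : Module.finrank ℚ K = d) (hG : 1 ≤ G) (hσ : ∀ σ : K →ₐ[ℚ] ℂ, ‖σ θ‖ ≤ G)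
    (hnorm : ∀ r : ℤ, Ideal.absNorm (Ideal.span {θ - (r : 𝓞 K)}) = (h.eval r).natAbs)
    {n : ℕ} (hn : n ≠ 0) :
    ∑ q ∈ Nat.primesLE n, ((rootResidues h q).card : ℝ) * (Real.log q / q) ≤
      Real.log n + d * (Real.log (2 * d * G ^ d) + Real.log 4) := by
  classical
  have hd0 : d ≠ 0 := by rw [← hd]; exact Module.finrank_pos.ne'
  have hexQ : ∀ q r : ℕ, ∃ Q : Ideal (𝓞 K), q.Prime → (q : ℤ) ∣ h.eval (r : ℤ) →
      Q.IsPrime ∧ Q ≠ ⊥ ∧ (q : 𝓞 K) ∈ Q ∧ θ - ((r : ℤ) : 𝓞 K) ∈ Q := fun q r => by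
    by_cases hq : q.Prime ∧ (q : ℤ) ∣ h.eval (r : ℤ)
    · obtain ⟨Q, hQ⟩ := exists_prime_of_dvd_eval hnorm hq.1 hq.2
      exact ⟨Q, fun _ _ => hQ⟩
    · exact ⟨⊥, fun h1 h2 => absurd ⟨h1, h2⟩ hq⟩
  choose Qf hQf using hexQ
  obtain ⟨s, hs, hs'⟩ := exists_pow_le_lt_succ_pow hd0 n
  have hs0 : s ≠ 0 := by
    rintro rfl
    simp at hs'
    exact hn hs'
  set X : ℕ := s + 1 with hX
  set B : Finset (Fin d → ℤ) := Fintype.piFinset fun _ => Finset.Ico (0 : ℤ) X with hB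
  have hBcard : B.card = X ^ d := by simp [hB]
  set I := (Nat.primesLE n).sigma fun q => rootResidues h q with hI
  have hImem : ∀ z ∈ I, z.1.Prime ∧ z.2 ∈ rootResidues h z.1 := fun z hz => by
    obtain ⟨h1, h2⟩ := Finset.mem_sigma.1 hz
    exact ⟨(Nat.mem_primesLE.1 h1).2, h2⟩
  set P : (Σ _ : ℕ, ℕ) → (Fin d → ℤ) × (Fin d → ℤ) → Prop := fun z u =>
    powerEval (z.2 : ℤ) u.1 % z.1 = powerEval (z.2 : ℤ) u.2 % z.1 with hP
  set M : ℝ := d * Real.log (d * G ^ d * X) with hM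
  have hM0 : 0 ≤ M := by
    refine mul_nonneg (Nat.cast_nonneg _) (Real.log_nonneg ?_)
    have : 1 ≤ d * G ^ d * X := Nat.one_le_iff_ne_zero.2 (by positivity)
    exact_mod_cast this
  have hpair : ∀ u ∈ B.offDiag, ∑ z ∈ I with P z u, Real.log z.1 ≤ M := by
    intro u hu
    obtain ⟨hu1, hu2, hne⟩ := Finset.mem_offDiag.1 hu
    refine (sum_log_rootResidues_le hQf (powerEval_ne_zero hli (sub_ne_zero.2 hne)) _
      fun z hz => ?_).trans ?_
    · obtain ⟨hzI, hzP⟩ := Finset.mem_filter.1 hz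
      obtain ⟨h1, h2⟩ := hImem z hzI
      obtain ⟨-, -, h3, h4⟩ := hQf z.1 z.2 h1 (Finset.mem_filter.1 h2).2
      refine ⟨h1, h2, powerEval_mem_of_dvd h3 h4 ?_⟩
      rw [powerEval_sub]
      exact Int.ModEq.dvd (Int.ModEq.symm hzP)
    · have h1 : ∀ σ : K →ₐ[ℚ] ℂ, ‖σ (powerEval θ (u.1 - u.2) : 𝓞 K)‖ ≤ d * G ^ d * X :=
        fun σ => by
        rw [algHom_powerEval]
        refine norm_powerEval_le hG (hσ σ) fun i => ?_
        have h1 := Finset.mem_Ico.1 (Fintype.mem_piFinset.1 hu1 i)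
        have h2 := Finset.mem_Ico.1 (Fintype.mem_piFinset.1 hu2 i)
        have h3 : |(u.1 - u.2) i| ≤ X := by
          rw [Pi.sub_apply, abs_le]
          constructor <;> omega
        exact_mod_cast h3
      have h2 := absNorm_span_le_pow h1
      rw [hd] at h2
      rw [hM, ← Real.log_pow]
      refine Real.log_le_log ?_ h2
      exact_mod_cast absNorm_pos
        (span_singleton_ne_bot (powerEval_ne_zero hli (sub_ne_zero.2 hne)))
  have hsum := Finset.sum_le_sum hpair
  rw [Finset.sum_const, nsmul_eq_mul] at hsum
  have hoff : (B.offDiag.card : ℝ) ≤ ((X : ℝ) ^ d) ^ 2 := by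
    rw [Finset.offDiag_card, hBcard]
    have : X ^ d * X ^ d - X ^ d ≤ (X ^ d) ^ 2 := by rw [sq]; exact Nat.sub_le _ _
    exact_mod_cast this
  have hcount : ∀ z ∈ I, ((X : ℝ) ^ d) ^ 2 / z.1 - (X : ℝ) ^ d ≤
      (Finset.card {u ∈ B.offDiag | P z u} : ℕ) := by
    intro z hz
    have hz1 := (hImem z hz).1
    have hpos : (0 : ℝ) < z.1 := by exact_mod_cast hz1.pos
    have h1 := card_sq_le_card_mul B (fun u => powerEval (z.2 : ℤ) u % z.1)
      (Finset.Ico (0 : ℤ) z.1) (fun u _ => Finset.mem_Ico.2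
        ⟨Int.emod_nonneg _ (by exact_mod_cast hz1.ne_zero),
          Int.emod_lt_of_pos _ (by exact_mod_cast hz1.pos)⟩)
    have h2 : Finset.card {u ∈ B ×ˢ B | P z u} ≤
        Finset.card {u ∈ B.offDiag | P z u} + B.card := by
      rw [← Finset.diag_union_offDiag, Finset.filter_union]
      refine (Finset.card_union_le _ _).trans ?_
      rw [add_comm]
      refine Nat.add_le_add_left ((Finset.card_filter_le _ _).trans_eq (Finset.diag_card _)) _
    rw [Int.card_Ico, sub_zero, Int.toNat_natCast, hBcard] at h1
    rw [hBcard] at h2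
    have h3 : (X ^ d) ^ 2 ≤ z.1 * (Finset.card {u ∈ B.offDiag | P z u} + X ^ d) :=
      h1.trans (Nat.mul_le_mul_left _ h2)
    have h4 : ((X : ℝ) ^ d) ^ 2 ≤
        z.1 * ((Finset.card {u ∈ B.offDiag | P z u} : ℕ) + (X : ℝ) ^ d) := by
      exact_mod_cast h3
    rw [sub_le_iff_le_add, div_le_iff₀ hpos]
    linarith
  have hswap : ∑ u ∈ B.offDiag, ∑ z ∈ I with P z u, Real.log z.1
      = ∑ z ∈ I, (Finset.card {u ∈ B.offDiag | P z u} : ℕ) * Real.log z.1 := by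
    simp only [Finset.sum_filter]
    rw [Finset.sum_comm]
    refine Finset.sum_congr rfl fun z _ => ?_
    rw [← Finset.sum_filter, Finset.sum_const, nsmul_eq_mul]
  have hlower : ∑ z ∈ I, (((X : ℝ) ^ d) ^ 2 / z.1 - (X : ℝ) ^ d) * Real.log z.1 ≤
      ((X : ℝ) ^ d) ^ 2 * M := by
    calc _ ≤ ∑ z ∈ I, (Finset.card {u ∈ B.offDiag | P z u} : ℕ) * Real.log z.1 :=
          Finset.sum_le_sum fun z hz =>
            mul_le_mul_of_nonneg_right (hcount z hz) (Real.log_natCast_nonneg _)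
      _ ≤ B.offDiag.card * M := by rw [← hswap]; exact hsum
      _ ≤ _ := mul_le_mul_of_nonneg_right hoff hM0
  have htheta : ∑ z ∈ I, Real.log z.1 ≤ d * (Real.log 4 * n) := by
    rw [hI, Finset.sum_sigma]
    calc ∑ q ∈ Nat.primesLE n, ∑ r ∈ rootResidues h q, Real.log q
        ≤ ∑ q ∈ Nat.primesLE n, d * Real.log q := by
          refine Finset.sum_le_sum fun q hq => ?_
          have hqp := (Nat.mem_primesLE.1 hq).2
          have h1 := sum_log_rootResidues_le hQf
            (show (q : 𝓞 K) ≠ 0 by exact_mod_cast hqp.ne_zero)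
            (({q} : Finset ℕ).sigma fun q => rootResidues h q) (fun z hz => by
              obtain ⟨h1, h2⟩ := Finset.mem_sigma.1 hz
              rw [Finset.mem_singleton] at h1
              have hzp : z.1.Prime := h1 ▸ hqp
              have h3 := (hQf z.1 z.2 hzp (Finset.mem_filter.1 h2).2).2.2.1
              rw [h1] at h3
              exact ⟨hzp, h2, by rw [h1]; exact h3⟩)
          rw [Finset.sum_sigma, Finset.sum_singleton, absNorm_span_natCast', hd] at h1
          push_cast at h1
          rwa [Real.log_pow] at h1
      _ ≤ _ := by
          rw [← Finset.mul_sum]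
          exact mul_le_mul_of_nonneg_left (sum_log_primesLE_le n) (Nat.cast_nonneg _)
  have hmain : ∑ q ∈ Nat.primesLE n, ((rootResidues h q).card : ℝ) * (Real.log q / q)
      = ∑ z ∈ I, Real.log z.1 / z.1 := by
    rw [hI, Finset.sum_sigma]
    simp
  have hXd : (0 : ℝ) < (X : ℝ) ^ d := by positivity
  have hnX : (n : ℝ) ≤ (X : ℝ) ^ d := by exact_mod_cast hs'.le
  have hfin : ∑ z ∈ I, Real.log z.1 / z.1 ≤ M + d * Real.log 4 := by
    have h1 : ∑ z ∈ I, (((X : ℝ) ^ d) ^ 2 / z.1 - (X : ℝ) ^ d) * Real.log z.1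
        = ((X : ℝ) ^ d) ^ 2 * (∑ z ∈ I, Real.log z.1 / z.1)
          - (X : ℝ) ^ d * ∑ z ∈ I, Real.log z.1 := by
      rw [Finset.mul_sum, Finset.mul_sum, ← Finset.sum_sub_distrib]
      exact Finset.sum_congr rfl fun z _ => by ring
    rw [h1] at hlower
    have hlog4 : 0 ≤ Real.log 4 := Real.log_nonneg (by norm_num)
    have h2 : (X : ℝ) ^ d * ∑ z ∈ I, Real.log z.1 ≤ ((X : ℝ) ^ d) ^ 2 * (d * Real.log 4) := by
      rw [sq, mul_assoc]
      refine mul_le_mul_of_nonneg_left (htheta.trans ?_) hXd.le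
      calc (d : ℝ) * (Real.log 4 * n) = n * (d * Real.log 4) := by ring
        _ ≤ _ := mul_le_mul_of_nonneg_right hnX (by positivity)
    have h3 : ((X : ℝ) ^ d) ^ 2 * (∑ z ∈ I, Real.log z.1 / z.1) ≤
        ((X : ℝ) ^ d) ^ 2 * (M + d * Real.log 4) := by linarith
    exact le_of_mul_le_mul_left h3 (by positivity)
  rw [hmain]
  refine hfin.trans ?_
  have hM' : M ≤ Real.log n + d * Real.log (2 * d * G ^ d) := by
    have hs0' : (0 : ℝ) < s := by positivity
    have h1 : Real.log (d * G ^ d * X) ≤ Real.log (2 * d * G ^ d) + Real.log s := by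
      rw [← Real.log_mul (by positivity) hs0'.ne']
      refine Real.log_le_log (by positivity) ?_
      have : (X : ℝ) ≤ 2 * s := by
        have : X ≤ 2 * s := by omega
        exact_mod_cast this
      calc (d : ℝ) * G ^ d * X ≤ d * G ^ d * (2 * s) := by gcongr
        _ = _ := by ring
    have h2 : d * Real.log s ≤ Real.log n := by
      rw [← Real.log_pow]
      exact Real.log_le_log (by positivity) (by exact_mod_cast hs)
    calc M ≤ d * (Real.log (2 * d * G ^ d) + Real.log s) :=
          mul_le_mul_of_nonneg_left h1 (Nat.cast_nonneg _)
      _ ≤ _ := by linarith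
  linarith

end UpperBound

theorem card_rootResidues_le {h : Polynomial ℤ} (hm : h.Monic) {q : ℕ} (hq : q.Prime) :
    (rootResidues h q).card ≤ h.natDegree := by
  classical
  have := Fact.mk hq
  have h0 : h.map (Int.castRingHom (ZMod q)) ≠ 0 := (hm.map _).ne_zero
  calc (rootResidues h q).card
      ≤ (h.map (Int.castRingHom (ZMod q))).roots.toFinset.card := by
        refine Finset.card_le_card_of_injOn (fun r => (r : ZMod q)) (fun r hr => ?_)
          fun r hr s hs hrs => ?_
        · have hr' := (Finset.mem_filter.1 hr).2
          rw [Finset.mem_coe, Multiset.mem_toFinset, Polynomial.mem_roots h0,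
            Polynomial.IsRoot,
            show ((fun r : ℕ => (r : ZMod q)) r) = ((r : ℤ) : ZMod q) by simp,
            Polynomial.eval_intCast_map, eq_intCast]
          exact (ZMod.intCast_zmod_eq_zero_iff_dvd _ q).2 hr'
        · have hr' := Finset.mem_range.1 (Finset.mem_filter.1 hr).1
          have hs' := Finset.mem_range.1 (Finset.mem_filter.1 hs).1
          have := (ZMod.natCast_eq_natCast_iff' r s q).1 hrs
          rwa [Nat.mod_eq_of_lt hr', Nat.mod_eq_of_lt hs'] at this
    _ ≤ Multiset.card (h.map (Int.castRingHom (ZMod q))).roots := Multiset.toFinset_card_le _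
    _ ≤ (h.map (Int.castRingHom (ZMod q))).natDegree := Polynomial.card_roots' _
    _ = h.natDegree := hm.natDegree_map _

section PrimeCount

open NumberField

variable {L : Type*} [Field L] [NumberField L]

theorem exists_sub_natCast_mem {Q : Ideal (𝓞 L)} (hQ : (Ideal.absNorm Q).Prime) (x : 𝓞 L) :
    ∃ r < Ideal.absNorm Q, x - (r : 𝓞 L) ∈ Q := by
  set q := Ideal.absNorm Q with hq
  have hfin : Finite (𝓞 L ⧸ Q) := (Ideal.absNorm_ne_zero_iff Q).1 hQ.ne_zero
  have := Fintype.ofFinite (𝓞 L ⧸ Q)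
  have hcard : Fintype.card (𝓞 L ⧸ Q) = q := by
    rw [hq, Ideal.absNorm_apply, Submodule.cardQuot_apply, Nat.card_eq_fintype_card]
  let e := ZMod.ringEquivOfPrime (𝓞 L ⧸ Q) hQ hcard
  have : NeZero q := ⟨hQ.ne_zero⟩
  refine ⟨(e.symm (Ideal.Quotient.mk Q x)).val, ZMod.val_lt _, ?_⟩
  rw [← Ideal.Quotient.eq_zero_iff_mem, map_sub, map_natCast, sub_eq_zero]
  apply e.symm.injective
  rw [map_natCast, ZMod.natCast_zmod_val]

theorem isPrime_of_prime_absNorm {Q : Ideal (𝓞 L)} (hQ : (Ideal.absNorm Q).Prime) :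
    Q.IsPrime ∧ Q ≠ ⊥ ∧ ((Ideal.absNorm Q : ℕ) : 𝓞 L) ∈ Q :=
  ⟨Ideal.isPrime_of_irreducible_absNorm (Nat.irreducible_iff_nat_prime _ |>.2 hQ),
    fun h => hQ.ne_zero (by simp [h]), Ideal.absNorm_mem Q⟩

theorem intCast_mem_iff {Q : Ideal (𝓞 L)} (hQ : (Ideal.absNorm Q).Prime) (x : ℤ) :
    (x : 𝓞 L) ∈ Q ↔ (Ideal.absNorm Q : ℤ) ∣ x := by
  obtain ⟨h1, -, h3⟩ := isPrime_of_prime_absNorm hQ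
  constructor
  · intro hx
    by_contra hdvd
    have hc : IsCoprime (Ideal.absNorm Q : ℤ) x :=
      (Nat.prime_iff_prime_int.1 hQ).irreducible.coprime_iff_not_dvd.2 hdvd
    exact int_not_mem_of_isCoprime h1 hc (by simpa using h3) hx
  · rintro ⟨c, rfl⟩
    push_cast
    exact Q.mul_mem_right _ h3

theorem mem_rootResidues_of_sub_mem {Q : Ideal (𝓞 L)} (hQ : (Ideal.absNorm Q).Prime)
    {h : Polynomial ℤ} {β : 𝓞 L} (hβ : Polynomial.aeval β h = 0) {r : ℕ}
    (hr : r < Ideal.absNorm Q) (hmem : β - (r : 𝓞 L) ∈ Q) :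
    r ∈ rootResidues h (Ideal.absNorm Q) := by
  refine Finset.mem_filter.2 ⟨Finset.mem_range.2 hr, (intCast_mem_iff hQ _).1 ?_⟩
  have h1 : β - (r : 𝓞 L) ∣ Polynomial.aeval β h - Polynomial.aeval (r : 𝓞 L) h := by
    simpa [Polynomial.aeval_def, Polynomial.eval₂_eq_eval_map] using
      Polynomial.sub_dvd_eval_sub β (r : 𝓞 L) (h.map (algebraMap ℤ (𝓞 L)))
  rw [hβ, zero_sub, dvd_neg] at h1
  have h2 : Polynomial.aeval (r : 𝓞 L) h = ((h.eval (r : ℤ) : ℤ) : 𝓞 L) := by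
    rw [← Int.cast_natCast r]
    simpa using Polynomial.aeval_algebraMap_apply (𝓞 L) (r : ℤ) h
  rw [← h2]
  exact Q.mem_of_dvd h1 hmem

variable {β₁ β₂ : 𝓞 L} {c m G D : ℕ} {h : Polynomial ℤ}

theorem IsBoundedGenerator.le_of_sub_mem (hg : IsBoundedGenerator (β₁ + (c : 𝓞 L) * β₂) m G D)
    {q : ℕ} (hq : q.Prime) (hqD : ¬ q ∣ D) {Q Q' : Ideal (𝓞 L)} (hQ : Ideal.absNorm Q = q)
    (hQ' : Ideal.absNorm Q' = q) {r s : ℕ} (h₁ : β₁ - (r : 𝓞 L) ∈ Q) (h₂ : β₂ - (s : 𝓞 L) ∈ Q)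
    (h₁' : β₁ - (r : 𝓞 L) ∈ Q') (h₂' : β₂ - (s : 𝓞 L) ∈ Q') : Q ≤ Q' := by
  intro x hx
  have key : ∀ P : Ideal (𝓞 L), β₁ - (r : 𝓞 L) ∈ P → β₂ - (s : 𝓞 L) ∈ P → ∀ v : Fin m → ℤ,
      powerEval (β₁ + c * β₂) v - ((powerEval ((r : ℤ) + c * s) v : ℤ) : 𝓞 L) ∈ P := by
    intro P hP₁ hP₂ v
    have h3 : ((powerEval ((r : ℤ) + c * s) v : ℤ) : 𝓞 L) = powerEval ((r : 𝓞 L) + c * s) v := by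
      have := map_powerEval (Int.castRingHom (𝓞 L)) ((r : ℤ) + c * s) v
      simpa using this
    rw [h3, ← Ideal.Quotient.eq, map_powerEval, map_powerEval]
    congr 1
    rw [Ideal.Quotient.eq]
    have : β₁ + c * β₂ - ((r : 𝓞 L) + c * s) = (β₁ - r) + c * (β₂ - s) := by ring
    rw [this]
    exact P.add_mem hP₁ (P.mul_mem_left _ hP₂)
  obtain ⟨v, hv⟩ := hg.exists_eq_index_mul x
  have h4 : ((powerEval ((r : ℤ) + c * s) v : ℤ) : 𝓞 L) ∈ Q := by
    have := Q.sub_mem (Q.mul_mem_left (D : 𝓞 L) hx) (hv ▸ key Q h₁ h₂ v)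
    simpa using this
  have h5 : ((powerEval ((r : ℤ) + c * s) v : ℤ) : 𝓞 L) ∈ Q' := by
    rw [intCast_mem_iff (hQ' ▸ hq), hQ', ← hQ, ← intCast_mem_iff (hQ ▸ hq)]
    exact h4
  have h6 : (D : 𝓞 L) * x ∈ Q' := by
    have := Q'.add_mem (key Q' h₁' h₂' v) h5
    rwa [sub_add_cancel, hv] at this
  refine ((isPrime_of_prime_absNorm (hQ' ▸ hq)).1.mem_or_mem h6).resolve_left fun h7 => hqD ?_
  have := (intCast_mem_iff (hQ' ▸ hq) (D : ℤ)).1 (by simpa using h7)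
  rw [hQ'] at this
  exact_mod_cast this

/-- Away from finitely many primes, a prime ideal of norm `q` determines an ordered pair of
distinct roots of `h` modulo `q`. -/
theorem IsBoundedGenerator.card_absNorm_eq_le (hg : IsBoundedGenerator (β₁ + (c : 𝓞 L) * β₂) m G D)
    (h₁ : Polynomial.aeval β₁ h = 0) (h₂ : Polynomial.aeval β₂ h = 0) {q : ℕ} (hq : q.Prime)
    (hqD : ¬ q ∣ D) (hqN : ¬ q ∣ Ideal.absNorm (Ideal.span {β₁ - β₂}))
    (T : Finset (Ideal (𝓞 L))) (hT : ∀ Q ∈ T, Ideal.absNorm Q = q) :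
    T.card ≤ (rootResidues h q).card * ((rootResidues h q).card - 1) := by
  classical
  rw [Nat.mul_sub_one, ← Finset.offDiag_card]
  have hex : ∀ (β : 𝓞 L) (Q : Ideal (𝓞 L)), ∃ r : ℕ, Q ∈ T → r < q ∧ β - (r : 𝓞 L) ∈ Q := by
    intro β Q
    by_cases hQ : Q ∈ T
    · obtain ⟨r, hr, hr'⟩ := exists_sub_natCast_mem (hT Q hQ ▸ hq) β
      exact ⟨r, fun _ => ⟨hT Q hQ ▸ hr, hr'⟩⟩
    · exact ⟨0, fun h => (hQ h).elim⟩
  choose f hf using hex β₁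
  choose g hg' using hex β₂
  have hmem : ∀ Q ∈ T, f Q ∈ rootResidues h q ∧ g Q ∈ rootResidues h q := fun Q hQ => by
    have hp : (Ideal.absNorm Q).Prime := hT Q hQ ▸ hq
    constructor
    · have := mem_rootResidues_of_sub_mem hp h₁ ((hT Q hQ).symm ▸ (hf Q hQ).1) (hf Q hQ).2
      rwa [hT Q hQ] at this
    · have := mem_rootResidues_of_sub_mem hp h₂ ((hT Q hQ).symm ▸ (hg' Q hQ).1) (hg' Q hQ).2
      rwa [hT Q hQ] at this
  refine Finset.card_le_card_of_injOn (fun Q => (f Q, g Q)) (fun Q hQ => ?_)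
    fun Q hQ Q' hQ' he => ?_
  · rw [Finset.mem_coe] at hQ
    rw [Finset.mem_coe, Finset.mem_offDiag]
    refine ⟨(hmem Q hQ).1, (hmem Q hQ).2, fun heq => hqN ?_⟩
    rw [← hT Q hQ]
    refine Ideal.absNorm_dvd_absNorm_of_le ?_
    rw [Ideal.span_singleton_le_iff_mem]
    have heq' : f Q = g Q := heq
    have := Q.sub_mem (hf Q hQ).2 (hg' Q hQ).2
    rwa [heq', sub_sub_sub_cancel_right] at this
  · rw [Finset.mem_coe] at hQ hQ'
    obtain ⟨he1, he2⟩ := Prod.mk.inj he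
    have h1' := (hf Q' hQ').2
    have h2' := (hg' Q' hQ').2
    rw [← he1] at h1'
    rw [← he2] at h2'
    exact le_antisymm
      (hg.le_of_sub_mem hq hqD (hT Q hQ) (hT Q' hQ') (hf Q hQ).2 (hg' Q hQ).2 h1' h2')
      (hg.le_of_sub_mem hq hqD (hT Q' hQ') (hT Q hQ) h1' h2' (hf Q hQ).2 (hg' Q hQ).2)

theorem card_mul_log_le {q : ℕ} (hq : q.Prime) (T : Finset (Ideal (𝓞 L)))
    (hT : ∀ Q ∈ T, Ideal.absNorm Q = q) :
    T.card * Real.log q ≤ Module.finrank ℚ L * Real.log q := by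
  have h0 : (q : 𝓞 L) ≠ 0 := by exact_mod_cast hq.ne_zero
  have h1 := sum_log_absNorm_le h0 T fun Q hQ => by
    obtain ⟨h1, h2, h3⟩ := isPrime_of_prime_absNorm (hT Q hQ ▸ hq)
    exact ⟨h1, h2, by rwa [hT Q hQ] at h3⟩
  rw [absNorm_span_natCast', Finset.sum_congr rfl fun Q hQ => by rw [hT Q hQ], Finset.sum_const,
    nsmul_eq_mul] at h1
  push_cast at h1
  rwa [Real.log_pow] at h1

theorem IsBoundedGenerator.sum_log_div_absNorm_le
    (hg : IsBoundedGenerator (β₁ + (c : 𝓞 L) * β₂) m G D)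
    (hm : h.Monic) (h₁ : Polynomial.aeval β₁ h = 0) (h₂ : Polynomial.aeval β₂ h = 0)
    (hne : β₁ ≠ β₂) {n : ℕ} (T : Finset (Ideal (𝓞 L)))
    (hT : ∀ Q ∈ T, (Ideal.absNorm Q).Prime ∧ Ideal.absNorm Q ≤ n) :
    ∑ Q ∈ T, Real.log (Ideal.absNorm Q) / Ideal.absNorm Q ≤
      h.natDegree * ∑ q ∈ Nat.primesLE n with rootResidues h q ≠ ∅,
        (((rootResidues h q).card : ℝ) - 1) * (Real.log q / q) +
      m * (Real.log D + Real.log (Ideal.absNorm (Ideal.span {β₁ - β₂}))) := by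
  classical
  set N := Ideal.absNorm (Ideal.span {β₁ - β₂}) with hN
  have hN0 : N ≠ 0 := (absNorm_pos (span_singleton_ne_bot (sub_ne_zero.2 hne))).ne'
  have hD0 := hg.index_ne_zero
  have hlogq : ∀ q : ℕ, 0 ≤ Real.log q / q := fun q =>
    div_nonneg (Real.log_natCast_nonneg q) (Nat.cast_nonneg q)
  set T' : ℕ → Finset (Ideal (𝓞 L)) := fun q => {Q ∈ T | Ideal.absNorm Q = q} with hT'
  have hT'mem : ∀ q, ∀ Q ∈ T' q, Ideal.absNorm Q = q := fun q Q hQ => (Finset.mem_filter.1 hQ).2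
  have hfib : ∑ Q ∈ T, Real.log (Ideal.absNorm Q) / Ideal.absNorm Q =
      ∑ q ∈ Nat.primesLE n, (T' q).card * (Real.log q / q) := by
    rw [← Finset.sum_fiberwise_of_maps_to (g := fun Q => Ideal.absNorm Q) (t := Nat.primesLE n)
      fun Q hQ => Nat.mem_primesLE.2 ⟨(hT Q hQ).2, (hT Q hQ).1⟩]
    refine Finset.sum_congr rfl fun q _ => ?_
    rw [Finset.sum_congr rfl fun Q hQ => by rw [(Finset.mem_filter.1 hQ).2], Finset.sum_const,
      nsmul_eq_mul]
  have hbound : ∀ q ∈ Nat.primesLE n, (T' q).card * (Real.log q / q) ≤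
      (if rootResidues h q ≠ ∅ then
        h.natDegree * ((((rootResidues h q).card : ℝ) - 1) * (Real.log q / q)) else 0) +
      (if q ∈ (D * N).primeFactors then m * Real.log q else 0) := by
    intro q hq
    have hqp := (Nat.mem_primesLE.1 hq).2
    have hnn : 0 ≤ (if rootResidues h q ≠ ∅ then
        h.natDegree * ((((rootResidues h q).card : ℝ) - 1) * (Real.log q / q)) else 0) := by
      split_ifs with hs
      · have : (1 : ℝ) ≤ (rootResidues h q).card := by
          exact_mod_cast Finset.card_pos.2 (Finset.nonempty_iff_ne_empty.2 hs)
        have := hlogq q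
        have : (0 : ℝ) ≤ ((rootResidues h q).card : ℝ) - 1 := by linarith
        positivity
      · exact le_rfl
    by_cases hbad : q ∈ (D * N).primeFactors
    · rw [if_pos hbad]
      have h1 := card_mul_log_le hqp (T' q) (hT'mem q)
      rw [hg.finrank_eq] at h1
      have h2 : (T' q).card * (Real.log q / q) ≤ (T' q).card * Real.log q := by
        refine mul_le_mul_of_nonneg_left ?_ (Nat.cast_nonneg _)
        exact div_le_self (Real.log_natCast_nonneg q) (by exact_mod_cast hqp.one_le)
      linarith
    · rw [if_neg hbad, add_zero]
      have hndvd : ¬ q ∣ D * N := fun hd =>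
        hbad (Nat.mem_primeFactors.2 ⟨hqp, hd, mul_ne_zero hD0 hN0⟩)
      have h1 := hg.card_absNorm_eq_le h₁ h₂ hqp (fun hd => hndvd (hd.mul_right _))
        (fun hd => hndvd (hd.mul_left _)) (T' q) (hT'mem q)
      by_cases hs : rootResidues h q = ∅
      · rw [hs, Finset.card_empty, zero_mul, Nat.le_zero] at h1
        simp [h1, hs]
      · rw [if_pos hs]
        have hpos : 1 ≤ (rootResidues h q).card :=
          Finset.card_pos.2 (Finset.nonempty_iff_ne_empty.2 hs)
        have h2 : ((T' q).card : ℝ) ≤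
            h.natDegree * (((rootResidues h q).card : ℝ) - 1) := by
          calc ((T' q).card : ℝ)
              ≤ ((rootResidues h q).card * ((rootResidues h q).card - 1) : ℕ) := by
                exact_mod_cast h1
            _ ≤ (h.natDegree * ((rootResidues h q).card - 1) : ℕ) := by
              exact_mod_cast Nat.mul_le_mul_right _ (card_rootResidues_le hm hqp)
            _ = _ := by push_cast [hpos]; ring
        rw [← mul_assoc]
        exact mul_le_mul_of_nonneg_right h2 (hlogq q)
  rw [hfib]
  refine (Finset.sum_le_sum hbound).trans ?_
  rw [Finset.sum_add_distrib, Finset.mul_sum, ← Finset.sum_filter, ← Finset.sum_filter]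
  refine add_le_add le_rfl ?_
  calc ∑ q ∈ Nat.primesLE n with q ∈ (D * N).primeFactors, (m : ℝ) * Real.log q
      ≤ ∑ q ∈ (D * N).primeFactors, (m : ℝ) * Real.log q :=
        Finset.sum_le_sum_of_subset_of_nonneg (fun q hq => (Finset.mem_filter.1 hq).2)
          fun q _ _ => mul_nonneg (Nat.cast_nonneg _) (Real.log_natCast_nonneg q)
    _ ≤ m * Real.log ((D * N : ℕ) : ℝ) := by
        rw [← Finset.mul_sum]
        exact mul_le_mul_of_nonneg_left (sum_log_primeFactors_le (mul_ne_zero hD0 hN0))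
          (Nat.cast_nonneg _)
    _ = _ := by
        push_cast
        rw [Real.log_mul (by exact_mod_cast hD0) (by exact_mod_cast hN0)]

end PrimeCount

section Generator

open NumberField Polynomial

variable {L : Type*} [Field L] [NumberField L] {α : 𝓞 L} {m B : ℕ}

theorem natDegree_minpoly_int : (minpoly ℤ α).natDegree = (minpoly ℚ (α : L)).natDegree := by
  have h : minpoly ℤ (α : L) = minpoly ℤ α :=
    minpoly.algebraMap_eq (RingOfIntegers.coe_injective (K := L)) α
  rw [minpoly.isIntegrallyClosed_eq_field_fractions' ℚ α.isIntegral_coe, h,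
    (minpoly.monic α.isIntegral).natDegree_map]

omit [NumberField L] in
theorem powerEval_coeff {p : ℤ[X]} (hp : p.natDegree < m) (β : 𝓞 L) :
    powerEval β (fun i : Fin m => p.coeff i) = aeval β p := by
  rw [aeval_eq_sum_range' hp, powerEval, Finset.sum_range]
  simp

omit [NumberField L] in
theorem exists_powerEval_eq_of_mem_adjoin (hm : (minpoly ℤ α).natDegree = m) (hm0 : m ≠ 0)
    {y : 𝓞 L} (hy : (y : L) ∈ Algebra.adjoin ℤ {(α : L)}) :
    ∃ v : Fin m → ℤ, powerEval α v = y := by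
  rw [Algebra.adjoin_singleton_eq_range_aeval] at hy
  obtain ⟨p, hp⟩ := hy
  have hmonic := minpoly.monic (A := ℤ) α.isIntegral
  refine ⟨fun i => (p %ₘ minpoly ℤ α).coeff i, ?_⟩
  rw [powerEval_coeff (hm ▸ natDegree_modByMonic_lt p hmonic fun h => hm0 (by rw [← hm, h]; simp)),
    aeval_modByMonic_eq_self_of_root (minpoly.aeval ℤ α)]
  apply RingOfIntegers.coe_injective (K := L)
  exact (aeval_algebraMap_apply L α p).symm.trans hp

theorem abs_coeff_minpoly_le (hm : Module.finrank ℚ L = m) (hB1 : 1 ≤ B)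
    (hB : ∀ σ : L →ₐ[ℚ] ℂ, ‖σ α‖ ≤ B) (i : ℕ) :
    |(minpoly ℤ α).coeff i| ≤ (((2 * B) ^ m : ℕ) : ℤ) := by
  have h1 := Embeddings.coeff_bdd_of_norm_le (A := ℂ) (x := (α : L)) (B := B)
    (fun φ => hB (RingHom.toRatAlgHom φ)) i
  have h : minpoly ℤ (α : L) = minpoly ℤ α :=
    minpoly.algebraMap_eq (RingOfIntegers.coe_injective (K := L)) α
  rw [minpoly.isIntegrallyClosed_eq_field_fractions' ℚ α.isIntegral_coe, h, coeff_map, eq_intCast,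
    Int.norm_cast_rat, Int.norm_eq_abs, hm, max_eq_left (by exact_mod_cast hB1)] at h1
  have h2 : (m.choose (m / 2) : ℝ) ≤ 2 ^ m := by exact_mod_cast Nat.choose_le_two_pow m _
  have h3 : |((minpoly ℤ α).coeff i : ℝ)| ≤ (((2 * B) ^ m : ℕ) : ℝ) := by
    refine h1.trans ?_
    push_cast
    rw [mul_pow, mul_comm]
    gcongr
  exact_mod_cast h3

theorem norm_discr_le (b : Fin m → L) {T : ℝ}
    (hm : Module.finrank ℚ L = m) (hT : ∀ i j, ∀ σ : L →ₐ[ℚ] ℂ, ‖σ (b i * b j)‖ ≤ T) :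
    |((Algebra.discr ℚ b : ℚ) : ℝ)| ≤ m.factorial * (m * T) ^ m := by
  have hent : ∀ i j, (IsAbsoluteValue.toAbsoluteValue (norm : ℂ → ℝ))
      ((Algebra.traceMatrix ℚ b).map (algebraMap ℚ ℂ) i j) ≤ m * T := by
    intro i j
    rw [Matrix.map_apply, Algebra.traceMatrix_apply, Algebra.traceForm_apply,
      trace_eq_sum_embeddings ℂ]
    refine (norm_sum_le _ _).trans ((Finset.sum_le_sum fun σ _ => hT i j σ).trans_eq ?_)
    rw [Finset.sum_const, Finset.card_univ, AlgHom.card, hm, nsmul_eq_mul]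
  have h := Matrix.det_le hent
  rw [Fintype.card_fin, nsmul_eq_mul] at h
  have h2 : ((Algebra.traceMatrix ℚ b).map (algebraMap ℚ ℂ)).det
      = ((Algebra.discr ℚ b : ℚ) : ℂ) := by
    rw [Algebra.discr_def, ← eq_ratCast (algebraMap ℚ ℂ), RingHom.map_det]
    rfl
  rw [h2] at h
  refine le_trans (le_of_eq ?_) h
  show _ = ‖((Algebra.discr ℚ b : ℚ) : ℂ)‖
  rw [← Complex.ofReal_ratCast, Complex.norm_real, Real.norm_eq_abs]

theorem exists_isBoundedGenerator (hα : IntermediateField.adjoin ℚ {(α : L)} = ⊤)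
    (hm : Module.finrank ℚ L = m) (hB1 : 1 ≤ B) (hB : ∀ σ : L →ₐ[ℚ] ℂ, ‖σ α‖ ≤ B) :
    ∃ D, IsBoundedGenerator α m ((2 * B) ^ m) D ∧
      D ≤ m.factorial * (m * B ^ (2 * m)) ^ m := by
  have hm0 : m ≠ 0 := by rw [← hm]; exact Module.finrank_pos.ne'
  have hdeg : (minpoly ℚ (α : L)).natDegree = m := by
    rw [← hm]; exact (Field.primitive_element_iff_minpoly_natDegree_eq ℚ (α : L)).1 hα
  have hdegZ : (minpoly ℤ α).natDegree = m := by rw [natDegree_minpoly_int, hdeg]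
  have hmonic := minpoly.monic (A := ℤ) α.isIntegral
  have hli : LinearIndependent ℚ fun i : Fin m => (α : L) ^ (i : ℕ) := by
    have := linearIndependent_pow (K := ℚ) (α : L)
    rwa [hdeg] at this
  have : Nonempty (Fin m) := ⟨⟨0, Nat.pos_of_ne_zero hm0⟩⟩
  let pb : PowerBasis ℚ L :=
    { gen := α
      dim := m
      basis := basisOfLinearIndependentOfCardEqFinrank hli (by rw [Fintype.card_fin, hm])
      basis_eq_pow := fun i => by simp }
  have hpb : ∀ i, pb.basis i = (α : L) ^ (i : ℕ) := pb.basis_eq_pow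
  obtain ⟨δ, hδ⟩ := IsIntegrallyClosed.isIntegral_iff.1
    (Algebra.discr_isIntegral (R := ℤ) ℚ (b := pb.basis) fun i => by
      rw [hpb]; exact α.isIntegral_coe.pow _)
  have hδ' : Algebra.discr ℚ pb.basis = (δ : ℚ) := by rw [← hδ]; simp
  have hδ0 : δ ≠ 0 := fun h0 => Algebra.discr_not_zero_of_basis ℚ pb.basis (by rw [hδ', h0]; simp)
  have hBpow : (B : ℝ) ≤ (2 * B : ℝ) ^ m := by
    have h1 : (1 : ℝ) ≤ B := by exact_mod_cast hB1
    calc (B : ℝ) ≤ 2 * B := by linarith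
      _ ≤ _ := le_self_pow₀ (by linarith) hm0
  refine ⟨δ.natAbs, ⟨hli, hm, ⟨fun i => -(minpoly ℤ α).coeff i, ?_, fun i => ?_⟩, ?_, ?_, ?_, ?_⟩,
    ?_⟩
  · have h1 := minpoly.aeval ℤ α
    rw [aeval_eq_sum_range, hdegZ, Finset.sum_range_succ, ← hdegZ, hmonic.coeff_natDegree, hdegZ,
      one_smul, Finset.sum_range] at h1
    rw [eq_neg_of_add_eq_zero_right h1, powerEval, ← Finset.sum_neg_distrib]
    simp
  · rw [abs_neg]; exact abs_coeff_minpoly_le hm hB1 hB i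
  · exact Nat.one_le_pow _ _ (by omega)
  · intro σ
    push_cast
    exact (hB σ).trans hBpow
  · exact Int.natAbs_ne_zero.2 hδ0
  · intro x
    have h1 : (((δ : 𝓞 L) * x : 𝓞 L) : L) ∈ Algebra.adjoin ℤ {(α : L)} := by
      have := Algebra.discr_mul_isIntegral_mem_adjoin (K := ℚ) (B := pb) (R := ℤ)
        α.isIntegral_coe x.isIntegral_coe
      rw [hδ'] at this
      simpa [Algebra.smul_def] using this
    have h2 : (((δ.natAbs : 𝓞 L) * x : 𝓞 L) : L) ∈ Algebra.adjoin ℤ {(α : L)} := by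
      rcases Int.natAbs_eq δ with h | h
      · rw [h] at h1
        simpa using h1
      · rw [h] at h1
        have := neg_mem h1
        simpa using this
    exact exists_powerEval_eq_of_mem_adjoin hdegZ hm0 h2
  · have h1 := norm_discr_le (T := (B : ℝ) ^ (2 * m)) pb.basis hm fun i j σ => by
      rw [hpb, hpb, ← pow_add, map_pow, norm_pow]
      refine (pow_le_pow_left₀ (norm_nonneg _) (hB σ) _).trans ?_
      refine pow_le_pow_right₀ (by exact_mod_cast hB1) ?_
      have hi : (i : ℕ) < m := i.2
      have hj : (j : ℕ) < m := j.2
      omega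
    rw [hδ'] at h1
    rw [← Nat.cast_le (α := ℝ), Nat.cast_natAbs]
    push_cast at h1 ⊢
    exact h1

end Generator

section Fields

open NumberField Polynomial

variable {h : ℤ[X]} {d B : ℕ}

theorem natAbs_eval_eq_absNorm {K : Type*} [Field K] [NumberField K] (pb : PowerBasis ℚ K)
    {θ : 𝓞 K} (hθ : (θ : K) = pb.gen) (hmin : minpoly ℚ pb.gen = h.map (Int.castRingHom ℚ))
    (r : ℤ) :
    Ideal.absNorm (Ideal.span {θ - (r : 𝓞 K)}) = (h.eval r).natAbs := by
  have h1 : Algebra.norm ℚ (algebraMap ℚ K r - pb.gen) = (minpoly ℚ pb.gen).eval (r : ℚ) := by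
    rw [Algebra.norm_eq_matrix_det pb.basis, ← charpoly_leftMulMatrix pb, Matrix.eval_charpoly,
      map_sub]
    congr 2
    rw [AlgHom.commutes, Matrix.algebraMap_eq_diagonal]
    rfl
  have h2 : Algebra.norm ℤ ((r : 𝓞 K) - θ) = h.eval r := by
    have h3 : ((Algebra.norm ℤ ((r : 𝓞 K) - θ) : ℤ) : ℚ) = ((h.eval r : ℤ) : ℚ) := by
      rw [Algebra.coe_norm_int]
      have h4 : (((r : 𝓞 K) - θ : 𝓞 K) : K) = algebraMap ℚ K r - pb.gen := by
        rw [← hθ]; simp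
      rw [h4, h1, hmin, eval_intCast_map]
      simp
    exact_mod_cast h3
  rw [← Ideal.span_singleton_neg, neg_sub, Ideal.absNorm_span_singleton, h2]

theorem minpoly_eq_map (hm : h.Monic) (hirr : Irreducible h) {z : ℂ} (hz : aeval z h = 0) :
    minpoly ℚ z = h.map (Int.castRingHom ℚ) := by
  symm
  refine minpoly.eq_of_irreducible_of_monic
    ((hm.irreducible_iff_irreducible_map_fraction_map (K := ℚ)).1 hirr) ?_ (hm.map _)
  exact (aeval_map_algebraMap ℚ z h).trans hz

theorem norm_algHom_le {L : Type*} [Field L] [NumberField L] {x : 𝓞 L} (hx : aeval x h = 0)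
    (hroot : ∀ z : ℂ, aeval z h = 0 → ‖z‖ ≤ B) (σ : L →ₐ[ℚ] ℂ) : ‖σ x‖ ≤ B := by
  apply hroot
  have h1 : aeval (x : L) h = 0 := by
    have := aeval_algebraMap_apply L x h
    rw [hx, map_zero] at this
    exact this
  have h2 := aeval_algHom_apply (σ.restrictScalars ℤ) (x : L) h
  rw [h1, map_zero] at h2
  exact h2

theorem aeval_ringOfIntegers_eq_zero {L : IntermediateField ℚ ℂ} {x : 𝓞 L}
    (hx : aeval ((x : L) : ℂ) h = 0) : aeval x h = 0 := by
  have h1 : algebraMap (𝓞 L) ℂ (aeval x h) = 0 := by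
    rw [← aeval_algebraMap_apply]; exact hx
  have hinj : Function.Injective (algebraMap (𝓞 L) ℂ) := by
    intro a b hab
    exact RingOfIntegers.coe_injective (K := L) (Subtype.ext hab)
  exact hinj (h1.trans (map_zero _).symm)

theorem sum_card_rootResidues_le_of_powerBasis {K : Type*} [Field K] [NumberField K]
    (pb : PowerBasis ℚ K) {θ : 𝓞 K} (hθ : (θ : K) = pb.gen)
    (hmin : minpoly ℚ pb.gen = h.map (Int.castRingHom ℚ)) (hm : h.Monic) (hd : h.natDegree = d)
    (hB1 : 1 ≤ B) (hσ : ∀ σ : K →ₐ[ℚ] ℂ, ‖σ θ‖ ≤ B) {n : ℕ} (hn : n ≠ 0) :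
    ∑ q ∈ Nat.primesLE n, ((rootResidues h q).card : ℝ) * (Real.log q / q) ≤
      Real.log n + d * (Real.log (2 * d * B ^ d) + Real.log 4) := by
  have hdim : pb.dim = d := by
    rw [← pb.natDegree_minpoly, hmin, hm.natDegree_map, hd]
  refine sum_card_rootResidues_le (θ := θ) (h := h) ?_ ?_ hB1 hσ
    (natAbs_eval_eq_absNorm pb hθ hmin) hn
  · rw [hθ]
    have := linearIndependent_pow (K := ℚ) pb.gen
    rwa [pb.natDegree_minpoly, hdim] at this
  · rw [pb.finrank, hdim]

/-- Each prime weighted by its number of roots of `h` has Mertens sum at most `log n`. -/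
theorem sum_card_rootResidues_le_log (hm : h.Monic) (hirr : Irreducible h)
    (hd : h.natDegree = d) (hB1 : 1 ≤ B) (hroot : ∀ z : ℂ, aeval z h = 0 → ‖z‖ ≤ B)
    {n : ℕ} (hn : n ≠ 0) :
    ∑ q ∈ Nat.primesLE n, ((rootResidues h q).card : ℝ) * (Real.log q / q) ≤
      Real.log n + d * (Real.log (2 * d * B ^ d) + Real.log 4) := by
  obtain ⟨z, hz⟩ := IsAlgClosed.exists_aeval_eq_zero_of_injective ℂ
    (RingHom.injective_int (algebraMap ℤ ℂ)) h
    (by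
      intro h0
      have := hm.natDegree_pos_of_not_isUnit hirr.not_isUnit
      rw [natDegree_eq_of_degree_eq_some h0] at this
      exact lt_irrefl _ this)
  have hint : IsIntegral ℤ z := ⟨h, hm, hz⟩
  have hintQ : IsIntegral ℚ z := hint.tower_top
  have hfd : FiniteDimensional ℚ (IntermediateField.adjoin ℚ {z}) :=
    IntermediateField.adjoin.finiteDimensional hintQ
  have hnf : NumberField (IntermediateField.adjoin ℚ {z}) := ⟨⟩
  let pb := IntermediateField.adjoin.powerBasis hintQ
  have hgen : ((pb.gen : IntermediateField.adjoin ℚ {z}) : ℂ) = z :=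
    IntermediateField.AdjoinSimple.coe_gen ℚ z
  have hmin : minpoly ℚ pb.gen = h.map (Int.castRingHom ℚ) := by
    rw [← minpoly_eq_map hm hirr hz]
    exact IntermediateField.minpoly_gen ℚ z
  have hgint : IsIntegral ℤ pb.gen :=
    (isIntegral_algebraMap_iff (algebraMap (IntermediateField.adjoin ℚ {z}) ℂ).injective).1
      (by rw [← hgen] at hint; exact hint)
  let θ : 𝓞 (IntermediateField.adjoin ℚ {z}) := ⟨pb.gen, hgint⟩
  have hθ0 : aeval θ h = 0 := aeval_ringOfIntegers_eq_zero (by rw [← hz]; congr 1)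
  exact sum_card_rootResidues_le_of_powerBasis pb (θ := θ) rfl hmin hm hd hB1
    (norm_algHom_le hθ0 hroot) hn

theorem exists_algHom_injective_eval {L : Type*} [Field L] [NumberField L] {x y : L}
    (hext : ∀ φ ψ : L →ₐ[ℚ] ℂ, φ x = ψ x → φ y = ψ y → φ = ψ) :
    ∃ c ≤ Module.finrank ℚ L, IntermediateField.adjoin ℚ {x + (c : L) * y} = ⊤ := by
  classical
  by_contra! hcon
  have φ : L →ₐ[ℚ] ℂ := IsAlgClosed.lift
  have h1 : ∀ c : ℕ, ∃ ψ : L →ₐ[ℚ] ℂ, c ≤ Module.finrank ℚ L →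
      φ (x + (c : L) * y) = ψ (x + (c : L) * y) ∧ φ ≠ ψ := by
    intro c
    by_cases hc : c ≤ Module.finrank ℚ L
    · have := hcon c hc
      rw [Ne, Field.primitive_element_iff_algHom_eq_of_eval ℚ ℂ (fun _ => IsAlgClosed.splits _) _ φ]
        at this
      push Not at this
      obtain ⟨ψ, h1, h2⟩ := this
      exact ⟨ψ, fun _ => ⟨h1, h2⟩⟩
    · exact ⟨φ, fun h => (hc h).elim⟩
  choose ψ hψ using h1
  obtain ⟨c, hc, c', hc', hne, heq⟩ := Finset.exists_ne_map_eq_of_card_lt_of_maps_to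
    (s := Finset.range (Module.finrank ℚ L + 1)) (t := (Finset.univ : Finset (L →ₐ[ℚ] ℂ)))
    (by rw [Finset.card_univ, AlgHom.card, Finset.card_range]; exact Nat.lt_succ_self _)
    (f := ψ) (fun _ _ => Finset.mem_coe.2 (Finset.mem_univ _))
  obtain ⟨e1, n1⟩ := hψ c (Nat.lt_succ_iff.1 (Finset.mem_range.1 hc))
  obtain ⟨e2, -⟩ := hψ c' (Nat.lt_succ_iff.1 (Finset.mem_range.1 hc'))
  rw [← heq] at e2
  simp only [map_add, map_mul, map_natCast] at e1 e2
  have h3 : ((c : ℂ) - c') * (φ y - ψ c y) = 0 := by linear_combination e1 - e2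
  have h4 : φ y = ψ c y := by
    rcases mul_eq_zero.1 h3 with h | h
    · exact (hne (by exact_mod_cast sub_eq_zero.1 h)).elim
    · exact sub_eq_zero.1 h
  exact n1 (hext _ _ (by rw [h4] at e1; exact add_right_cancel e1) h4)

/-- Landau's prime ideal theorem for the field generated by two roots of `h`, in a weak effective
form, expressed through the roots of `h` modulo primes. -/
theorem exists_log_le_sum (hm : h.Monic) (hirr : Irreducible h) (hd : h.natDegree = d)
    (hd2 : 2 ≤ d) (hB1 : 1 ≤ B) (hroot : ∀ z : ℂ, aeval z h = 0 → ‖z‖ ≤ B) :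
    ∃ m D : ℕ, m ≠ 0 ∧ m ≤ d * d ∧ D ≠ 0 ∧
      D ≤ m.factorial * (m * ((1 + m) * B) ^ (2 * m)) ^ m ∧
      ∀ a n G W C : ℕ, a ≠ 0 → n ≠ 0 → G = (2 * ((1 + m) * B)) ^ m →
      W = D ^ m * (1 + 2 * (m * (1 + G) ^ m * (3 * m * G ^ m))) ^ m →
      C = (3 * m * G ^ m * (4 * m * (m * (1 + G) ^ m) * a)) ^ m →
      Real.log n ≤ (1 + 1 / a) *
        (d * ∑ q ∈ Nat.primesLE n with rootResidues h q ≠ ∅,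
          (((rootResidues h q).card : ℝ) - 1) * (Real.log q / q) +
          m * (Real.log D + m * Real.log (2 * B))) + m * W * (Real.log 4 * C + 12) := by
  classical
  have hsep : (h.map (Int.castRingHom ℂ)).roots.toFinset.card = d := by
    have h1 : (h.map (Int.castRingHom ℚ)).Separable :=
      ((hm.irreducible_iff_irreducible_map_fraction_map (K := ℚ)).1 hirr).separable
    have h2 : ((h.map (Int.castRingHom ℚ)).map (algebraMap ℚ ℂ)).roots.toFinset.card = d := by
      rw [Multiset.toFinset_card_of_nodup (nodup_roots h1.map),
        IsAlgClosed.card_roots_eq_natDegree, (hm.map _).natDegree_map, hm.natDegree_map, hd]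
    rwa [Polynomial.map_map, RingHom.ext_int ((algebraMap ℚ ℂ).comp (Int.castRingHom ℚ))
      (Int.castRingHom ℂ)] at h2
  obtain ⟨z₁, hz₁, z₂, hz₂, hz⟩ := Finset.one_lt_card.1 (hsep ▸ hd2 : 1 < _)
  have hroot' : ∀ z ∈ (h.map (Int.castRingHom ℂ)).roots.toFinset, aeval z h = 0 := fun z hz => by
    have := (mem_roots'.1 (Multiset.mem_toFinset.1 hz)).2
    rwa [IsRoot, eval_map] at this
  replace hz₁ := hroot' z₁ hz₁
  replace hz₂ := hroot' z₂ hz₂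
  have hint₁ : IsIntegral ℤ z₁ := ⟨h, hm, hz₁⟩
  have hint₂ : IsIntegral ℤ z₂ := ⟨h, hm, hz₂⟩
  have hfd₁ : FiniteDimensional ℚ (IntermediateField.adjoin ℚ {z₁}) :=
    IntermediateField.adjoin.finiteDimensional hint₁.tower_top
  have hfd₂ : FiniteDimensional ℚ (IntermediateField.adjoin ℚ {z₂}) :=
    IntermediateField.adjoin.finiteDimensional hint₂.tower_top
  have hsup : IntermediateField.adjoin ℚ {z₁, z₂} =
      IntermediateField.adjoin ℚ {z₁} ⊔ IntermediateField.adjoin ℚ {z₂} := by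
    rw [← IntermediateField.adjoin_union, Set.singleton_union]
  have hdeg : ∀ z : ℂ, aeval z h = 0 →
      Module.finrank ℚ (IntermediateField.adjoin ℚ {z}) = d := fun z hz => by
    have hint : IsIntegral ℤ z := ⟨h, hm, hz⟩
    rw [IntermediateField.adjoin.finrank hint.tower_top, minpoly_eq_map hm hirr hz,
      hm.natDegree_map, hd]
  obtain ⟨L, hL⟩ : ∃ L, L = IntermediateField.adjoin ℚ {z₁, z₂} := ⟨_, rfl⟩
  have hfd : FiniteDimensional ℚ L := by
    rw [hL, hsup]; infer_instance
  have hfin : Module.finrank ℚ L ≤ d * d := by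
    have := IntermediateField.finrank_sup_le (IntermediateField.adjoin ℚ {z₁})
      (IntermediateField.adjoin ℚ {z₂})
    rwa [hdeg z₁ hz₁, hdeg z₂ hz₂, ← hsup, ← hL] at this
  have hnf : NumberField L := ⟨⟩
  have hmem₁ : z₁ ∈ L := hL ▸ IntermediateField.subset_adjoin _ _ (by simp)
  have hmem₂ : z₂ ∈ L := hL ▸ IntermediateField.subset_adjoin _ _ (by simp)
  have hinj := (algebraMap L ℂ).injective
  let β₁ : 𝓞 L := ⟨⟨z₁, hmem₁⟩, (isIntegral_algebraMap_iff hinj).1 hint₁⟩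
  let β₂ : 𝓞 L := ⟨⟨z₂, hmem₂⟩, (isIntegral_algebraMap_iff hinj).1 hint₂⟩
  have hβ₁ : aeval β₁ h = 0 := aeval_ringOfIntegers_eq_zero hz₁
  have hβ₂ : aeval β₂ h = 0 := aeval_ringOfIntegers_eq_zero hz₂
  have hne : β₁ ≠ β₂ := fun he => hz (by
    have := congrArg (fun x : 𝓞 L => ((x : L) : ℂ)) he
    exact this)
  obtain ⟨c, hc, hgen⟩ := exists_algHom_injective_eval (L := L) (x := β₁) (y := β₂) (by
    intro φ ψ h1 h2
    subst hL
    refine IntermediateField.algHom_ext_of_eq_adjoin _ rfl ?_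
    rintro x (rfl | rfl)
    · exact h1
    · exact h2)
  obtain ⟨m, hmL⟩ : ∃ m, m = Module.finrank ℚ L := ⟨_, rfl⟩
  rw [← hmL] at hc hfin
  have hm0 : m ≠ 0 := hmL ▸ Module.finrank_pos.ne'
  have hσ₁ := norm_algHom_le hβ₁ hroot
  have hσ₂ := norm_algHom_le hβ₂ hroot
  have hσ : ∀ σ : L →ₐ[ℚ] ℂ, ‖σ ((β₁ + (c : 𝓞 L) * β₂ : 𝓞 L) : L)‖ ≤ ((1 + m) * B : ℕ) := by
    intro σ
    have h1 : σ ((β₁ + (c : 𝓞 L) * β₂ : 𝓞 L) : L) = σ β₁ + c * σ β₂ := by simp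
    rw [h1]
    refine (norm_add_le _ _).trans ?_
    rw [norm_mul, Complex.norm_natCast]
    have h2 : (c : ℝ) * ‖σ β₂‖ ≤ m * B :=
      mul_le_mul (by exact_mod_cast hc) (hσ₂ σ) (norm_nonneg _) (Nat.cast_nonneg _)
    push_cast
    linarith [hσ₁ σ]
  obtain ⟨D, hbg, hD⟩ := exists_isBoundedGenerator (α := β₁ + (c : 𝓞 L) * β₂)
    (by simpa using hgen) hmL.symm (Nat.mul_pos (by omega) hB1) hσ
  refine ⟨m, D, hm0, hfin, hbg.index_ne_zero, hD, ?_⟩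
  intro a n G W C ha hn hG hW hC
  subst hG
  have hfinite : {Q : Ideal (𝓞 L) | Ideal.absNorm Q ≤ n}.Finite :=
    Ideal.finite_setOfPred_absNorm_le n
  let T : Finset (Ideal (𝓞 L)) := {Q ∈ hfinite.toFinset | (Ideal.absNorm Q).Prime}
  have hT : ∀ Q : Ideal (𝓞 L), Q ∈ T ↔ Ideal.absNorm Q ≤ n ∧ (Ideal.absNorm Q).Prime := by
    intro Q; simp [T]
  have h1 := hbg.log_le_sum ha hn hW hC T fun Q h1 h2 => (hT Q).2 ⟨h2, h1⟩
  have h2 := hbg.sum_log_div_absNorm_le hm hβ₁ hβ₂ hne (n := n) T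
    fun Q hQ => ⟨((hT Q).1 hQ).2, ((hT Q).1 hQ).1⟩
  have h3 : Real.log (Ideal.absNorm (Ideal.span {β₁ - β₂})) ≤ m * Real.log (2 * B) := by
    rw [← Real.log_pow, hmL]
    refine Real.log_le_log ?_ (absNorm_span_le_pow fun σ => ?_)
    · exact_mod_cast absNorm_pos (span_singleton_ne_bot (sub_ne_zero.2 hne))
    · have : σ ((β₁ - β₂ : 𝓞 L) : L) = σ β₁ - σ β₂ := by simp
      rw [this]
      refine (norm_sub_le _ _).trans ?_
      linarith [hσ₁ σ, hσ₂ σ]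
  rw [hd] at h2
  refine h1.trans (add_le_add ?_ le_rfl)
  refine mul_le_mul_of_nonneg_left (h2.trans ?_) (by positivity)
  gcongr

end Fields

section Combine

open Polynomial

/-- An upper bound for `n` when the primes up to `n` which do not divide any value of `h`
contribute little to `n!`. -/
theorem exists_log_le {h : ℤ[X]} {d B n p : ℕ} {V Y : ℝ} (hm : h.Monic) (hirr : Irreducible h)
    (hd : h.natDegree = d) (hd2 : 2 ≤ d) (hB1 : 1 ≤ B)
    (hroot : ∀ z : ℂ, aeval z h = 0 → ‖z‖ ≤ B) (hn : n ≠ 0) (hp : p ≠ 0)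
    (hV : ∑ q ∈ Nat.primesLE n with rootResidues h q = ∅,
      (n.factorial.factorization q : ℝ) * Real.log q ≤ V * n)
    (hdV : d * V ≤ (1 - 1 / p) * Real.log n + Y) (hY : 0 ≤ Y) :
    ∃ m D : ℕ, m ≠ 0 ∧ m ≤ d * d ∧ D ≠ 0 ∧
      D ≤ m.factorial * (m * ((1 + m) * B) ^ (2 * m)) ^ m ∧
      ∀ G W C : ℕ, G = (2 * ((1 + m) * B)) ^ m →
      W = D ^ m * (1 + 2 * (m * (1 + G) ^ m * (3 * m * G ^ m))) ^ m →
      C = (3 * m * G ^ m * (4 * m * (m * (1 + G) ^ m) * (2 * p))) ^ m →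
      Real.log n ≤ 2 * p * (2 * (d * (d * (Real.log (2 * d * B ^ d) + Real.log 4) + 9) + Y +
        m * (Real.log D + m * Real.log (2 * B))) + m * W * (Real.log 4 * C + 12)) := by
  classical
  obtain ⟨m, D, hm0, hmd, hD0, hD, hmain⟩ := exists_log_le_sum hm hirr hd hd2 hB1 hroot
  refine ⟨m, D, hm0, hmd, hD0, hD, fun G W C hG hW hC => ?_⟩
  have h1 := hmain (2 * p) n G W C (by omega) hn hG hW hC
  have h2 := sum_card_rootResidues_le_log hm hirr hd hB1 hroot hn
  have h3 := log_sub_le_sum_log_div (n := n) (Nat.one_le_iff_ne_zero.2 hn)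
    (Finset.filter_subset (fun q => rootResidues h q = ∅) (Nat.primesLE n)) hV
  have h4 : ∑ q ∈ Nat.primesLE n with rootResidues h q ≠ ∅,
      (((rootResidues h q).card : ℝ) - 1) * (Real.log q / q) =
      ∑ q ∈ Nat.primesLE n, ((rootResidues h q).card : ℝ) * (Real.log q / q) -
      ∑ q ∈ Nat.primesLE n \ {q ∈ Nat.primesLE n | rootResidues h q = ∅}, Real.log q / q := by
    rw [← Finset.filter_not]
    have : ∑ q ∈ Nat.primesLE n, ((rootResidues h q).card : ℝ) * (Real.log q / q) =
        ∑ q ∈ Nat.primesLE n with rootResidues h q ≠ ∅,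
          ((rootResidues h q).card : ℝ) * (Real.log q / q) := by
      rw [Finset.sum_filter]
      refine Finset.sum_congr rfl fun q _ => ?_
      split_ifs with hq
      · rfl
      · rw [not_not.1 hq]; simp
    rw [this, ← Finset.sum_sub_distrib]
    exact Finset.sum_congr rfl fun q _ => by ring
  rw [h4] at h1
  set U := Real.log (2 * d * B ^ d) + Real.log 4 with hU
  set F := (m : ℝ) * W * (Real.log 4 * C + 12) with hF
  set Z := (m : ℝ) * (Real.log D + m * Real.log (2 * B)) with hZ
  set E := d * (d * U + 9) + Y + Z with hE
  have hB' : (1 : ℝ) ≤ B := by exact_mod_cast hB1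
  have hd' : (2 : ℝ) ≤ d := by exact_mod_cast hd2
  have hlog4 : 0 ≤ Real.log 4 := Real.log_nonneg (by norm_num)
  have hU0 : 0 ≤ U := by
    refine add_nonneg (Real.log_nonneg ?_) hlog4
    have := one_le_pow₀ hB' (n := d)
    nlinarith
  have hZ0 : 0 ≤ Z := by
    have := Real.log_natCast_nonneg D
    have : 0 ≤ Real.log (2 * B) := Real.log_nonneg (by linarith)
    positivity
  have hE0 : 0 ≤ E := by positivity
  have hp1 : (1 : ℝ) ≤ p := by exact_mod_cast Nat.one_le_iff_ne_zero.2 hp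
  have hlogn := Real.log_natCast_nonneg n
  have h5 : d * (∑ q ∈ Nat.primesLE n, ((rootResidues h q).card : ℝ) * (Real.log q / q) -
      ∑ q ∈ Nat.primesLE n \ {q ∈ Nat.primesLE n | rootResidues h q = ∅}, Real.log q / q) + Z ≤
      (1 - 1 / p) * Real.log n + E := by
    have := mul_le_mul_of_nonneg_left (sub_le_sub h2 h3) (Nat.cast_nonneg (α := ℝ) d)
    calc _ ≤ d * (Real.log n + d * U - (Real.log n - 9 - V)) + Z := by linarith
      _ = d * V + d * (d * U + 9) + Z := by ring
      _ ≤ _ := by linarith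
  have h6 : Real.log n ≤ (1 + 1 / ((2 * p : ℕ) : ℝ)) * ((1 - 1 / p) * Real.log n + E) + F :=
    h1.trans (add_le_add_left (mul_le_mul_of_nonneg_left h5 (by positivity)) _)
  push_cast at h6
  have h7 : (1 + 1 / (2 * (p : ℝ))) * (1 - 1 / p) ≤ 1 - 1 / (2 * p) := by
    have : (1 + 1 / (2 * (p : ℝ))) * (1 - 1 / p) = 1 - 1 / (2 * p) - 1 / (2 * p ^ 2) := by
      field_simp
      ring
    rw [this]
    have : (0 : ℝ) ≤ 1 / (2 * p ^ 2) := by positivity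
    linarith
  have h8 : (1 + 1 / (2 * (p : ℝ))) * E ≤ 2 * E := by
    refine mul_le_mul_of_nonneg_right ?_ hE0
    have : 1 / (2 * (p : ℝ)) ≤ 1 := by rw [div_le_one (by positivity)]; linarith
    linarith
  have h9 := mul_le_mul_of_nonneg_right h7 hlogn
  have h10 : 1 / (2 * (p : ℝ)) * Real.log n ≤ 2 * E + F := by linarith
  rw [div_mul_eq_mul_div, one_mul, div_le_iff₀ (by positivity)] at h10
  linarith

end Combine

section Repunit

open Polynomial

theorem norm_le_of_aeval_shiftedRepunit {p A : ℕ} (hp : 2 ≤ p) {z : ℂ}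
    (hz : aeval z (shiftedRepunit p A) = 0) : ‖z‖ ≤ A + 1 := by
  by_contra! hlt
  have h1 : ∑ i ∈ range p, z ^ i = A := by
    have h : aeval z (shiftedRepunit p A) = ∑ i ∈ range p, z ^ i - A := by
      simp [shiftedRepunit]
    rw [h] at hz
    exact sub_eq_zero.1 hz
  have h2 : z ^ p = 1 + A * (z - 1) := by
    rw [← h1, geom_sum_mul]; ring
  have h3 : ‖z‖ ^ p ≤ 1 + A * (‖z‖ + 1) := by
    rw [← norm_pow, h2]
    refine (norm_add_le _ _).trans ?_
    rw [norm_one, norm_mul, Complex.norm_natCast]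
    gcongr
    exact (norm_sub_le _ _).trans (by simp)
  have hA : (0 : ℝ) ≤ A := Nat.cast_nonneg A
  have h4 : ‖z‖ ^ 2 ≤ ‖z‖ ^ p := pow_le_pow_right₀ (by linarith) hp
  nlinarith

theorem rootResidues_ne_empty {h : ℤ[X]} {q : ℕ} (hq : q.Prime) {b : ℤ} (hb : (q : ℤ) ∣ h.eval b) :
    rootResidues h q ≠ ∅ := by
  have hq0 : (q : ℤ) ≠ 0 := by exact_mod_cast hq.ne_zero
  refine Finset.ne_empty_of_mem (a := (b % q).toNat) (Finset.mem_filter.2 ⟨?_, ?_⟩)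
  · rw [Finset.mem_range]
    have h1 := Int.emod_lt_of_pos b (by exact_mod_cast hq.pos : (0 : ℤ) < q)
    have h2 := Int.emod_nonneg b hq0
    omega
  · rw [Int.toNat_of_nonneg (Int.emod_nonneg b hq0)]
    have h1 : (q : ℤ) ∣ b - b % q := Int.dvd_self_sub_emod
    exact (dvd_sub_right (hb)).1 (h1.trans (sub_dvd_eval_sub b (b % q) h))

/-- Primes up to `n` at which `h` has no root divide `n!` only through the linear factor. -/
theorem sum_factorization_le_log {h : ℤ[X]} {n : ℕ} {b c : ℤ}
    (hb : (n.factorial : ℤ) = c * h.eval b) :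
    ∑ q ∈ Nat.primesLE n with rootResidues h q = ∅,
      (n.factorial.factorization q : ℝ) * Real.log q ≤ Real.log c.natAbs := by
  have hprod : c.natAbs * (h.eval b).natAbs = n.factorial := by
    rw [← Int.natAbs_mul, ← hb, Int.natAbs_natCast]
  have hc0 : c.natAbs ≠ 0 := fun h0 => n.factorial_ne_zero (by rw [← hprod, h0, zero_mul])
  have hh0 : (h.eval b).natAbs ≠ 0 := fun h0 => n.factorial_ne_zero (by rw [← hprod, h0, mul_zero])
  have hfac : ∀ q ∈ ({q ∈ Nat.primesLE n | rootResidues h q = ∅} : Finset ℕ),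
      n.factorial.factorization q = c.natAbs.factorization q := fun q hq => by
    obtain ⟨hq1, hq2⟩ := Finset.mem_filter.1 hq
    rw [← hprod, Nat.factorization_mul hc0 hh0, Finsupp.add_apply,
      Nat.factorization_eq_zero_of_not_dvd (n := (h.eval b).natAbs), add_zero]
    exact fun hdvd => rootResidues_ne_empty (Nat.mem_primesLE.1 hq1).2
      (Int.natCast_dvd.2 hdvd) hq2
  rw [Finset.sum_congr rfl fun q hq => by rw [hfac q hq]]
  set S := {q ∈ Nat.primesLE n | rootResidues h q = ∅}
  rw [Real.log_nat_eq_sum_factorization, Finsupp.sum, Nat.support_factorization]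
  calc _ ≤ ∑ q ∈ c.natAbs.primeFactors ∪ S, (c.natAbs.factorization q : ℝ) * Real.log q :=
        Finset.sum_le_sum_of_subset_of_nonneg Finset.subset_union_right fun q _ _ =>
          mul_nonneg (Nat.cast_nonneg _) (Real.log_natCast_nonneg q)
    _ ≤ _ := by
        refine (Finset.sum_subset Finset.subset_union_left fun q _ hq => ?_).ge
        rw [← Nat.support_factorization, Finsupp.notMem_support_iff] at hq
        rw [hq, Nat.cast_zero, zero_mul]

theorem log_natAbs_sub_le {n p A : ℕ} {b r : ℤ} (hn : n ≠ 0) (hp : 2 ≤ p) (hb : 2 ≤ b)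
    (hr : |r| ≤ A + 1) (hbr : b - r ≠ 0)
    (heq : ((n.factorial : ℕ) : ℤ) + A = ∑ i ∈ range p, b ^ i) :
    Real.log (b - r).natAbs ≤ (Real.log n / (p - 1 : ℝ) + 2 * Real.log (A + 2)) * n := by
  have hp1 : (1 : ℝ) ≤ (p : ℝ) - 1 := by
    have : (2 : ℝ) ≤ p := by exact_mod_cast hp
    linarith
  have hbR : (2 : ℝ) ≤ b := by exact_mod_cast hb
  have hA : (0 : ℝ) ≤ A := Nat.cast_nonneg A
  have hrR : |(r : ℝ)| ≤ A + 1 := by exact_mod_cast hr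
  have hn1 : (1 : ℝ) ≤ n := by exact_mod_cast Nat.one_le_iff_ne_zero.2 hn
  have hfac1 : (1 : ℝ) ≤ n.factorial := by exact_mod_cast n.factorial_pos
  have h1 : Real.log (b - r).natAbs ≤ Real.log b + Real.log (A + 2) := by
    rw [← Real.log_mul (by linarith) (by linarith)]
    refine Real.log_le_log (by exact_mod_cast Int.natAbs_pos.2 hbr) ?_
    rw [Nat.cast_natAbs]
    push_cast
    calc |(b : ℝ) - r| ≤ |(b : ℝ)| + |(r : ℝ)| := abs_sub _ _
      _ ≤ b + (A + 1) := by rw [abs_of_nonneg (by linarith : (0 : ℝ) ≤ b)]; linarith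
      _ ≤ _ := by nlinarith
  have h2 : (b : ℝ) ^ (p - 1) ≤ n.factorial * (A + 2) := by
    have h3 : (b : ℝ) ^ (p - 1) ≤ ∑ i ∈ range p, (b : ℝ) ^ i :=
      Finset.single_le_sum (f := fun i => (b : ℝ) ^ i) (fun i _ => by positivity)
        (Finset.mem_range.2 (by omega))
    have h4 : ((n.factorial : ℕ) : ℝ) + A = ∑ i ∈ range p, (b : ℝ) ^ i := by exact_mod_cast heq
    nlinarith
  have h5 : (p - 1 : ℝ) * Real.log b ≤ n * Real.log n + Real.log (A + 2) := by
    have h6 := Real.log_le_log (by positivity) h2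
    rw [Real.log_pow, Real.log_mul (by linarith) (by linarith), Nat.cast_sub (by omega)] at h6
    push_cast at h6
    have h7 : Real.log n.factorial ≤ n * Real.log n := by
      rw [← Real.log_pow]
      exact Real.log_le_log (by linarith) (by exact_mod_cast Nat.factorial_le_pow n)
    linarith
  have hlogA : 0 ≤ Real.log (A + 2) := Real.log_nonneg (by linarith)
  have h8 : Real.log b ≤ (n * Real.log n + Real.log (A + 2)) / (p - 1) := by
    rw [le_div_iff₀ (by linarith)]; linarith
  have h9 : Real.log (A + 2) / (p - 1 : ℝ) ≤ Real.log (A + 2) := div_le_self hlogA hp1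
  rw [add_div, mul_div_assoc] at h8
  nlinarith

end Repunit

section Tower

theorem mul_le_tower {A j k l x y : ℕ} (hA : 2 ≤ A) (hx : x ≤ A ^ A ^ j) (hy : y ≤ A ^ A ^ k)
    (hj : j < l) (hk : k < l) : x * y ≤ A ^ A ^ l := by
  obtain ⟨l, rfl⟩ : ∃ i, l = i + 1 := ⟨l - 1, by omega⟩
  refine (Nat.mul_le_mul hx hy).trans ?_
  rw [← pow_add]
  refine Nat.pow_le_pow_right (by omega) ?_
  have h1 : A ^ j ≤ A ^ l := Nat.pow_le_pow_right (by omega) (by omega)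
  have h2 : A ^ k ≤ A ^ l := Nat.pow_le_pow_right (by omega) (by omega)
  rw [pow_succ]
  linarith [Nat.mul_le_mul_left (A ^ l) hA]

theorem add_le_tower {A j k l x y : ℕ} (hA : 2 ≤ A) (hx : x ≤ A ^ A ^ j) (hy : y ≤ A ^ A ^ k)
    (hj : j < l) (hk : k < l) : x + y ≤ A ^ A ^ l := by
  have h (i : ℕ) : 2 ≤ A ^ A ^ i :=
    hA.trans (Nat.le_self_pow (pow_ne_zero i (by omega)) A)
  exact (add_le_add hx hy).trans
    ((Nat.add_le_mul (h j) (h k)).trans (mul_le_tower hA le_rfl le_rfl hj hk))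

theorem pow_le_tower {A j k l m x : ℕ} (hA : 2 ≤ A) (hx : x ≤ A ^ A ^ j) (hm : m ≤ A ^ k)
    (hl : j + k ≤ l) : x ^ m ≤ A ^ A ^ l := by
  refine (Nat.pow_le_pow_left hx m).trans ?_
  rw [← pow_mul]
  refine Nat.pow_le_pow_right (by omega) ?_
  calc A ^ j * m ≤ A ^ j * A ^ k := Nat.mul_le_mul_left _ hm
    _ = A ^ (j + k) := (pow_add _ _ _).symm
    _ ≤ A ^ l := Nat.pow_le_pow_right (by omega) hl

theorem le_tower {A k x : ℕ} (hA : 2 ≤ A) (hk : k ≤ A) (hx : x ≤ A ^ k) : x ≤ A ^ A ^ 1 := by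
  rw [pow_one]
  exact hx.trans (Nat.pow_le_pow_right (by omega) hk)

/-- The quantity bounding `log n` is at most `A ^ A ^ 19`. -/
theorem bound_le_tower {A p d m D G W C : ℕ} (hA : 7 ≤ A) (hp : p ≤ A) (hd : d ≤ A)
    (hm : m ≤ d * d) (hD : D ≤ m.factorial * (m * ((1 + m) * (A + 1)) ^ (2 * m)) ^ m)
    (hG : G = (2 * ((1 + m) * (A + 1))) ^ m)
    (hW : W = D ^ m * (1 + 2 * (m * (1 + G) ^ m * (3 * m * G ^ m))) ^ m)
    (hC : C = (3 * m * G ^ m * (4 * m * (m * (1 + G) ^ m) * (2 * p))) ^ m) :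
    2 * p * (2 * (d * (d * (2 * d * (A + 1) ^ d + 2) + 9) + 2 * A * (A + 2) +
      m * (D + m * (2 * (A + 1)))) + m * W * (2 * C + 12)) ≤ A ^ A ^ 19 := by
  have hA2 : 2 ≤ A := by omega
  have small {x : ℕ} (hx : x ≤ A ^ 3) : x ≤ A ^ A ^ 1 := le_tower hA2 (by omega) hx
  have hmA : m ≤ A ^ 2 := hm.trans (by rw [pow_two]; exact Nat.mul_le_mul hd hd)
  have hcube : 7 * A ^ 2 ≤ A ^ 3 := by rw [pow_succ A 2, mul_comm]; exact Nat.mul_le_mul_left _ hA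
  have hsq : 7 * A ≤ A ^ 2 := by rw [pow_two]; exact Nat.mul_le_mul_right _ hA
  have cst {x : ℕ} (hx : x ≤ 49) : x ≤ A ^ A ^ 1 := small (by omega)
  have tm : m ≤ A ^ A ^ 1 := small (by omega)
  have tm1 : 1 + m ≤ A ^ A ^ 1 := small (by omega)
  have tB : A + 1 ≤ A ^ A ^ 1 := small (by omega)
  have tp : p ≤ A ^ A ^ 1 := small (by omega)
  have td : d ≤ A ^ A ^ 1 := small (by omega)
  have tA : A ≤ A ^ A ^ 1 := small (by omega)
  have tA2 : A + 2 ≤ A ^ A ^ 1 := small (by omega)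
  have tmB : (1 + m) * (A + 1) ≤ A ^ A ^ 2 := mul_le_tower hA2 tm1 tB (by simp) (by simp)
  have tD : D ≤ A ^ A ^ 9 := by
    refine hD.trans (mul_le_tower hA2 (j := 3) (k := 8) ?_ ?_ (by simp) (by simp))
    · exact (Nat.factorial_le_pow m).trans (pow_le_tower hA2 tm hmA (by simp))
    · refine pow_le_tower hA2 (j := 6) ?_ hmA (by simp)
      refine mul_le_tower hA2 tm (k := 5) ?_ (by simp) (by simp)
      exact pow_le_tower hA2 tmB (k := 3) (by omega) (by simp)
  have tG : G ≤ A ^ A ^ 5 := hG.trans_le <| pow_le_tower hA2 (j := 3)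
    (mul_le_tower hA2 (cst (by simp)) tmB (by simp) (by simp)) hmA (by simp)
  have tG1 : m * (1 + G) ^ m ≤ A ^ A ^ 9 := by
    refine mul_le_tower hA2 tm (k := 8) ?_ (by simp) (by simp)
    exact pow_le_tower hA2 (j := 6) (add_le_tower hA2 (cst (by simp)) tG (by simp) (by simp)) hmA
      (by simp)
  have t3G : 3 * m * G ^ m ≤ A ^ A ^ 8 := mul_le_tower hA2 (j := 2) (k := 7)
    (mul_le_tower hA2 (cst (by simp)) tm (by simp) (by simp)) (pow_le_tower hA2 tG hmA (by simp))
    (by simp) (by simp)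
  have tW : W ≤ A ^ A ^ 15 := by
    refine hW.trans_le (mul_le_tower hA2 (j := 11) (k := 14) (pow_le_tower hA2 tD hmA (by simp)) ?_
      (by simp) (by simp))
    refine pow_le_tower hA2 (j := 12) ?_ hmA (by simp)
    refine add_le_tower hA2 (cst (by simp)) (k := 11) ?_ (by simp) (by simp)
    exact mul_le_tower hA2 (cst (by simp)) (k := 10)
      (mul_le_tower hA2 tG1 t3G (by simp) (by simp)) (by simp) (by simp)
  have t2p : 2 * p ≤ A ^ A ^ 2 := mul_le_tower hA2 (cst (by simp)) tp (by simp) (by simp)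
  have tC : C ≤ A ^ A ^ 14 := by
    refine hC.trans_le (pow_le_tower hA2 (j := 12) ?_ hmA (by simp))
    refine mul_le_tower hA2 t3G (k := 11) ?_ (by simp) (by simp)
    refine mul_le_tower hA2 (j := 10) ?_ t2p (by simp) (by simp)
    exact mul_le_tower hA2 (j := 2) (mul_le_tower hA2 (cst (by simp)) tm (by simp) (by simp)) tG1
      (by simp) (by simp)
  refine mul_le_tower hA2 t2p (k := 18) ?_ (by simp) (by simp)
  refine add_le_tower hA2 (j := 13) (k := 17) ?_ ?_ (by simp) (by simp)
  · refine mul_le_tower hA2 (cst (by simp)) (k := 12) ?_ (by simp) (by simp)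
    refine add_le_tower hA2 (j := 8) (k := 11) (add_le_tower hA2 (j := 7) (k := 3) ?_ ?_
      (by simp) (by simp)) ?_ (by simp) (by simp)
    · refine mul_le_tower hA2 td (k := 6) ?_ (by simp) (by simp)
      refine add_le_tower hA2 (j := 5) ?_ (cst (by simp)) (by simp) (by simp)
      refine mul_le_tower hA2 td (k := 4) ?_ (by simp) (by simp)
      refine add_le_tower hA2 (j := 3) ?_ (cst (by simp)) (by simp) (by simp)
      exact mul_le_tower hA2 (mul_le_tower hA2 (cst (by simp)) td (l := 2) (by simp) (by simp))
        (pow_le_tower hA2 tB (k := 1) (l := 2) (by simpa using hd) (by simp)) (by simp) (by simp)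
    · exact mul_le_tower hA2 (j := 2) (mul_le_tower hA2 (cst (by simp)) tA (by simp) (by simp)) tA2
        (by simp) (by simp)
    · refine mul_le_tower hA2 tm (k := 10) ?_ (by simp) (by simp)
      refine add_le_tower hA2 tD (k := 3) ?_ (by simp) (by simp)
      exact mul_le_tower hA2 tm (k := 2) (mul_le_tower hA2 (cst (by simp)) tB (by simp) (by simp))
        (by simp) (by simp)
  · refine mul_le_tower hA2 (j := 16) (k := 16) (mul_le_tower hA2 tm tW (by simp) (by simp)) ?_
      (by simp) (by simp)
    exact add_le_tower hA2 (j := 15)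
      (mul_le_tower hA2 (cst (by simp)) tC (by simp) (by simp)) (cst (by simp)) (by simp) (by simp)

end Tower

section Final

open Polynomial

/-- Any monic irreducible divisor `h` of the shifted repunit with `n! = c * h(b)` and `c` small
bounds `n`. -/
theorem log_le_tower {h : ℤ[X]} {n p A : ℕ} {b c : ℤ} {V Y : ℝ} (hp : 7 ≤ p) (hpA : p ≤ A)
    (hm : h.Monic) (hirr : Irreducible h) (hd2 : 2 ≤ h.natDegree) (hdp : h.natDegree ≤ p)
    (hdvd : h ∣ shiftedRepunit p A) (hn : n ≠ 0) (hb : (n.factorial : ℤ) = c * h.eval b)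
    (hc : Real.log c.natAbs ≤ V * n)
    (hV : h.natDegree * V ≤ (1 - 1 / p) * Real.log n + Y) (hY : 0 ≤ Y)
    (hYA : Y ≤ 2 * A * Real.log (A + 2)) :
    Real.log n ≤ ((A ^ A ^ 19 : ℕ) : ℝ) := by
  obtain ⟨m, D, hm0, hmd, hD0, hD, hmain⟩ := exists_log_le (B := A + 1) hm hirr rfl hd2 (by omega)
    (fun z hz => by
      obtain ⟨g, hg⟩ := hdvd
      push_cast
      exact norm_le_of_aeval_shiftedRepunit (p := p) (by omega) (by rw [hg, map_mul, hz, zero_mul]))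
    hn (by omega) ((sum_factorization_le_log hb).trans hc) hV hY
  refine (hmain _ _ _ rfl rfl rfl).trans (le_trans ?_ (Nat.cast_le.2
    (bound_le_tower (by omega) hpA (hdp.trans hpA) hmd hD rfl rfl rfl)))
  generalize (2 * ((1 + m) * (A + 1))) ^ m = G
  generalize D ^ m * (1 + 2 * (m * (1 + G) ^ m * (3 * m * G ^ m))) ^ m = W
  generalize (3 * m * G ^ m * (4 * m * (m * (1 + G) ^ m) * (2 * p))) ^ m = C
  have hlog4 : Real.log 4 ≤ 2 := by
    rw [show (4 : ℝ) = 2 ^ 2 by norm_num, Real.log_pow]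
    have := Real.log_two_lt_d9
    push_cast
    linarith
  have h1 : Real.log (2 * h.natDegree * ((A + 1 : ℕ) : ℝ) ^ h.natDegree) ≤
      2 * h.natDegree * ((A : ℝ) + 1) ^ h.natDegree := by
    push_cast
    exact Real.log_le_self (by positivity)
  have h2 : Real.log D ≤ D := Real.log_le_self (by positivity)
  have h3 : Real.log (2 * ((A + 1 : ℕ) : ℝ)) ≤ 2 * ((A : ℝ) + 1) := by
    push_cast
    exact Real.log_le_self (by positivity)
  have h4 : Y ≤ 2 * A * ((A : ℝ) + 2) :=
    hYA.trans (by gcongr; exact Real.log_le_self (by positivity))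
  push_cast at *
  gcongr

theorem log_le_tower_of_factorial_eq {n p A : ℕ} {b : ℤ} (hp : p.Prime) (hp7 : 7 ≤ p)
    (hA0 : A ≠ 0) (hpA : p ∣ A) (hn : n ≠ 0) (hb : 2 ≤ b)
    (heq : ((n.factorial : ℕ) : ℤ) + A = ∑ i ∈ range p, b ^ i) :
    Real.log n ≤ ((A ^ A ^ 19 : ℕ) : ℝ) := by
  have hle : p ≤ A := Nat.le_of_dvd (Nat.pos_of_ne_zero hA0) hpA
  have heval : (n.factorial : ℤ) = (shiftedRepunit p A).eval b := by
    rw [eval_shiftedRepunit]; linarith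
  have hlogn := Real.log_natCast_nonneg n
  have hlogA : 0 ≤ Real.log ((A : ℝ) + 2) :=
    Real.log_nonneg (by linarith [(Nat.cast_nonneg A : (0 : ℝ) ≤ A)])
  have hpR : (7 : ℝ) ≤ p := by exact_mod_cast hp7
  have hpinv : 1 / (p : ℝ) ≤ 1 := by rw [div_le_one (by linarith)]; linarith
  obtain ⟨h, hm, hirr, ⟨hd, hh⟩ | ⟨hd, r, hh⟩⟩ :=
    exists_irreducible_factor_shiftedRepunit hp hp7 (A := A) (by exact_mod_cast hpA)
  · refine log_le_tower (c := 1) (V := 0) (Y := 0) hp7 hle hm hirr (by omega) (by omega)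
      (by rw [hh]) hn (by rw [heval, hh, one_mul]) (by simp) ?_ le_rfl (by positivity)
    rw [mul_zero, add_zero]
    exact mul_nonneg (by linarith) hlogn
  · have hfac : (n.factorial : ℤ) = (b - r) * h.eval b := by rw [heval, hh]; simp
    have hbr : b - r ≠ 0 := fun h0 => by
      rw [h0, zero_mul] at hfac
      exact n.factorial_ne_zero (by exact_mod_cast hfac)
    have hr : |r| ≤ A + 1 := by
      have := norm_le_of_aeval_shiftedRepunit (p := p) (A := A) (z := (r : ℂ)) (by omega)
        (by rw [hh]; simp)
      rw [Complex.norm_intCast] at this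
      exact_mod_cast this
    refine log_le_tower (c := b - r) (Y := (h.natDegree : ℝ) * (2 * Real.log (A + 2))) hp7 hle hm
      hirr (by omega) (by omega) ⟨X - C r, by rw [hh, mul_comm]⟩ hn hfac
      (log_natAbs_sub_le hn (by omega) hb hr hbr heq) ?_ (by positivity) ?_
    · rw [mul_add, hd, Nat.cast_sub (by omega)]
      push_cast
      gcongr ?_ + _
      rw [mul_div_assoc', div_le_iff₀ (by linarith), mul_comm]
      have : (1 - 1 / (p : ℝ)) * (p - 1) = p - 2 + 1 / p := by field_simp; ring
      have h0 : (0 : ℝ) ≤ 1 / p := by positivity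
      nlinarith
    · have : (h.natDegree : ℝ) ≤ A := by exact_mod_cast (by omega : h.natDegree ≤ A)
      nlinarith

theorem log_log_log_le {n A : ℕ} (hA : 2 ≤ A) (h1 : 0 < Real.log n) (h2 : 0 < Real.log (Real.log n))
    (h : Real.log n ≤ ((A ^ A ^ 19 : ℕ) : ℝ)) :
    Real.log (Real.log (Real.log n)) ≤ 20 * Real.log A := by
  have hA0 : (0 : ℝ) < A := by positivity
  have h3 : Real.log (Real.log n) ≤ (A : ℝ) ^ 20 := by
    refine (Real.log_le_log h1 h).trans ?_
    push_cast
    rw [Real.log_pow, pow_succ _ 19]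
    push_cast
    gcongr
    exact Real.log_le_self hA0.le
  simpa using Real.log_le_log h2 h3

theorem eventually_log_log_log : ∀ᶠ n : ℕ in Filter.atTop,
    0 < Real.log n ∧ 0 < Real.log (Real.log n) ∧
      1 ≤ Real.log (Real.log (Real.log (Real.log n))) ∧
      20 * Real.log (Real.log (Real.log (Real.log n))) < Real.log (Real.log (Real.log n)) := by
  have t1 : Filter.Tendsto (fun n : ℕ => Real.log n) Filter.atTop Filter.atTop :=
    Real.tendsto_log_atTop.comp tendsto_natCast_atTop_atTop
  have t2 := Real.tendsto_log_atTop.comp t1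
  have t3 := Real.tendsto_log_atTop.comp t2
  have t4 := Real.tendsto_log_atTop.comp t3
  have h := (Real.isLittleO_log_id_atTop.bound (by norm_num : (0 : ℝ) < 1 / 40))
  filter_upwards [t1.eventually_gt_atTop 0, t2.eventually_gt_atTop 0, t3.eventually_gt_atTop 0,
    t4.eventually_ge_atTop 1, t3.eventually h] with n h1 h2 h3 h4 h5
  simp only [Function.comp_apply, Real.norm_eq_abs, id] at *
  refine ⟨h1, h2, h4, ?_⟩
  rw [abs_of_pos h3, abs_of_pos (by linarith)] at h5
  linarith

end Final

end RepunitFactorial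

end

/-- **Theorem 2 (iii).** There exists a positive integer `n₀` such that for all
integers `n ≥ n₀` and `b ≥ 2`, every prime `p ≥ 7`, and every negative integer
`a` divisible by `p`, if `n! = (b^p − 1)/(b − 1) + a`, then
`|a| ≥ 0.5·(log log log n)/(log log log log n)`. -/
theorem thm2_part3 :
    ∃ n₀ : ℕ, 0 < n₀ ∧ ∀ (n : ℕ) (b : ℤ) (p : ℕ) (a : ℤ),
      n₀ ≤ n → 2 ≤ b → Nat.Prime p → 7 ≤ p → a < 0 → (p : ℤ) ∣ a →
      (Nat.factorial n : ℤ) = (∑ i ∈ Finset.range p, b ^ i) + a →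
      0.5 * Real.log (Real.log (Real.log n)) /
          Real.log (Real.log (Real.log (Real.log n))) ≤ |(a : ℝ)| := by
  obtain ⟨n₁, hn₁⟩ := Filter.eventually_atTop.1 RepunitFactorial.eventually_log_log_log
  refine ⟨n₁ + 1, n₁.succ_pos, fun n b p a hn hb hp hp7 ha hpa heq => ?_⟩
  obtain ⟨h1, h2, h3, h4⟩ := hn₁ n (by omega)
  obtain ⟨A, rfl⟩ : ∃ A : ℕ, a = -A := ⟨a.natAbs, by omega⟩
  have hA0 : A ≠ 0 := by omega
  have hpA : p ∣ A := by simpa [Int.natCast_dvd_natCast] using hpa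
  have hA7 : 7 ≤ A := hp7.trans (Nat.le_of_dvd (Nat.pos_of_ne_zero hA0) hpA)
  have h5 := RepunitFactorial.log_log_log_le (by omega) h1 h2
    (RepunitFactorial.log_le_tower_of_factorial_eq (n := n) (b := b) hp hp7 hA0 hpA (by omega) hb
      (by rw [heq]; ring))
  set u := Real.log (Real.log (Real.log n))
  have hAR : (0 : ℝ) < A := by exact_mod_cast Nat.pos_of_ne_zero hA0
  rw [Int.cast_neg, Int.cast_natCast, abs_neg, abs_of_pos hAR]
  by_contra! hlt
  have h6 : (A : ℝ) ≤ u := by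
    refine hlt.le.trans ?_
    rw [div_le_iff₀ (by linarith)]
    nlinarith
  linarith [Real.log_le_log hAR h6]
end

section
/- Let b ≥ 2 and n ≥ 2 be integers, let p ≥ 7 be prime, and let a be an integer with 2 ≤ |a| ≤ n. If n! = (b^p − 1)/(b − 1) + a, then a is odd and every prime q dividing a with q ≠ p satisfies q ≡ 1 (mod p). -/
/-- A prime divisor `q ≠ p` of a repunit of prime length `p` satisfies `q ≡ 1 (mod p)`. -/
theorem modEq_one_of_dvd_repunit {b : ℤ} {p q : ℕ} (hp : p.Prime) (hq : q.Prime) (hqp : q ≠ p)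
    (h : (q : ℤ) ∣ ∑ i ∈ Finset.range p, b ^ i) : q ≡ 1 [MOD p] := by
  have := Fact.mk hp
  have := Fact.mk hq
  have hsum : ∑ i ∈ Finset.range p, (b : ZMod q) ^ i = 0 := by
    simpa using (ZMod.intCast_zmod_eq_zero_iff_dvd _ q).2 h
  have hpow : (b : ZMod q) ^ p = 1 := by
    have hgeom := geom_sum_mul (b : ZMod q) p
    rw [hsum, zero_mul] at hgeom
    exact sub_eq_zero.1 hgeom.symm
  have hne : (b : ZMod q) ≠ 1 := by
    intro h1
    have hp0 : (p : ZMod q) = 0 := by simpa [h1] using hsum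
    exact hqp ((Nat.prime_dvd_prime_iff_eq hq hp).1 ((ZMod.natCast_eq_zero_iff p q).1 hp0))
  have hb0 : (b : ZMod q) ≠ 0 := by
    intro h0
    simp [h0, hp.ne_zero] at hpow
  have hdvd : p ∣ q - 1 := by
    rw [← orderOf_eq_prime hpow hne]
    exact ZMod.orderOf_dvd_card_sub_one hb0
  exact ((Nat.modEq_iff_dvd' hq.one_le).2 hdvd).symm


/-- **Theorem 2 (iv).** Let `b ≥ 2` and `n ≥ 2` be integers, `p ≥ 7` a prime, and
`a` an integer with `2 ≤ |a| ≤ n`. If `n! = (b^p − 1)/(b − 1) + a`, then `a` is odd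
and every prime `q ∣ a` with `q ≠ p` satisfies `q ≡ 1 (mod p)`. -/
theorem thm2_part4 (b : ℤ) (n : ℕ) (p : ℕ) (a : ℤ)
    (hb : 2 ≤ b) (hn : 2 ≤ n) (hp : Nat.Prime p) (hp7 : 7 ≤ p)
    (ha2 : 2 ≤ |a|) (han : |a| ≤ (n : ℤ))
    (heq : (Nat.factorial n : ℤ) = (∑ i ∈ Finset.range p, b ^ i) + a) :
    Odd a ∧ ∀ q : ℕ, Nat.Prime q → (q : ℤ) ∣ a → q ≠ p → q ≡ 1 [MOD p] := by
  have hmod : ∀ q : ℕ, Nat.Prime q → (q : ℤ) ∣ a → q ≠ p → q ≡ 1 [MOD p] := by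
    intro q hq hqa hqp
    have hqn : q ≤ n := by
      have hle : (q : ℤ) ≤ |a| := Int.le_of_dvd (by linarith) ((dvd_abs _ _).2 hqa)
      exact_mod_cast hle.trans han
    have hfac : (q : ℤ) ∣ (Nat.factorial n : ℤ) :=
      Int.natCast_dvd_natCast.2 (Nat.dvd_factorial hq.pos hqn)
    exact modEq_one_of_dvd_repunit hp hq hqp ((dvd_add_left hqa).1 (heq ▸ hfac))
  refine ⟨?_, hmod⟩
  by_contra hodd
  have h2 := hmod 2 Nat.prime_two (Int.not_odd_iff_even.1 hodd).two_dvd (by omega)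
  rw [Nat.ModEq, Nat.mod_eq_of_lt (by omega), Nat.mod_eq_of_lt (by omega)] at h2
  omega
end

section
/- There exist constants C > 0 and c₁ > 0 such that for all integers n ≥ 2, b ≥ 2, m ≥ 3 and every integer a with |a| ≤ n, if n! = (b^m − 1)/(b − 1) + a, then m ≤ C·n^{1/2}·(log n)² and b ≥ exp(c₁·√n / log n). -/
lemma exists_det_ne_zero_of_forall_eq_zero {ι κ F : Type*} [Fintype ι] [DecidableEq ι] [Field F]
    (V : κ → ι → F) (h : ∀ p : ι → F, (∀ x, ∑ i, p i * V x i = 0) → p = 0) :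
    ∃ f : ι → κ, (Matrix.of fun i j => V (f j) i).det ≠ 0 := by
  have hspan : Submodule.span F (Set.range V) = ⊤ := by
    by_contra hne
    obtain ⟨φ, hφ0, hφ⟩ := Submodule.exists_le_ker_of_lt_top _ (lt_top_iff_ne_top.2 hne)
    have hφ_sum (v : ι → F) : φ v = ∑ i, φ (Pi.single i 1) * v i := by
      conv_lhs => rw [pi_eq_sum_univ' v]
      simp [map_sum, mul_comm]
    have hp := h (fun i => φ (Pi.single i 1)) fun x => by
      rw [← hφ_sum]
      exact hφ (Submodule.subset_span ⟨x, rfl⟩)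
    refine hφ0 (LinearMap.ext fun v => ?_)
    rw [hφ_sum]
    simp [congrFun hp]
  obtain ⟨τ, a, -, hτ, hli⟩ := exists_linearIndependent' F V
  let B := Module.Basis.mk hli (by rw [hτ, hspan])
  let e := B.indexEquiv (Pi.basisFun F ι)
  refine ⟨fun j => a (e.symm j), ?_⟩
  have hli' : LinearIndependent F (fun j => V (a (e.symm j))) := hli.comp _ e.symm.injective
  have : IsUnit (Matrix.of fun j i => V (a (e.symm j)) i) :=
    Matrix.linearIndependent_rows_iff_isUnit.1 hli'
  rw [← Matrix.det_transpose]
  exact ((Matrix.isUnit_iff_isUnit_det _).1 this).ne_zero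

lemma exists_newton_coeff_pow_mul_pow {q β : ℤ} (hβ : q ∣ β - 1) (k : ℕ) :
    ∃ a : ℕ → ℤ, (∀ d, q ^ d ∣ q ^ k * a d) ∧ ∀ D z : ℕ, z < D →
      (z : ℤ) ^ k * β ^ z = ∑ d ∈ Finset.range D, a d * (z.choose d : ℤ) := by
  induction k with
  | zero =>
    refine ⟨fun d => (β - 1) ^ d, fun d => by simpa using pow_dvd_pow_of_dvd hβ d, ?_⟩
    intro D z hz
    have h := add_pow (β - 1) 1 z
    simp only [sub_add_cancel, one_pow, mul_one] at h
    rw [pow_zero, one_mul, h]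
    refine Finset.sum_subset (Finset.range_subset_range.2 hz) fun d _ hd => ?_
    rw [Finset.mem_range, not_lt] at hd
    rw [Nat.choose_eq_zero_of_lt hd, Nat.cast_zero, mul_zero]
  | succ k ih =>
    obtain ⟨a, ha, hsum⟩ := ih
    refine ⟨fun d => d * a d + d * a (d - 1), fun d => ?_, ?_⟩
    · rw [mul_add]
      refine dvd_add ?_ ?_
      · rw [pow_succ, show q ^ k * q * (d * a d) = q ^ k * a d * (q * d) by ring]
        exact (ha d).mul_right _
      · cases d with
        | zero => simp
        | succ d =>
          rw [pow_succ, pow_succ, Nat.add_sub_cancel,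
            show q ^ k * q * (((d + 1 : ℕ) : ℤ) * a d) =
              (q ^ k * a d * q) * ((d + 1 : ℕ) : ℤ) by ring]
          exact (mul_dvd_mul_right (ha d) q).mul_right _
    · intro D z hz
      obtain ⟨D, rfl⟩ : ∃ E, D = E + 1 := ⟨D - 1, by omega⟩
      have hstep (d : ℕ) : (z : ℤ) * z.choose d = d * z.choose d + (d + 1) * z.choose (d + 1) := by
        have h := Nat.choose_succ_right_eq z d
        rcases le_or_gt d z with hd | hd
        · zify [hd] at h
          linear_combination -h
        · simp [Nat.choose_eq_zero_of_lt hd, Nat.choose_eq_zero_of_lt (hd.trans d.lt_succ_self)]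
      have hlast : (z.choose (D + 1) : ℤ) = 0 := by
        rw [Nat.choose_eq_zero_of_lt hz, Nat.cast_zero]
      calc (z : ℤ) ^ (k + 1) * β ^ z = z * (z ^ k * β ^ z) := by ring
        _ = ∑ d ∈ Finset.range (D + 1), (d * a d * z.choose d +
              (d + 1) * a d * z.choose (d + 1)) := by
            rw [hsum _ z hz, Finset.mul_sum]
            exact Finset.sum_congr rfl fun d _ => by linear_combination a d * hstep d
        _ = ∑ d ∈ Finset.range (D + 1), d * a d * z.choose d +
              ∑ d ∈ Finset.range (D + 1), d * a (d - 1) * z.choose d := by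
            rw [Finset.sum_add_distrib]
            congr 1
            rw [Finset.sum_range_succ, Finset.sum_range_succ' _ D, hlast]
            simp
        _ = _ := by
            rw [← Finset.sum_add_distrib]
            exact Finset.sum_congr rfl fun d _ => by ring

lemma sum_range_card_le_sum {ι : Type*} [Fintype ι] (w : ι → ℕ)
    (hw : ∀ i j, w i = w j → w i < Fintype.card ι → i = j) :
    ∑ t ∈ Finset.range (Fintype.card ι), t ≤ ∑ i, w i := by
  classical
  set N := Fintype.card ι
  calc ∑ t ∈ Finset.range N, t = ∑ t ∈ Finset.range N, (N - 1 - t) :=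
        (Finset.sum_range_reflect (fun t => t) N).symm
    _ ≤ ∑ t ∈ Finset.range N, ∑ i, if t < w i then 1 else 0 := by
        refine Finset.sum_le_sum fun t ht => ?_
        rw [Finset.mem_range] at ht
        have h1 : (Finset.univ.filter fun i => ¬ t < w i).card ≤ t + 1 := by
          rw [← Finset.card_range (t + 1)]
          refine Finset.card_le_card_of_injOn w (fun i hi => ?_) fun i hi j hj hij => ?_
          · simp at hi ⊢; omega
          · simp at hi
            exact hw i j hij (by omega)
        have h2 := Finset.card_filter_add_card_filter_not (s := (Finset.univ : Finset ι))
          (fun i => t < w i)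
        rw [Finset.card_univ] at h2
        rw [← Finset.card_filter]
        omega
    _ = ∑ i, ∑ t ∈ Finset.range N, if t < w i then 1 else 0 := Finset.sum_comm
    _ ≤ ∑ i, w i := by
        refine Finset.sum_le_sum fun i _ => ?_
        rw [← Finset.card_filter]
        calc _ ≤ (Finset.range (w i)).card := Finset.card_le_card fun t ht => by simp at ht ⊢; omega
          _ = w i := Finset.card_range _

lemma pow_sum_range_dvd_det {ι : Type*} [Fintype ι] [DecidableEq ι] (q : ℤ) (D : ℕ)
    (M E : Matrix ι ι ℤ) (c : ι → Fin D → ℤ) (v : Fin D → ι → ℤ)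
    (hM : ∀ i j, M i j = q ^ Fintype.card ι * E i j + ∑ d : Fin D, q ^ (d : ℕ) * c i d * v d j) :
    q ^ (∑ t ∈ Finset.range (Fintype.card ι), t) ∣ M.det := by
  classical
  let w : Option (Fin D) → ℕ := fun o => o.elim (Fintype.card ι) fun d => d
  let x : ι → Option (Fin D) → ℤ := fun i o => o.elim 1 fun d => c i d
  let u : ι → Option (Fin D) → ι → ℤ := fun i o => o.elim (E i) v
  have hrow : M = fun i => ∑ o, (q ^ w o * x i o) • u i o := by
    funext i j
    rw [hM, Finset.sum_apply, Fintype.sum_option]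
    simp [w, x, u]
  have hdet : M.det = ∑ σ : ι → Option (Fin D),
      (∏ i, q ^ w (σ i) * x i (σ i)) * (Matrix.of fun i => u i (σ i)).det := by
    rw [hrow]
    refine (MultilinearMap.map_sum (Matrix.detRowAlternating (R := ℤ) (n := ι)).toMultilinearMap
      fun i o => (q ^ w o * x i o) • u i o).trans (Finset.sum_congr rfl fun σ _ => ?_)
    exact (MultilinearMap.map_smul_univ _ _ _).trans (by rfl)
  rw [hdet]
  refine Finset.dvd_sum fun σ _ => ?_
  by_cases hσ : ∃ i j, i ≠ j ∧ σ i = σ j ∧ σ i ≠ none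
  · obtain ⟨i, j, hij, hσij, hi⟩ := hσ
    rw [Matrix.det_zero_of_row_eq hij, mul_zero]
    · exact dvd_zero _
    · obtain ⟨d, hd⟩ := Option.ne_none_iff_exists'.1 hi
      funext k
      simp [u, ← hσij, hd]
  · push Not at hσ
    refine Dvd.dvd.mul_right ?_ _
    rw [Finset.prod_mul_distrib, Finset.prod_pow_eq_pow_sum]
    refine Dvd.dvd.mul_right (pow_dvd_pow q (sum_range_card_le_sum _ fun i j hij hi => ?_)) _
    by_contra hne
    rcases hσi : σ i with _ | d
    · simp [hσi, w] at hi
    · rcases hσj : σ j with _ | d'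
      · simp [hσi, hσj, w] at hij hi; omega
      · refine absurd (hσ i j hne ?_) (by simp [hσi])
        simp [hσi, hσj, w] at hij ⊢
        omega

open Polynomial in
lemma natDegree_det_le_card_mul {ι R : Type*} [Fintype ι] [DecidableEq ι] [CommRing R]
    (M : Matrix ι ι R[X]) (d : ℕ) (hM : ∀ i j, (M i j).natDegree ≤ d) :
    M.det.natDegree ≤ Fintype.card ι * d := by
  rw [Matrix.det_apply]
  refine natDegree_sum_le_of_forall_le _ _ fun σ _ => (natDegree_smul_le _ _).trans ?_
  refine (natDegree_prod_le _ _).trans ((Finset.sum_le_card_nsmul _ _ d fun i _ => hM _ _).trans ?_)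
  simp

open Polynomial in
lemma coeff_det_card_mul {ι R : Type*} [Fintype ι] [DecidableEq ι] [CommRing R]
    (M : Matrix ι ι R[X]) (d : ℕ) (hM : ∀ i j, (M i j).natDegree ≤ d) :
    M.det.coeff (Fintype.card ι * d) = (Matrix.of fun i j => (M i j).coeff d).det := by
  rw [Matrix.det_apply, Matrix.det_apply, finsetSum_coeff]
  refine Finset.sum_congr rfl fun σ _ => ?_
  rw [coeff_smul, ← Finset.card_univ, coeff_prod_of_natDegree_le _ _ _ fun i _ => hM _ _]
  rfl

open Polynomial in
lemma det_taylor_ne_zero {F : Type*} [Field F] {t d : ℕ} (P : Fin t → F[X])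
    (hP : ∀ j, P j ≠ 0) (hd : ∀ j, (P j).natDegree ≤ d) {v : Fin t → F}
    (hv : Function.Injective v) :
    (Matrix.of fun i j : Fin t => C (v j ^ (i : ℕ)) * taylor (i : F) (P j)).det ≠ 0 := by
  intro h0
  let M : Matrix (Fin t) (Fin t) F[X] := Matrix.of fun i j =>
    X ^ (d - (P j).natDegree) * (C (v j ^ (i : ℕ)) * taylor (i : F) (P j))
  have hM0 : M.det = 0 := by
    have := Matrix.det_mul_row (fun j => (X : F[X]) ^ (d - (P j).natDegree))
      (Matrix.of fun i j : Fin t => C (v j ^ (i : ℕ)) * taylor (i : F) (P j))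
    rw [h0, mul_zero] at this
    exact this
  have hM (i j) : (M i j).natDegree ≤ d := by
    change (X ^ (d - (P j).natDegree) * (C (v j ^ (i : ℕ)) * taylor (i : F) (P j))).natDegree ≤ d
    refine natDegree_mul_le.trans ?_
    have h1 := natDegree_C_mul_le (v j ^ (i : ℕ)) (taylor (i : F) (P j))
    rw [natDegree_taylor] at h1
    rw [natDegree_X_pow]
    have := hd j
    omega
  have hcoeff (i j) : (M i j).coeff d = (P j).leadingCoeff * v j ^ (i : ℕ) := by
    have h : d = (P j).natDegree + (d - (P j).natDegree) := by have := hd j; omega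
    change (X ^ (d - (P j).natDegree) * (C (v j ^ (i : ℕ)) * taylor (i : F) (P j))).coeff d = _
    conv_lhs => rw [h]
    rw [Nat.add_sub_cancel_left, coeff_X_pow_mul, coeff_C_mul, coeff_taylor_natDegree, mul_comm]
  have h1 := coeff_det_card_mul M d hM
  rw [hM0, coeff_zero] at h1
  have h2 : (Matrix.of fun i j => (M i j).coeff d) =
      Matrix.of fun i j => (P j).leadingCoeff * (Matrix.vandermonde v).transpose i j := by
    ext i j
    simp [hcoeff, Matrix.vandermonde]
  rw [h2, Matrix.det_mul_row, Matrix.det_transpose] at h1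
  refine mul_ne_zero (Finset.prod_ne_zero_iff.2 fun j _ => leadingCoeff_ne_zero.2 (hP j)) ?_ h1.symm
  exact Matrix.det_vandermonde_ne_zero_iff.2 hv

open Polynomial in
lemma eq_zero_of_forall_sum_pow_eq_zero {F : Type*} [Field F] [LinearOrder F]
    [IsStrictOrderedRing F] {K L m R S : ℕ} {b c : F}
    (hb : 1 < b) (hc : c ≠ 0) (hRm : R ≤ m) (hRS : L * (K - 1) < R * S)
    (p : Fin K × Fin L → F)
    (hp : ∀ r s, r < R + L → s < S →
      ∑ i, p i * (((r + m * s : ℕ) : F) ^ (i.1 : ℕ) * (b ^ r * c ^ s) ^ (i.2 : ℕ)) = 0) :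
    p = 0 := by
  classical
  let P : Fin L → F[X] := fun l => ∑ k : Fin K, C (p (k, l)) * X ^ (k : ℕ)
  have hPcoeff (k : Fin K) (l : Fin L) : (P l).coeff k = p (k, l) := by
    simp [P, coeff_X_pow, Fin.val_inj]
  have hPdeg (l : Fin L) : (P l).natDegree ≤ K - 1 := by
    refine natDegree_sum_le_of_forall_le _ _ fun k _ => (natDegree_C_mul_X_pow_le _ _).trans ?_
    have := k.2
    omega
  have hPeval (r s : ℕ) (hr : r < R + L) (hs : s < S) :
      ∑ l, (P l).eval ((r + m * s : ℕ) : F) * (b ^ r * c ^ s) ^ (l : ℕ) = 0 := by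
    rw [← hp r s hr hs, Fintype.sum_prod_type_right]
    refine Finset.sum_congr rfl fun l _ => ?_
    rw [eval_finsetSum, Finset.sum_mul]
    exact Finset.sum_congr rfl fun k _ => by simp [mul_assoc]
  by_contra hne
  let T := Finset.univ.filter fun l => P l ≠ 0
  have hT : 0 < T.card := by
    rw [Finset.card_pos]
    by_contra hT
    refine hne (funext fun ⟨k, l⟩ => ?_)
    rw [← hPcoeff k l]
    have : P l = 0 := by
      by_contra hl
      exact hT ⟨l, by simp [T, hl]⟩
    simp [this]
  have hTL : T.card ≤ L := by simpa using Finset.card_le_univ T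
  let e := T.equivFin.symm
  let f : Fin T.card → Fin L := fun j => (e j : Fin L)
  have hf : Function.Injective f := Subtype.val_injective.comp e.injective
  let v : Fin T.card → F := fun j => b ^ (f j : ℕ)
  have hv : Function.Injective v := fun i j hij =>
    hf (Fin.ext (pow_right_injective₀ (zero_lt_one.trans hb) hb.ne' hij))
  let M : Matrix (Fin T.card) (Fin T.card) F[X] :=
    Matrix.of fun i j => C (v j ^ (i : ℕ)) * taylor (i : F) (P (f j))
  have hM : M.det ≠ 0 := det_taylor_ne_zero (fun j => P (f j))
    (fun j => (Finset.mem_filter.1 (e j).2).2) (fun j => hPdeg _) hv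
  have hMdeg : M.det.natDegree ≤ L * (K - 1) := by
    refine (natDegree_det_le_card_mul M (K - 1) fun i j => ?_).trans ?_
    · refine (natDegree_C_mul_le _ _).trans ?_
      exact (natDegree_taylor _ _).le.trans (hPdeg _)
    · rw [Fintype.card_fin]
      gcongr
  refine hM (eq_zero_of_natDegree_lt_card_of_eval_eq_zero M.det
    (f := fun x : Fin R × Fin S => ((x.1 + m * x.2 : ℕ) : F)) ?_ ?_ ?_)
  · rintro ⟨r, s⟩ ⟨r', s'⟩ h
    have h : (r : ℕ) + m * s = r' + m * s' := by simpa using Nat.cast_injective h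
    have hr := r.2.trans_le hRm
    have hr' := r'.2.trans_le hRm
    have hmod := congrArg (· % m) h
    have hdiv := congrArg (· / m) h
    simp only [Nat.add_mul_mod_self_left, Nat.mod_eq_of_lt hr, Nat.mod_eq_of_lt hr'] at hmod
    simp only [Nat.add_mul_div_left _ _ (Nat.zero_lt_of_lt hr), Nat.div_eq_of_lt hr,
      Nat.div_eq_of_lt hr', zero_add] at hdiv
    exact Prod.ext (Fin.ext hmod) (Fin.ext hdiv)
  · rintro ⟨r, s⟩
    let x : F := ((r + m * s : ℕ) : F)
    have hb0 : b ≠ 0 := (zero_lt_one.trans hb).ne'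
    have hdet : (evalRingHom x) M.det = 0 := by
      rw [RingHom.map_det]
      refine Matrix.exists_mulVec_eq_zero_iff.1 ⟨fun j => (b ^ (r : ℕ) * c ^ (s : ℕ)) ^ (f j : ℕ),
        fun h => ?_, funext fun i => ?_⟩
      · have := congrFun h ⟨0, hT⟩
        simp [hb0, hc] at this
      · have hi := i.2
        have h := hPeval (r + i) s (by have := r.2; omega) s.2
        rw [← Finset.sum_filter_of_ne (p := fun l => P l ≠ 0)
          (by intro l _ h0 hl; simp [hl] at h0), ← Finset.sum_coe_sort,
          ← Equiv.sum_comp e] at h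
        rw [Pi.zero_apply, ← h]
        simp only [Matrix.mulVec, dotProduct]
        refine Finset.sum_congr rfl fun j _ => ?_
        simp only [M, v, RingHom.mapMatrix_apply, Matrix.map_apply, Matrix.of_apply,
          coe_evalRingHom, eval_mul, eval_C, taylor_eval, x, f]
        push_cast
        ring_nf
    exact hdet
  · simpa using hMdeg.trans_lt hRS

lemma mul_le_of_dvd_pow_sub {b c : ℤ} {m ν β γ t K L R S : ℕ} (hb : 1 < b) (hb2 : 2 ∣ b - 1)
    (hc : c ≠ 0) (hbc : 2 ^ ν ∣ b ^ m - c) (hbβ : b ≤ 2 ^ β) (hcγ : |c| ≤ 2 ^ γ)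
    (hRm : R ≤ m) (hRS : L * (K - 1) < R * S) (hν : K * L ≤ ν) (hKL : K * L ≤ 2 ^ t)
    (hmS : R + L + m * S ≤ 2 ^ t) :
    K * L ≤ K + 2 * (t + (t * K + L * (β * (R + L) + γ * S))) := by
  rcases Nat.eq_zero_or_pos (K * L) with h0 | hpos
  · rw [h0]
    exact Nat.zero_le _
  let x : Fin (R + L) × Fin S → ℕ := fun y => y.1 + m * y.2
  have hx (y) : x y < 2 ^ t := by
    have h2 : m * y.2 ≤ m * S := Nat.mul_le_mul_left m y.2.2.le
    have h1 := y.1.2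
    change (y.1 : ℕ) + m * y.2 < 2 ^ t
    omega
  let V : Fin (R + L) × Fin S → Fin K × Fin L → ℤ := fun y i =>
    (x y : ℤ) ^ (i.1 : ℕ) * (b ^ (y.1 : ℕ) * c ^ (y.2 : ℕ)) ^ (i.2 : ℕ)
  obtain ⟨f, hf⟩ := exists_det_ne_zero_of_forall_eq_zero (F := ℚ) (fun y i => (V y i : ℚ)) fun p hp =>
    eq_zero_of_forall_sum_pow_eq_zero (b := (b : ℚ)) (c := (c : ℚ)) (by exact_mod_cast hb)
      (by exact_mod_cast hc) hRm hRS p fun r s hr hs => by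
        rw [← hp (⟨r, hr⟩, ⟨s, hs⟩)]
        simp [V, x]
  let M : Matrix (Fin K × Fin L) (Fin K × Fin L) ℤ := Matrix.of fun i j => V (f j) i
  have hM : M.det ≠ 0 := by
    intro h
    apply hf
    have := (Int.castRingHom ℚ).map_det M
    rw [h, map_zero] at this
    exact this.symm
  have hcard : Fintype.card (Fin K × Fin L) = K * L := by simp
  have hpow (y) (l : ℕ) : (2 : ℤ) ^ (K * L) ∣
      (b ^ (y.1 : ℕ) * c ^ (y.2 : ℕ)) ^ l - (b ^ l) ^ x y := by
    have h1 : b ^ m ≡ c [ZMOD 2 ^ ν] := ((Int.modEq_iff_dvd.2 hbc)).symm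
    have h2 : (b ^ l) ^ x y ≡ (b ^ (y.1 : ℕ) * c ^ (y.2 : ℕ)) ^ l [ZMOD 2 ^ ν] := by
      rw [← pow_mul, mul_comm l, pow_mul]
      refine Int.ModEq.pow l ?_
      rw [pow_add, pow_mul]
      exact (h1.pow _).mul_left _
    exact (pow_dvd_pow 2 hν).trans h2.dvd
  choose E hE using fun i j : Fin K × Fin L => hpow (f j) i.2
  choose a ha hasum using fun i : Fin K × Fin L => exists_newton_coeff_pow_mul_pow (q := 2)
    (β := b ^ (i.2 : ℕ)) (hb2.trans (sub_one_dvd_pow_sub_one b i.2)) i.1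
  choose a' ha' using ha
  have hdvd : (2 : ℤ) ^ (∑ s ∈ Finset.range (K * L), s) ∣
      2 ^ (L * ∑ s ∈ Finset.range K, s) * M.det := by
    have h := pow_sum_range_dvd_det 2 (2 ^ t)
      (Matrix.of fun i j => 2 ^ (i.1 : ℕ) * M i j)
      (Matrix.of fun i j => 2 ^ (i.1 : ℕ) * ((x (f j) : ℤ) ^ (i.1 : ℕ) * E i j))
      (fun i d => a' i d) (fun d j => ((x (f j)).choose d : ℤ)) fun i j => by
        have h1 := hasum i (2 ^ t) (x (f j)) (hx _)
        have h2 := hE i j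
        rw [hcard, ← Finset.sum_range
          (fun d => 2 ^ d * a' i d * ((x (f j)).choose d : ℤ))]
        simp only [← ha', mul_assoc, ← Finset.mul_sum, ← h1, Matrix.of_apply, M, V]
        linear_combination 2 ^ (i.1 : ℕ) * (x (f j) : ℤ) ^ (i.1 : ℕ) * h2
    rw [hcard, Matrix.det_mul_column, Finset.prod_pow_eq_pow_sum] at h
    convert h using 3
    simp [Fintype.sum_prod_type_right, Finset.sum_range]
  set Y := t * K + L * (β * (R + L) + γ * S) with hY
  have hentry (i j) : |M i j| ≤ 2 ^ Y := by
    have hi1 : (i.1 : ℕ) ≤ K := i.1.2.le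
    have hi2 : (i.2 : ℕ) ≤ L := i.2.2.le
    have hr : ((f j).1 : ℕ) ≤ R + L := (f j).1.2.le
    have hs : ((f j).2 : ℕ) ≤ S := (f j).2.2.le
    have hxz : |(x (f j) : ℤ)| ≤ 2 ^ t := by
      rw [Nat.abs_cast]
      exact_mod_cast (hx (f j)).le
    calc |M i j| = |(x (f j) : ℤ)| ^ (i.1 : ℕ) *
          (|b| ^ ((f j).1 : ℕ) * |c| ^ ((f j).2 : ℕ)) ^ (i.2 : ℕ) := by
          simp [M, V, abs_mul, abs_pow]
      _ ≤ (2 ^ t) ^ (i.1 : ℕ) *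
          ((2 ^ β) ^ ((f j).1 : ℕ) * (2 ^ γ) ^ ((f j).2 : ℕ)) ^ (i.2 : ℕ) := by
          rw [abs_of_pos (by omega : 0 < b)]
          gcongr
      _ = 2 ^ (t * i.1 + i.2 * (β * (f j).1 + γ * (f j).2)) := by
          rw [← pow_mul, ← pow_mul, ← pow_mul, ← pow_add, ← pow_mul, ← pow_add]
          ring_nf
      _ ≤ 2 ^ Y := by
          rw [hY]
          gcongr
          norm_num
  have hdet : |M.det| ≤ 2 ^ (K * L * (t + Y)) := by
    have h := Matrix.det_le (A := M) (abv := AbsoluteValue.abs) (x := 2 ^ Y) hentry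
    rw [hcard, nsmul_eq_mul] at h
    refine h.trans ?_
    have h1 : ((K * L).factorial : ℤ) ≤ (2 ^ t) ^ (K * L) := by
      exact_mod_cast (Nat.factorial_le_pow _).trans (Nat.pow_le_pow_left hKL _)
    calc ((K * L).factorial : ℤ) * (2 ^ Y) ^ (K * L) ≤ (2 ^ t) ^ (K * L) * (2 ^ Y) ^ (K * L) := by
          gcongr
      _ = 2 ^ (K * L * (t + Y)) := by
          rw [← mul_pow, ← pow_add, ← pow_mul, mul_comm]
  have hle : (2 : ℤ) ^ (∑ s ∈ Finset.range (K * L), s) ≤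
      2 ^ (L * ∑ s ∈ Finset.range K, s + K * L * (t + Y)) := by
    rw [pow_add]
    calc _ ≤ |2 ^ (L * ∑ s ∈ Finset.range K, s) * M.det| :=
          Int.le_of_dvd (abs_pos.2 (mul_ne_zero (by positivity) hM)) ((dvd_abs _ _).2 hdvd)
      _ = 2 ^ (L * ∑ s ∈ Finset.range K, s) * |M.det| := by
          rw [abs_mul, abs_of_pos (by positivity : (0 : ℤ) < 2 ^ (L * ∑ s ∈ Finset.range K, s))]
      _ ≤ _ := by gcongr
  have hexp := (pow_le_pow_iff_right₀ (by norm_num : (1 : ℤ) < 2)).1 hle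
  have h1 := Finset.sum_range_id_mul_two (K * L)
  have h2 := Finset.sum_range_id_mul_two K
  have h3 : K * L * (K * L - 1) ≤ K * L * ((K - 1) + 2 * (t + Y)) := by
    calc K * L * (K * L - 1) = (∑ s ∈ Finset.range (K * L), s) * 2 := h1.symm
      _ ≤ (L * ∑ s ∈ Finset.range K, s + K * L * (t + Y)) * 2 := Nat.mul_le_mul_right 2 hexp
      _ = L * ((∑ s ∈ Finset.range K, s) * 2) + K * L * (2 * (t + Y)) := by ring
      _ = _ := by rw [h2]; ring
  have h4 := Nat.le_of_mul_le_mul_left h3 hpos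
  have hK : 0 < K := Nat.pos_of_mul_pos_right hpos
  omega

lemma lt_of_dvd_pow_sub {b c : ℤ} {m ν β γ t : ℕ} (hb : 1 < b) (hb2 : 2 ∣ b - 1)
    (hc : c ≠ 0) (hbc : 2 ^ ν ∣ b ^ m - c) (hbβ : b ≤ 2 ^ β) (hcγ : |c| ≤ 2 ^ γ)
    (hβ : 0 < β) (hγ : 0 < γ) (ht : 0 < t) (hm : 256 * t * γ ≤ m)
    (hN : 65536 * t ^ 2 * β * γ ≤ 2 ^ t) (hmt : 768 * m * t * β ≤ 2 ^ t) :
    ν < 65536 * t ^ 2 * β * γ := by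
  by_contra! hν
  have hKL : 4096 * t * β * γ * (16 * t) = 65536 * t ^ 2 * β * γ := by ring
  have htβ : 1 ≤ t * β := Nat.mul_pos ht hβ
  have hmS : 256 * t * γ + 16 * t + m * (256 * t * β) ≤ 2 ^ t := by
    have h1 : t ≤ t * γ := Nat.le_mul_of_pos_right t hγ
    have h2 : m ≤ m * (t * β) := Nat.le_mul_of_pos_right m htβ
    nlinarith
  have hRS : 16 * t * (4096 * t * β * γ - 1) < 256 * t * γ * (256 * t * β) := by
    have h0 : 0 < 4096 * t * β * γ := by positivity
    calc 16 * t * (4096 * t * β * γ - 1) < 16 * t * (4096 * t * β * γ) := by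
          gcongr
          omega
      _ = _ := by ring
  have h := mul_le_of_dvd_pow_sub hb hb2 hc hbc hbβ hcγ hm hRS (hKL.trans_le hν)
    (hKL.trans_le hN) hmS
  have e1 : t ≤ t * (t * (β * γ)) := Nat.le_mul_of_pos_right t (by positivity)
  have e2 : t * β * γ ≤ t * (t * β * γ) := Nat.le_mul_of_pos_left _ ht
  have e3 : t ^ 2 * β ≤ t ^ 2 * β * γ := Nat.le_mul_of_pos_right _ hγ
  have e4 : 0 < t ^ 2 * β * γ := by positivity
  nlinarith

lemma two_pow_half_dvd_factorial (n : ℕ) : 2 ^ (n / 2) ∣ n.factorial := by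
  have h (k : ℕ) : 2 ^ k ∣ (2 * k).factorial := by
    induction k with
    | zero => simp
    | succ k ih =>
      rw [pow_succ, show 2 * (k + 1) = 2 * k + 1 + 1 by ring, Nat.factorial_succ,
        Nat.factorial_succ, mul_comm]
      refine mul_dvd_mul ⟨k + 1, by ring⟩ (ih.mul_left _)
  exact (h _).trans (Nat.factorial_dvd_factorial (Nat.mul_div_le n 2))

lemma two_mul_le_factorial {n : ℕ} (hn : 3 ≤ n) : 2 * n ≤ n.factorial := by
  obtain ⟨k, rfl⟩ : ∃ k, n = k + 1 := ⟨n - 1, by omega⟩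
  rw [Nat.factorial_succ, mul_comm]
  exact Nat.mul_le_mul_left _ ((by omega : 2 ≤ k).trans (Nat.self_le_factorial k))

lemma le_mul_of_factorial_eq_geom_sum_add {n m l β : ℕ} {a b : ℤ} (hb : 2 ≤ b) (hm : 1 ≤ m)
    (ha : |a| ≤ n) (h : (n.factorial : ℤ) = (∑ i ∈ Finset.range m, b ^ i) + a)
    (hn : n ≤ 2 ^ l) (hbβ : b ≤ 2 ^ β) (hl : 0 < l) (hβ : 0 < β) :
    n ≤ 2 ^ 22 * (l ^ 2 * β * (β + l)) := by
  by_contra! hlt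
  have hQ1 : 1 ≤ l ^ 2 * β * (β + l) := by
    have : 0 < l ^ 2 * β * (β + l) := by positivity
    omega
  have hlQ : l ≤ l ^ 2 * β * (β + l) := by
    calc l = l * 1 * 1 * 1 := by ring
      _ ≤ l * l * β * (β + l) := by gcongr <;> omega
      _ = _ := by ring
  have hlβQ : l * β ≤ l ^ 2 * β * (β + l) := by
    calc l * β = l * 1 * β * 1 := by ring
      _ ≤ l * l * β * (β + l) := by gcongr <;> omega
      _ = _ := by ring
  have hγQ : β + l ≤ l ^ 2 * β * (β + l) := Nat.le_mul_of_pos_left _ (by positivity)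
  have hβγQ : β * (β + l) ≤ l ^ 2 * β * (β + l) := by
    rw [mul_assoc]
    exact Nat.le_mul_of_pos_left _ (by positivity)
  have hlβγQ : l * β * (β + l) ≤ l ^ 2 * β * (β + l) := by
    rw [sq, mul_assoc l l β, mul_assoc l (l * β)]
    exact Nat.le_mul_of_pos_left _ hl
  obtain ⟨ha1, ha2⟩ := abs_le.1 ha
  have hgeom := geom_sum_mul b m
  have hfac : (2 * n : ℤ) ≤ n.factorial := by
    exact_mod_cast two_mul_le_factorial (by omega)
  have hpow_sub : b ^ m - (1 - a * (b - 1)) = (b - 1) * n.factorial := by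
    rw [h]
    linear_combination -hgeom
  have hdvd : (2 : ℤ) ^ (n / 2) ∣ b ^ m - (1 - a * (b - 1)) := by
    rw [hpow_sub]
    refine Dvd.dvd.mul_left ?_ _
    exact_mod_cast two_pow_half_dvd_factorial n
  have hc : 1 - a * (b - 1) ≠ 0 := by
    intro hc0
    have hb1 : b - 1 = 1 := by
      have := Int.isUnit_iff.1 (IsUnit.of_mul_eq_one a (by linarith : (b - 1) * a = 1))
      omega
    have hb2 : b = 2 := by omega
    rw [hc0, hb1, hb2, one_mul, sub_zero] at hpow_sub
    have h3 : 3 ∣ 2 ^ m := by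
      rw [show 2 ^ m = n.factorial by exact_mod_cast hpow_sub]
      exact Nat.dvd_factorial (by norm_num) (by omega)
    have := Nat.prime_three.dvd_of_dvd_pow h3
    omega
  have hcγ : |1 - a * (b - 1)| ≤ 2 ^ (β + l) := by
    have hn' : (n : ℤ) ≤ 2 ^ l := by exact_mod_cast hn
    calc |1 - a * (b - 1)| ≤ |1| + |a * (b - 1)| := abs_sub _ _
      _ = 1 + |a| * (b - 1) := by rw [abs_mul, abs_one, abs_of_pos (by omega : 0 < b - 1)]
      _ ≤ 1 + n * (b - 1) := by gcongr; omega
      _ ≤ n * b := by nlinarith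
      _ ≤ 2 ^ l * 2 ^ β := by gcongr
      _ = 2 ^ (β + l) := by rw [pow_add, mul_comm]
  have hmβ : n / 2 ≤ m * β := by
    have h1 : (2 : ℤ) ^ (n - 1) ≤ 2 ^ (m * β + 1) := by
      calc (2 : ℤ) ^ (n - 1) ≤ n.factorial := by
            have h2 := Nat.factorial_mul_pow_le_factorial (m := 1) (n := n - 1)
            rw [Nat.factorial_one, one_mul, Nat.add_sub_cancel' (by omega)] at h2
            exact_mod_cast h2
        _ ≤ 2 * b ^ m := by nlinarith [Finset.sum_nonneg fun i (_ : i ∈ Finset.range m) =>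
              (by positivity : 0 ≤ b ^ i)]
        _ ≤ 2 * (2 ^ β) ^ m := by gcongr
        _ = 2 ^ (m * β + 1) := by rw [← pow_mul, pow_succ]; ring
    have := (pow_le_pow_iff_right₀ (by norm_num : (1 : ℤ) < 2)).1 h1
    omega
  have hmn : m ≤ 2 * l * n := by
    have h1 : (2 : ℤ) ^ (m - 1) ≤ 2 ^ (l * n + 1) := by
      calc (2 : ℤ) ^ (m - 1) ≤ b ^ (m - 1) := by gcongr
        _ ≤ ∑ i ∈ Finset.range m, b ^ i :=
            Finset.single_le_sum (f := fun i => b ^ i) (fun i _ => by positivity)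
              (Finset.mem_range.2 (by omega))
        _ ≤ 2 * n.factorial := by linarith
        _ ≤ 2 * (2 ^ l) ^ n := by
            exact_mod_cast Nat.mul_le_mul_left 2
              ((Nat.factorial_le_pow n).trans (Nat.pow_le_pow_left hn n))
        _ = 2 ^ (l * n + 1) := by rw [← pow_mul, pow_succ, mul_comm]
    have h2 := (pow_le_pow_iff_right₀ (by norm_num : (1 : ℤ) < 2)).1 h1
    have h3 : n ≤ l * n := Nat.le_mul_of_pos_left n hl
    rw [mul_assoc]
    omega
  rcases Int.even_or_odd b with hbe | hbo
  · have h2 : (2 : ℤ) ^ min m (n / 2) ∣ 1 - a * (b - 1) := by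
      have h3 : (2 : ℤ) ^ min m (n / 2) ∣ b ^ m :=
        (pow_dvd_pow 2 (min_le_left _ _)).trans (pow_dvd_pow_of_dvd hbe.two_dvd m)
      simpa using dvd_sub h3 ((pow_dvd_pow 2 (min_le_right m (n / 2))).trans hdvd)
    have h4 : (2 : ℤ) ^ min m (n / 2) ≤ 2 ^ (β + l) :=
      (Int.le_of_dvd (abs_pos.2 hc) ((dvd_abs _ _).2 h2)).trans hcγ
    have h5 := (pow_le_pow_iff_right₀ (by norm_num : (1 : ℤ) < 2)).1 h4
    rcases min_le_iff.1 h5 with h6 | h6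
    · have h7 : m * β ≤ β * (β + l) := by
        rw [mul_comm]
        exact Nat.mul_le_mul_left β h6
      omega
    · omega
  · have hb2 : 2 ∣ b - 1 := (hbo.sub_odd odd_one).two_dvd
    by_cases hm' : 256 * (4 * l) * (β + l) ≤ m
    · have h1 := lt_of_dvd_pow_sub (t := 4 * l) (by omega) hb2 hc hdvd hbβ hcγ hβ (by omega)
        (by omega) hm' ?_ ?_
      · have h2 : 65536 * (4 * l) ^ 2 * β * (β + l) = 2 ^ 20 * (l ^ 2 * β * (β + l)) := by ring
        omega
      · calc 65536 * (4 * l) ^ 2 * β * (β + l) = 2 ^ 20 * (l ^ 2 * β * (β + l)) := by ring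
          _ ≤ n := by omega
          _ ≤ 2 ^ l := hn
          _ ≤ 2 ^ (4 * l) := Nat.pow_le_pow_right two_pos (by omega)
      · calc 768 * m * (4 * l) * β = m * (3072 * (l * β)) := by ring
          _ ≤ 2 * l * n * n := by gcongr; omega
          _ ≤ n * n * n := by gcongr; omega
          _ ≤ 2 ^ l * 2 ^ l * 2 ^ l := by gcongr
          _ = 2 ^ (3 * l) := by rw [← pow_add, ← pow_add]; ring_nf
          _ ≤ 2 ^ (4 * l) := Nat.pow_le_pow_right two_pos (by omega)
    · have h1 : m * β ≤ 256 * (4 * l) * (β + l) * β := Nat.mul_le_mul_right β (by omega)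
      have h2 : 256 * (4 * l) * (β + l) * β = 1024 * (l * β * (β + l)) := by ring
      omega

lemma size_le_three_mul_log {n : ℕ} (hn : 2 ≤ n) : (n.size : ℝ) ≤ 3 * Real.log n := by
  have hs : 2 ≤ n.size := Nat.lt_size.2 (by omega)
  have h1 : 2 ^ (n.size - 1) ≤ n := Nat.lt_size.1 (by omega)
  have h2 : (2 : ℝ) ^ (n.size - 1) ≤ n := by exact_mod_cast h1
  have h3 := Real.log_le_log (by positivity) h2
  rw [Real.log_pow, Nat.cast_sub (by omega), Nat.cast_one] at h3
  have h4 : (2 : ℝ) ≤ n.size := by exact_mod_cast hs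
  nlinarith [Real.log_two_gt_d9]

lemma log_sq_le_sixteen_mul_sqrt {x : ℝ} (hx : 1 ≤ x) : Real.log x ^ 2 ≤ 16 * √x := by
  have h1 : Real.log x ≤ 4 * √√x := by
    have h := Real.log_le_self (Real.sqrt_nonneg √x)
    rw [Real.log_sqrt (Real.sqrt_nonneg x), Real.log_sqrt (by linarith)] at h
    linarith
  calc Real.log x ^ 2 ≤ (4 * √√x) ^ 2 := by
        gcongr
        exact Real.log_nonneg hx
    _ = 16 * √x := by rw [mul_pow, Real.sq_sqrt (Real.sqrt_nonneg x)]; norm_num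

/-- **Lemma 1.** There exist constants `C > 0` and `c₁ > 0` such that for all
integers `n ≥ 2`, `b ≥ 2`, `m ≥ 3` and every integer `a` with `|a| ≤ n`, if
`n! = (b^m − 1)/(b − 1) + a`, then `m ≤ C·n^{1/2}·(log n)²` and
`b ≥ exp(c₁·√n / log n)`. -/
theorem lemma1_size_bounds :
    ∃ C c₁ : ℝ, 0 < C ∧ 0 < c₁ ∧ ∀ (n : ℕ) (b : ℤ) (m : ℕ) (a : ℤ),
      2 ≤ n → 2 ≤ b → 3 ≤ m → |a| ≤ (n : ℤ) →
      (Nat.factorial n : ℤ) = (∑ i ∈ Finset.range m, b ^ i) + a →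
      (m : ℝ) ≤ C * Real.sqrt n * (Real.log n) ^ 2 ∧
        Real.exp (c₁ * Real.sqrt n / Real.log n) ≤ (b : ℝ) := by
  obtain ⟨c₁, hc₁⟩ : ∃ c₁ : ℝ, c₁ = 1 / (17 * (81 * 2 ^ 22)) := ⟨_, rfl⟩
  have hc₁0 : 0 < c₁ := by rw [hc₁]; positivity
  refine ⟨2 / c₁ + 3, c₁, by positivity, hc₁0, fun n b m a hn hb hm ha h => ?_⟩
  have hnat := le_mul_of_factorial_eq_geom_sum_add (l := n.size) (β := b.toNat.size) hb
    (by omega) ha h n.lt_size_self.le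
    (by have := b.toNat.lt_size_self; zify at this; rw [Int.toNat_of_nonneg (by omega)] at this
        exact this.le)
    (Nat.size_pos.2 (by omega)) (Nat.size_pos.2 (by omega))
  have hbcast : ((b.toNat : ℕ) : ℝ) = b := by
    exact_mod_cast congrArg (Int.cast (R := ℝ)) (Int.toNat_of_nonneg (by omega : 0 ≤ b))
  have hβ := size_le_three_mul_log (n := b.toNat) (by omega)
  rw [hbcast] at hβ
  have hl := size_le_three_mul_log hn
  have hn2 : (2 : ℝ) ≤ n := by exact_mod_cast hn
  have hb2 : (2 : ℝ) ≤ b := by exact_mod_cast hb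
  have hlog := log_sq_le_sixteen_mul_sqrt (by linarith : (1 : ℝ) ≤ n)
  have hy2 : Real.log 2 ≤ Real.log n := Real.log_le_log (by norm_num) hn2
  have hx2 : Real.log 2 ≤ Real.log b := Real.log_le_log (by norm_num) hb2
  have hlog2 := Real.log_two_gt_d9
  set x := Real.log b with hx
  set y := Real.log n with hy
  set w := √(n : ℝ) with hw
  have hw1 : 1 ≤ w := Real.one_le_sqrt.2 (by linarith)
  have hww : w * w = n := Real.mul_self_sqrt (by linarith)
  have hx0 : 0 < x := by linarith
  have hy0 : 0 < y := by linarith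
  have hreal : (n : ℝ) ≤ 81 * 2 ^ 22 * (y ^ 2 * x * (x + y)) := by
    calc (n : ℝ) ≤ 2 ^ 22 * ((n.size : ℝ) ^ 2 * b.toNat.size * (b.toNat.size + n.size)) := by
          exact_mod_cast hnat
      _ ≤ 2 ^ 22 * ((3 * y) ^ 2 * (3 * x) * (3 * x + 3 * y)) := by gcongr
      _ = _ := by ring
  have hmain : c₁ * w ≤ x * y := by
    by_contra! hlt
    have h1 : (y * x) ^ 2 ≤ (c₁ * w) ^ 2 :=
      pow_le_pow_left₀ (by positivity) (by linarith) 2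
    have h2 : y ^ 2 * (x * y) ≤ 16 * w * (c₁ * w) := by gcongr
    have h3 : y ^ 2 * x * (x + y) < 17 * c₁ * (w * w) := by
      have h4 : c₁ * c₁ < c₁ * 1 := mul_lt_mul_of_pos_left (by rw [hc₁]; norm_num) hc₁0
      nlinarith [mul_pos (by linarith : 0 < w) (by linarith : 0 < w)]
    rw [hww] at h3
    have h5 : 17 * c₁ * n * (81 * 2 ^ 22) = n := by
      rw [hc₁]
      field_simp
    linarith
  have hdiv : c₁ * w / y ≤ x := (div_le_iff₀ hy0).2 hmain
  refine ⟨?_, (Real.exp_le_exp.2 hdiv).trans (Real.exp_log (by linarith)).le⟩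
  have hbm : (b : ℝ) ^ (m - 1) ≤ (n : ℝ) ^ (2 * n) := by
    have h1 : b ^ (m - 1) ≤ 2 * (n : ℤ) ^ n := by
      have h2 : b ^ (m - 1) ≤ ∑ i ∈ Finset.range m, b ^ i :=
        Finset.single_le_sum (f := fun i => b ^ i) (fun i _ => by positivity)
          (Finset.mem_range.2 (by omega))
      have h3 : (n.factorial : ℤ) ≤ (n : ℤ) ^ n := by exact_mod_cast Nat.factorial_le_pow n
      have h4 : (n : ℤ) ≤ (n : ℤ) ^ n := by exact_mod_cast Nat.le_self_pow (by omega) n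
      have := (abs_le.1 ha).1
      linarith
    have h5 : 2 * n ^ n ≤ n ^ (2 * n) := by
      rw [two_mul n, pow_add]
      gcongr
      exact hn.trans (Nat.le_self_pow (by omega) n)
    have h6 : b ^ (m - 1) ≤ (n : ℤ) ^ (2 * n) := h1.trans (by exact_mod_cast h5)
    exact_mod_cast h6
  have hlogm := Real.log_le_log (by positivity) hbm
  rw [Real.log_pow, Real.log_pow, Nat.cast_sub (by omega), ← hx, ← hy] at hlogm
  push_cast at hlogm
  have hm1 : (0 : ℝ) ≤ m - 1 := by
    have : (3 : ℝ) ≤ m := by exact_mod_cast hm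
    linarith
  have hm2 : (m - 1) * c₁ ≤ 2 * w * y ^ 2 := by
    have h1 : (m - 1) * c₁ * w ≤ 2 * w * y ^ 2 * w := by
      calc (m - 1) * c₁ * w = (m - 1) * (c₁ * w) := by ring
        _ ≤ (m - 1) * (x * y) := by gcongr
        _ = (m - 1) * x * y := by ring
        _ ≤ 2 * n * y * y := by gcongr
        _ = 2 * w * y ^ 2 * w := by rw [← hww]; ring
    exact le_of_mul_le_mul_right h1 (by linarith)
  have hm3 : (m : ℝ) - 1 ≤ 2 / c₁ * w * y ^ 2 := by
    rw [div_mul_eq_mul_div, div_mul_eq_mul_div]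
    exact (le_div_iff₀ hc₁0).2 hm2
  have hm4 : 1 ≤ 3 * w * y ^ 2 := by nlinarith
  linarith
end
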